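/- For all α, β > 0 there exists c > 0 such that the following holds for every prime p. Let A and B be non-empty subsets of Z_p with α|B| ≤ |A| ≤ α⁻¹|B| and |A| + |B| ≤ (1 − β)p. Then for any integers 1 ≤ c₁ ≤ |A| and 1 ≤ c₂ ≤ |B| with c₁c₂ ≥ c·max(|A|, |B|), there exist subsets A' ⊆ A and B' ⊆ B with |A'| = c₁ and |B'| = c₂ such that |A' + B'| ≥ |A| + |B| − 1. -/

import Mathlib

open Finset Pointwise
set_option linter.unusedSectionVars false
set_option linter.unusedVariables false
namespace CD
section basics
variable {G : Type*} [AddCommGroup G] [Fintype G] [DecidableEq G]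
def rr (A B : Finset G) (y : G) : ℕ := #{a ∈ A | y - a ∈ B}
def ff (t : ℕ) (A B : Finset G) : ℕ := ∑ y, min t (rr A B y)
def nn (X : Finset G) (d : G) : ℕ := #{x ∈ X | x + d ∉ X}
theorem rr_eq_sum (A B : Finset G) (y : G) :
    rr A B y = ∑ a ∈ A, if y - a ∈ B then 1 else 0 := by
  unfold rr; rw [Finset.card_filter]
theorem rr_comm (A B : Finset G) (y : G) : rr A B y = rr B A y := by
  unfold rr
  apply Finset.card_bij' (fun a _ => y - a) (fun a _ => y - a) <;> simp +contextual
theorem ff_comm (t : ℕ) (A B : Finset G) : ff t A B = ff t B A := by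
  simp only [ff, rr_comm A B]
theorem rr_le_left (A B : Finset G) (y : G) : rr A B y ≤ #A := Finset.card_filter_le _ _
theorem rr_le_right (A B : Finset G) (y : G) : rr A B y ≤ #B := by
  rw [rr_comm]; exact rr_le_left _ _ _
theorem rr_mono_right {A B B' : Finset G} (h : B ⊆ B') (y : G) : rr A B y ≤ rr A B' y := by
  apply Finset.card_le_card
  intro a; simp only [mem_filter]; exact fun ⟨h1, h2⟩ => ⟨h1, h h2⟩
theorem rr_mono_left {A A' B : Finset G} (h : A ⊆ A') (y : G) : rr A B y ≤ rr A' B y := by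
  rw [rr_comm A, rr_comm A']; exact rr_mono_right h y
theorem rr_mono {A A' B B' : Finset G} (h : A ⊆ A') (h' : B ⊆ B') (y : G) :
    rr A B y ≤ rr A' B' y := (rr_mono_left h y).trans (rr_mono_right h' y)
theorem ff_mono {t : ℕ} {A A' B B' : Finset G} (h : A ⊆ A') (h' : B ⊆ B') :
    ff t A B ≤ ff t A' B' :=
  Finset.sum_le_sum fun y _ => min_le_min le_rfl (rr_mono h h' y)
theorem sum_rr (A B : Finset G) : ∑ y, rr A B y = #A * #B := by
  simp only [rr_eq_sum]
  rw [Finset.sum_comm]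
  have : ∀ a ∈ A, ∑ y, (if y - a ∈ B then 1 else 0) = #B := by
    intro a _
    rw [← Finset.card_filter]
    apply Finset.card_bij' (fun y _ => y - a) (fun y _ => y + a) <;> simp
  rw [Finset.sum_congr rfl this]; simp
theorem rr_union_right (A : Finset G) {B C : Finset G} (h : Disjoint B C) (y : G) :
    rr A (B ∪ C) y = rr A B y + rr A C y := by
  simp only [rr_eq_sum]
  rw [← Finset.sum_add_distrib]
  apply Finset.sum_congr rfl
  intro a _
  by_cases h1 : y - a ∈ B
  · have h2 : y - a ∉ C := Finset.disjoint_left.mp h h1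
    simp [h1, h2]
  · simp [h1]
theorem rr_union_left {A C : Finset G} (B : Finset G) (h : Disjoint A C) (y : G) :
    rr (A ∪ C) B y = rr A B y + rr C B y := by
  rw [rr_comm, rr_union_right B h, rr_comm B A, rr_comm B C]
def tr (e : G) (B : Finset G) : Finset G := B.image (fun b => b + e)
@[simp] theorem mem_tr {e x : G} {B : Finset G} : x ∈ tr e B ↔ x - e ∈ B := by
  simp only [tr, mem_image]
  constructor
  · rintro ⟨b, hb, rfl⟩; simpa using hb
  · intro h; exact ⟨_, h, by simp⟩
@[simp] theorem card_tr (e : G) (B : Finset G) : #(tr e B) = #B :=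
  Finset.card_image_of_injective _ (add_left_injective e)
theorem rr_tr_right (A B : Finset G) (e y : G) : rr A (tr e B) y = rr A B (y - e) := by
  unfold rr; congr 1; ext a; simp only [mem_filter, mem_tr]
  rw [show y - a - e = y - e - a by abel]
theorem ff_tr_right (t : ℕ) (A B : Finset G) (e : G) : ff t A (tr e B) = ff t A B := by
  unfold ff
  simp only [rr_tr_right]
  exact (Equiv.subRight e).sum_comp (fun y => min t (rr A B y))
theorem ff_tr_left (t : ℕ) (A B : Finset G) (e : G) : ff t (tr e A) B = ff t A B := by
  rw [ff_comm, ff_tr_right, ff_comm]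
theorem rr_decomp (A B : Finset G) (y : G) :
    rr A B y = rr (A ∪ B) (A ∩ B) y + rr (A \ (A ∩ B)) (B \ (A ∩ B)) y := by
  set V := A ∩ B
  have hA : A = V ∪ (A \ V) := (Finset.union_sdiff_of_subset Finset.inter_subset_left).symm
  have hB : B = V ∪ (B \ V) := (Finset.union_sdiff_of_subset Finset.inter_subset_right).symm
  have hU : A ∪ B = V ∪ ((A \ V) ∪ (B \ V)) := by
    ext x; simp only [V, mem_union, mem_sdiff, mem_inter]; tauto
  have d1 : Disjoint V (A \ V) := Finset.disjoint_sdiff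
  have d2 : Disjoint V (B \ V) := Finset.disjoint_sdiff
  have d3 : Disjoint (A \ V) (B \ V) := by
    rw [Finset.disjoint_left]; simp only [V, mem_sdiff, mem_inter]; tauto
  have d4 : Disjoint V ((A \ V) ∪ (B \ V)) := by
    rw [Finset.disjoint_union_right]; exact ⟨d1, d2⟩
  have e1 : rr A B y = rr (V ∪ (A \ V)) (V ∪ (B \ V)) y := by rw [← hA, ← hB]
  rw [e1, hU, rr_union_left _ d4, rr_union_left _ d3, rr_union_left _ d1,
    rr_union_right _ d2, rr_union_right _ d2, rr_comm (B \ V) V]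
  ring
end basics
section prime
variable {p : ℕ} [hp : Fact p.Prime]
theorem eq_univ_of_closed {A : Finset (ZMod p)} (hA : A.Nonempty) {d : ZMod p} (hd : d ≠ 0)
    (h : ∀ x ∈ A, x + d ∈ A) : A = univ := by
  obtain ⟨x0, hx0⟩ := hA
  have h1 : ∀ n : ℕ, x0 + n * d ∈ A := by
    intro n
    induction n with
    | zero => simpa using hx0
    | succ n ih => have := h _ ih; push_cast; rw [add_mul, ← add_assoc, one_mul]; exact this
  ext y; simp only [mem_univ, iff_true]
  have := h1 ((y - x0) / d).val
  rw [ZMod.natCast_zmod_val, div_mul_cancel₀ _ hd] at this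
  simpa using this
theorem pollard_aux (b : ℕ) : ∀ (t : ℕ) (A B : Finset (ZMod p)), #B = b → t ≤ #A → t ≤ b →
    #A + b ≤ p + t → t * (#A + b) ≤ ff t A B + t * t := by
  induction b using Nat.strong_induction_on with
  | _ b ih =>
  intro t A B hb hta htb hab
  rcases Nat.eq_zero_or_pos t with rfl | ht
  · simp
  rcases htb.eq_or_lt with h | h
  · have : ff t A B = #A * #B := by
      rw [← sum_rr]; unfold ff
      apply Finset.sum_congr rfl
      intro y _
      have := rr_le_right A B y
      rw [min_eq_right]; omega
    rw [this, hb, ← h]; nlinarith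
  have hAne : A.Nonempty := by rw [← Finset.card_pos]; omega
  obtain ⟨b1, hb1, b2, hb2, hne⟩ := Finset.one_lt_card.mp (show 1 < #B by omega)
  have hx : ∃ x ∈ A, x + (b1 - b2) ∉ A := by
    by_contra! hcon
    have := eq_univ_of_closed hAne (sub_ne_zero.mpr hne) hcon
    rw [this, Finset.card_univ, ZMod.card] at hab
    omega
  obtain ⟨x, hxA, hxd⟩ := hx
  set B' := tr (x - b2) B with hB'
  have hcB' : #B' = b := by rw [hB', card_tr, hb]
  rw [← ff_tr_right t A B (x - b2), ← hB']
  set V := A ∩ B' with hV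
  set U := A ∪ B' with hU
  have huv : #U + #V = #A + #B' := Finset.card_union_add_card_inter A B'
  have hv0 : 0 < #V := Finset.card_pos.mpr ⟨x, by simp [hV, hB', hxA, hb2]⟩
  have hvb : #V < #B' := by
    apply Finset.card_lt_card
    refine ⟨Finset.inter_subset_right, fun hs => ?_⟩
    have h1 : b1 + (x - b2) ∈ B' := by simp [hB', hb1]
    have h2 := hs h1
    rw [hV, mem_inter] at h2
    apply hxd
    rw [show x + (b1 - b2) = b1 + (x - b2) by ring]; exact h2.1
  have hUA : #A ≤ #U := Finset.card_le_card Finset.subset_union_left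
  rcases le_or_gt t (#V) with hvt | hvt
  · have := ih (#V) (by omega) t U V rfl (by omega) hvt (by omega)
    have h2 : ff t U V ≤ ff t A B' := by
      apply Finset.sum_le_sum; intro y _
      apply min_le_min le_rfl
      rw [rr_decomp A B' y]; exact Nat.le_add_right _ _
    rw [huv, hcB'] at this
    omega
  · have cA : #(A \ V) + #V = #A := Finset.card_sdiff_add_card_eq_card Finset.inter_subset_left
    have cB : #(B' \ V) + #V = #B' := Finset.card_sdiff_add_card_eq_card Finset.inter_subset_right
    have := ih (#(B' \ V)) (by omega) (t - #V) (A \ V) (B' \ V) rfl (by omega) (by omega) (by omega)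
    have h2 : #U * #V + ff (t - #V) (A \ V) (B' \ V) ≤ ff t A B' := by
      rw [← sum_rr]; unfold ff
      rw [← Finset.sum_add_distrib]
      apply Finset.sum_le_sum; intro y _
      rw [rr_decomp A B' y]
      have := rr_le_right U V y
      change rr U V y + min (t - #V) (rr (A \ V) (B' \ V) y) ≤ min t (rr U V y + rr (A \ V) (B' \ V) y)
      omega
    obtain ⟨s, hs⟩ := Nat.exists_eq_add_of_lt hvt
    have e1 : t - #V = s + 1 := by omega
    rw [e1] at this h2
    have e2 : #A + b = #U + #V := by omega
    have e3 : #(A \ V) + #(B' \ V) + #V = #U := by omega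
    rw [e2]
    generalize ff (s+1) (A \ V) (B' \ V) = F1 at *
    generalize ff t A B' = F2 at *
    generalize #(A \ V) + #(B' \ V) = q at *
    rw [← e3] at h2 ⊢
    rw [hs]
    nlinarith
theorem pollard {t : ℕ} {A B : Finset (ZMod p)} (hta : t ≤ #A) (htb : t ≤ #B)
    (hab : #A + #B ≤ p + t) : t * (#A + #B) ≤ ff t A B + t * t :=
  pollard_aux (#B) t A B rfl hta htb hab
/-- Pollard without upper size restriction. -/
theorem pollard_min {t : ℕ} {A B : Finset (ZMod p)} (hta : t ≤ #A) (htb : t ≤ #B) :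
    t * (min (#A + #B) (p + t)) ≤ ff t A B + t * t := by
  rcases le_or_gt (#A + #B) (p + t) with h | h
  · rw [min_eq_left h]; exact pollard hta htb h
  · rw [min_eq_right h.le]
    have hA : #A ≤ p := by simpa [ZMod.card] using Finset.card_le_univ A
    obtain ⟨B', hB', hc⟩ := Finset.exists_subset_card_eq (s := B) (n := p + t - #A) (by omega)
    have := pollard (A := A) (B := B') hta (by omega) (by omega)
    have h2 := ff_mono (t := t) (subset_refl A) hB'
    rw [hc, show #A + (p + t - #A) = p + t by omega] at this
    omega
end prime
section more
variable {G : Type*} [AddCommGroup G] [Fintype G] [DecidableEq G]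
theorem ff_submod (t : ℕ) (A X Y : Finset G) :
    ff t A (X ∪ Y) + ff t A (X ∩ Y) ≤ ff t A X + ff t A Y := by
  unfold ff
  rw [← Finset.sum_add_distrib, ← Finset.sum_add_distrib]
  apply Finset.sum_le_sum; intro y _
  have h1 : rr A X y ≤ rr A (X ∪ Y) y := rr_mono_right Finset.subset_union_left y
  have h2 : rr A Y y ≤ rr A (X ∪ Y) y := rr_mono_right Finset.subset_union_right y
  have h3 : rr A (X ∩ Y) y ≤ rr A X y := rr_mono_right Finset.inter_subset_left y
  have h4 : rr A (X ∩ Y) y ≤ rr A Y y := rr_mono_right Finset.inter_subset_right y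
  have h5 : rr A (X ∪ Y) y + rr A (X ∩ Y) y = rr A X y + rr A Y y := by
    have e1 : X ∪ Y = X ∪ (Y \ X) := by simp
    have e2 : Y = (X ∩ Y) ∪ (Y \ X) := by
      ext x; simp only [mem_union, mem_inter, mem_sdiff]; tauto
    have : rr A Y y = rr A (X ∩ Y) y + rr A (Y \ X) y := by
      conv_lhs => rw [e2]
      apply rr_union_right
      rw [Finset.disjoint_left]; simp only [mem_inter, mem_sdiff]; tauto
    rw [this, e1, rr_union_right A Finset.disjoint_sdiff]
    omega
  omega
theorem nn_eq (X : Finset G) (d : G) : nn X d + #{x ∈ X | x + d ∈ X} = #X := by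
  unfold nn; rw [add_comm]
  exact Finset.card_filter_add_card_filter_not (fun x => x + d ∈ X)
theorem nn_neg (X : Finset G) (d : G) : nn X (-d) = nn X d := by
  have h1 := nn_eq X d
  have h2 := nn_eq X (-d)
  have : #{x ∈ X | x + d ∈ X} = #{x ∈ X | x + -d ∈ X} := by
    apply Finset.card_bij' (fun y _ => y + d) (fun y _ => y - d) <;> simp +contextual [sub_eq_add_neg]
  omega
theorem nn_add (X : Finset G) (d e : G) : nn X (d + e) ≤ nn X d + nn X e := by
  unfold nn
  have : #{x ∈ X | x + (d + e) ∉ X} ≤ #({x ∈ X | x + d ∉ X} ∪ {x ∈ X | x + d ∈ X ∧ x + d + e ∉ X}) := by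
    apply Finset.card_le_card
    intro x; simp only [mem_filter, mem_union]
    rw [← add_assoc]; tauto
  refine this.trans ((Finset.card_union_le _ _).trans ?_)
  gcongr 1
  apply Finset.card_le_card_of_injOn (fun x => x + d)
  · intro x; simp +contextual
  · intro x _ y _ h; simpa using h
/-- second moment -/
theorem sum_rr_sq (X V : Finset G) :
    ∑ y, (rr X V y) ^ 2 = ∑ u ∈ V, ∑ u' ∈ V, #{x ∈ X | x + (u - u') ∈ X} := by
  have h : ∀ y, (rr X V y)^2 = ∑ u ∈ V, ∑ u' ∈ V, if (y - u ∈ X ∧ y - u' ∈ X) then 1 else 0 := by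
    intro y
    rw [rr_comm, rr_eq_sum, sq, Finset.sum_mul_sum]
    apply Finset.sum_congr rfl; intro u _
    apply Finset.sum_congr rfl; intro u' _
    by_cases h1 : y - u ∈ X <;> by_cases h2 : y - u' ∈ X <;> simp [h1, h2]
  simp only [h]
  rw [Finset.sum_comm]
  apply Finset.sum_congr rfl; intro u _
  rw [Finset.sum_comm]
  apply Finset.sum_congr rfl; intro u' _
  rw [← Finset.card_filter]
  apply Finset.card_bij' (fun y _ => y - u) (fun x _ => x + u)
  · intro y; simp only [mem_filter, mem_univ, true_and]
    rintro ⟨h1, h2⟩; exact ⟨h1, by rwa [show y - u + (u - u') = y - u' by abel]⟩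
  · intro y; simp only [mem_filter, mem_univ, true_and]
    rintro ⟨h1, h2⟩
    exact ⟨by simpa using h1, by rwa [show y + u - u' = y + (u - u') by abel]⟩
  · simp
  · simp
def SS (t : ℕ) (A B : Finset G) : Finset G := univ.filter (fun y => t ≤ rr A B y)
theorem ff_eq (t : ℕ) (A B : Finset G) :
    ff t A B = t * #(SS t A B) + ∑ y ∈ univ.filter (fun y => ¬ t ≤ rr A B y), rr A B y := by
  unfold ff SS
  rw [← Finset.sum_filter_add_sum_filter_not univ (fun y => t ≤ rr A B y)]
  congr 1
  · rw [Finset.sum_congr rfl (g := fun _ => t)]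
    · simp [mul_comm]
    · intro y hy; rw [mem_filter] at hy; exact min_eq_left hy.2
  · apply Finset.sum_congr rfl; intro y hy; rw [mem_filter] at hy; omega
theorem L4 {t : ℕ} {X V : Finset G} {D : ℝ} (h : (ff t X V : ℝ) ≤ t * (#X + #V + D))
    (ht : 1 ≤ t) (hv : 2 * t ≤ #V) :
    (∑ u ∈ V, ∑ u' ∈ V, (nn X (u - u') : ℝ)) ≤ (#V : ℝ)^2 * (#V + D) := by
  have h1 : (∑ u ∈ V, ∑ u' ∈ V, (nn X (u - u') : ℝ)) + ∑ y, ((rr X V y : ℝ))^2 = (#V:ℝ)^2 * #X := by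
    have := sum_rr_sq X V
    have h2 : ∑ y, ((rr X V y : ℝ))^2 = ∑ u ∈ V, ∑ u' ∈ V, (#{x ∈ X | x + (u - u') ∈ X} : ℝ) := by
      exact_mod_cast this
    rw [h2, ← Finset.sum_add_distrib]
    have : ∀ u ∈ V, (∑ u' ∈ V, (nn X (u - u') : ℝ)) + ∑ u' ∈ V, (#{x ∈ X | x + (u - u') ∈ X} : ℝ) = #V * #X := by
      intro u _
      rw [← Finset.sum_add_distrib]
      rw [Finset.sum_congr rfl (g := fun _ => (#X : ℝ))]
      · simp
      · intro u' _; exact_mod_cast nn_eq X (u - u')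
    rw [Finset.sum_congr rfl this]; simp; ring
  set S := SS t X V
  set m : ℕ := ∑ y ∈ univ.filter (fun y => ¬ t ≤ rr X V y), rr X V y with hm
  have hff : ff t X V = t * #S + m := ff_eq t X V
  have hsum : ((∑ y ∈ S, (rr X V y : ℝ)) + m) = #X * #V := by
    have := sum_rr X V
    rw [← Finset.sum_filter_add_sum_filter_not univ (fun y => t ≤ rr X V y)] at this
    rw [hm]; exact_mod_cast this
  have h3 : ∑ y, ((rr X V y : ℝ))^2 ≥ ∑ y ∈ S, (2 * #V * (rr X V y : ℝ) - (#V:ℝ)^2) := by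
    calc ∑ y ∈ S, (2 * #V * (rr X V y : ℝ) - (#V:ℝ)^2) ≤ ∑ y ∈ S, ((rr X V y : ℝ))^2 := by
          apply Finset.sum_le_sum; intro y hy
          have a1 : (t : ℝ) ≤ rr X V y := by
            have := (Finset.mem_filter.mp hy).2
            exact_mod_cast this
          have a2 : (rr X V y : ℝ) ≤ #V := by exact_mod_cast rr_le_right X V y
          nlinarith [sq_nonneg ((#V:ℝ) - rr X V y)]
      _ ≤ _ := Finset.sum_le_sum_of_subset_of_nonneg (Finset.subset_univ _) (fun _ _ _ => sq_nonneg _)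
  rw [Finset.sum_sub_distrib, ← Finset.mul_sum] at h3
  simp only [sum_const, nsmul_eq_mul] at h3
  have h4 : ∑ y ∈ S, (rr X V y : ℝ) = #X * #V - m := by linarith
  rw [h4] at h3
  have hff' : (t * #S + m : ℝ) ≤ t * (#X + #V + D) := by
    have : (ff t X V : ℝ) = t * #S + m := by exact_mod_cast hff
    linarith
  have hm0 : (0:ℝ) ≤ m := by positivity
  have ht' : (1:ℝ) ≤ t := by exact_mod_cast ht
  have hv' : (2 * t : ℝ) ≤ #V := by exact_mod_cast hv
  have hx0 : (0:ℝ) ≤ #X := by positivity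
  have h5 : (∑ u ∈ V, ∑ u' ∈ V, (nn X (u - u') : ℝ)) ≤ (#V:ℝ)^2 * #S - (#V:ℝ)^2 * #X + 2 * #V * m := by
    nlinarith
  have h6 : (t:ℝ) * ((#V:ℝ)^2 * #S - (#V:ℝ)^2 * #X + 2 * #V * m) ≤ t * ((#V : ℝ)^2 * (#V + D)) := by
    have b1 := mul_le_mul_of_nonneg_left hff' (show (0:ℝ) ≤ (#V:ℝ)^2 by positivity)
    have b2 : 0 ≤ ((#V:ℝ) * m) * (#V - 2 * t) := mul_nonneg (by positivity) (by linarith)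
    nlinarith
  exact h5.trans (le_of_mul_le_mul_left h6 (by linarith))
end more
end CD
namespace CD
section gen
variable {G : Type*} [AddCommGroup G] [Fintype G] [DecidableEq G]
def qs (Y : Finset G) (d : G) : Finset G := {x ∈ Y | x + d ∈ Y}
theorem qs_subset (Y : Finset G) (d : G) : qs Y d ⊆ Y := Finset.filter_subset _ _
theorem nn_add_qs (Y : Finset G) (d : G) : nn Y d + #(qs Y d) = #Y := nn_eq Y d
theorem qs_eq (Y : Finset G) (d : G) : qs Y d = Y ∩ tr (-d) Y := by
  ext x; simp [qs]
theorem sum_qs (Y : Finset G) : ∑ d, #(qs Y d) = #Y * #Y := by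
  simp only [qs, Finset.card_filter]
  rw [Finset.sum_comm]
  have : ∀ a ∈ Y, ∑ d, (if a + d ∈ Y then 1 else 0) = #Y := by
    intro a _
    rw [← Finset.card_filter]
    apply Finset.card_bij' (fun y _ => a + y) (fun y _ => y - a) <;> simp
  rw [Finset.sum_congr rfl this]; simp
theorem sum_qs_qs (X Y : Finset G) :
    ∑ y, (rr X Y y) ^ 2 = ∑ d, #(qs X d) * #(qs Y d) := by
  rw [sum_rr_sq, Finset.sum_comm]
  have : ∀ u' ∈ Y, ∑ u ∈ Y, #{x ∈ X | x + (u - u') ∈ X} = ∑ d, if u' + d ∈ Y then #(qs X d) else 0 := by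
    intro u' _
    rw [← Finset.sum_filter]
    apply Finset.sum_bij' (fun u _ => u - u') (fun d _ => u' + d) <;> simp [qs]
  rw [Finset.sum_congr rfl this, Finset.sum_comm]
  apply Finset.sum_congr rfl; intro d _
  conv_rhs => rw [qs, qs, Finset.card_filter (fun x => x + d ∈ Y), Finset.mul_sum]
  apply Finset.sum_congr rfl; intro u _
  simp only [qs]; split_ifs <;> simp
theorem SS_card_le {t : ℕ} {X Y : Finset G} {E : ℝ} (ht : 1 ≤ t) (h : (ff t X Y : ℝ) ≤ t * E) :
    (#(SS t X Y) : ℝ) ≤ E := by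
  have := ff_eq t X Y
  have h2 : t * #(SS t X Y) ≤ ff t X Y := by omega
  have h3 : (t * #(SS t X Y) : ℝ) ≤ ff t X Y := by exact_mod_cast h2
  have ht' : (0:ℝ) < t := by exact_mod_cast ht
  exact le_of_mul_le_mul_left (h3.trans h) ht'
theorem energy {t : ℕ} {X Y : Finset G} {E : ℝ} (ht : 1 ≤ t) (h : (ff t X Y : ℝ) ≤ t * E)
    (h2 : 2 * t * E ≤ #X * #Y) :
    ((#X * #Y : ℝ))^2 ≤ 4 * E * ∑ d, (#(qs X d) : ℝ) * #(qs Y d) := by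
  have hS := SS_card_le ht h
  have hff := ff_eq t X Y
  have hsum := sum_rr X Y
  rw [← Finset.sum_filter_add_sum_filter_not univ (fun y => t ≤ rr X Y y)] at hsum
  set m : ℕ := ∑ y ∈ univ.filter (fun y => ¬ t ≤ rr X Y y), rr X Y y
  have hm : (m:ℝ) ≤ t * E := by
    have : m ≤ ff t X Y := by omega
    have : (m:ℝ) ≤ ff t X Y := by exact_mod_cast this
    linarith
  have hsum' : (∑ y ∈ SS t X Y, (rr X Y y : ℝ)) + m = #X * #Y := by exact_mod_cast hsum
  have hcs := sq_sum_le_card_mul_sum_sq (s := SS t X Y) (f := fun y => (rr X Y y : ℝ))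
  have hle : ∑ y ∈ SS t X Y, ((rr X Y y : ℝ))^2 ≤ ∑ d, (#(qs X d) : ℝ) * #(qs Y d) := by
    have : ∑ y, ((rr X Y y : ℝ))^2 = ∑ d, (#(qs X d) : ℝ) * #(qs Y d) := by
      exact_mod_cast sum_qs_qs X Y
    rw [← this]
    exact Finset.sum_le_sum_of_subset_of_nonneg (Finset.subset_univ _) (fun _ _ _ => sq_nonneg _)
  set Q := ∑ d, (#(qs X d) : ℝ) * #(qs Y d)
  set R := ∑ y ∈ SS t X Y, (rr X Y y : ℝ)
  set R2 := ∑ y ∈ SS t X Y, ((rr X Y y : ℝ))^2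
  have hR : (#X * #Y : ℝ) ≤ 2 * R := by nlinarith
  have hR2 : 0 ≤ R2 := Finset.sum_nonneg fun _ _ => sq_nonneg _
  have hxy : (0:ℝ) ≤ #X * #Y := by positivity
  have hE : 0 ≤ E := le_trans (by positivity) hS
  calc ((#X * #Y : ℝ))^2 ≤ (2 * R)^2 := by gcongr
    _ = 4 * R^2 := by ring
    _ ≤ 4 * (#(SS t X Y) * R2) := by gcongr
    _ ≤ 4 * (E * Q) := by gcongr
    _ = _ := by ring
end gen
section prime
variable {p : ℕ} [hp : Fact p.Prime]
theorem ff_qs {t : ℕ} {X Y : Finset (ZMod p)} {D : ℝ} (e : ZMod p)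
    (h : (ff t X Y : ℝ) ≤ t * (#X + #Y + D)) (htD : t ≤ D) (htx : t ≤ #X) (hty : t ≤ #Y)
    (hp : (#X + 2 * #Y : ℝ) ≤ p + D) :
    (ff t X (qs Y e) : ℝ) ≤ t * (#X + #(qs Y e) + 4 * D) := by
  have h1 := ff_submod t X Y (tr (-e) Y)
  rw [← qs_eq, ff_tr_right] at h1
  set U := Y ∪ tr (-e) Y
  have hu : #U + #(qs Y e) = #Y + #Y := by
    rw [qs_eq]
    have := Finset.card_union_add_card_inter Y (tr (-e) Y)
    rwa [card_tr] at this
  have hU : #Y ≤ #U := Finset.card_le_card Finset.subset_union_left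
  have h2 := pollard_min htx (hty.trans hU)
  have h1' : (ff t X U : ℝ) + ff t X (qs Y e) ≤ 2 * ff t X Y := by
    have : ff t X U + ff t X (qs Y e) ≤ 2 * ff t X Y := by omega
    exact_mod_cast this
  have h2' : (t:ℝ) * (min (#X + #U) (p + t) : ℕ) ≤ ff t X U + t * t := by exact_mod_cast h2
  have hu' : (#U : ℝ) + #(qs Y e) = 2 * #Y := by
    have : #U + #(qs Y e) = 2 * #Y := by omega
    exact_mod_cast this
  have ht0 : (0:ℝ) ≤ t := by positivity
  have hq0 : (0:ℝ) ≤ #(qs Y e) := by positivity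
  have hmin : (#X + #U - D : ℝ) ≤ (min (#X + #U) (p + t) : ℕ) := by
    push_cast
    rw [le_min_iff]
    constructor <;> linarith
  have h3 := mul_le_mul_of_nonneg_left hmin ht0
  have h4 := mul_le_mul_of_nonneg_left htD ht0
  have h5 : (t:ℝ) * #(qs Y e) = 2 * t * #Y - t * #U := by linear_combination (t:ℝ) * hu'
  nlinarith
theorem shrink_step {t : ℕ} {X Y : Finset (ZMod p)} {D ε : ℝ} (hε : 0 < ε) (hε1 : ε ≤ 1)
    (ht : 1 ≤ t)
    (h : (ff t X Y : ℝ) ≤ t * (#X + #Y + D)) (htx : 30 * t ≤ #X) (hty : 30 * t ≤ #Y)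
    (hD0 : 0 ≤ D) (hDx : 2 * D ≤ #X) (hDy : 2 * D ≤ #Y)
    (hp : (#X + 2 * #Y : ℝ) ≤ p + D) (hyx : ε * #X ≤ #Y) :
    ∃ e : ZMod p, ε / 24 * #Y ≤ #(qs Y e) ∧ (#(qs Y e) : ℝ) ≤ 0.9 * #Y := by
  set x : ℝ := ((#X : ℕ) : ℝ) with hx
  set y : ℝ := ((#Y : ℕ) : ℝ) with hy
  set M := max x y with hM
  set m := min x y with hm
  have hxM : x ≤ M := le_max_left _ _
  have hyM : y ≤ M := le_max_right _ _
  have hmM : m * M = x * y := min_mul_max x y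
  have ht1 : (1:ℝ) ≤ t := by exact_mod_cast ht
  have htm : 30 * (t:ℝ) ≤ m := le_min (by rw [hx]; exact_mod_cast htx) (by rw [hy]; exact_mod_cast hty)
  have hM0 : 0 < M := by linarith [min_le_left x y]
  have hE := energy (E := 3 * M) ht (h.trans (by gcongr; linarith)) (by
    rw [← hmM]; nlinarith)
  have hεm : ε * x ≤ m := le_min (by nlinarith [show 0 ≤ x by positivity]) hyx
  have hx0 : 0 < x := by linarith [min_le_left x y]
  have hy0 : 0 < y := by linarith [min_le_right x y]
  have hnz : ∃ d : ZMod p, d ≠ 0 ∧ ε / 24 * y ≤ #(qs Y d) := by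
    by_contra! hcon
    have hb : ∑ d, (#(qs X d) : ℝ) * #(qs Y d) ≤ x * y + ε / 24 * y * (x * x) := by
      have : ∀ d : ZMod p, (#(qs X d) : ℝ) * #(qs Y d) ≤ (if d = 0 then x * y else 0) + ε / 24 * y * #(qs X d) := by
        intro d
        split_ifs with h0
        · have e1 : (#(qs X d) : ℝ) ≤ x := by rw [hx]; exact_mod_cast Finset.card_le_card (qs_subset X d)
          have e2 : (#(qs Y d) : ℝ) ≤ y := by rw [hy]; exact_mod_cast Finset.card_le_card (qs_subset Y d)
          have e3 : (#(qs X d) : ℝ) * #(qs Y d) ≤ x * y := by gcongr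
          have e4 : 0 ≤ ε / 24 * y * #(qs X d) := by positivity
          linarith
        · have := (hcon d h0).le
          rw [zero_add, mul_comm]; gcongr
      refine (Finset.sum_le_sum fun d _ => this d).trans ?_
      rw [Finset.sum_add_distrib, ← Finset.mul_sum]
      have hs : ∑ d, (#(qs X d) : ℝ) = x * x := by
        rw [hx]; exact_mod_cast sum_qs X
      rw [hs]; simp
    have h3 := hE.trans (mul_le_mul_of_nonneg_left hb (by positivity))
    have h4 : (x*y)^2 = m * M * (x * y) := by rw [hmM]; ring
    rw [h4] at h3
    have h5 : (x * y * M) * m ≤ (x * y * M) * (12 + ε / 2 * x) := by nlinarith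
    have h6 := le_of_mul_le_mul_left h5 (by positivity)
    linarith
  obtain ⟨d, hd0, hd⟩ := hnz
  by_contra! hcon
  set H : Finset (ZMod p) := univ.filter (fun d => ε / 24 * y ≤ #(qs Y d)) with hH
  have key : ∀ e ∈ H, (nn Y e : ℝ) < 0.1 * y := by
    intro e he
    have h1 := hcon e (mem_filter.mp he).2
    have h2 : (nn Y e : ℝ) + #(qs Y e) = y := by rw [hy]; exact_mod_cast nn_add_qs Y e
    linarith
  have hclosed : ∀ e ∈ H, e + d ∈ H := by
    intro e he
    have h1 := key e he
    have h2 := key d (by simp [hH, hd])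
    have h3 : (nn Y (e + d) : ℝ) ≤ nn Y e + nn Y d := by exact_mod_cast nn_add Y e d
    have h4 : (nn Y (e+d) : ℝ) + #(qs Y (e+d)) = y := by rw [hy]; exact_mod_cast nn_add_qs Y (e+d)
    simp only [hH, mem_filter, mem_univ, true_and]
    nlinarith
  have huniv := eq_univ_of_closed ⟨d, by simp [hH, hd]⟩ hd0 hclosed
  have hsum : (p:ℝ) * (0.9 * y) ≤ y * y := by
    have : ∑ d, (#(qs Y d) : ℝ) = y * y := by rw [hy]; exact_mod_cast sum_qs Y
    rw [← this]
    have : ∑ d : ZMod p, (0.9 * y) ≤ ∑ d, (#(qs Y d) : ℝ) := by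
      apply Finset.sum_le_sum; intro e _
      exact (hcon e (mem_filter.mp (by rw [huniv]; simp : e ∈ H)).2).le
    simpa [ZMod.card] using this
  have : (p:ℝ) * 0.9 ≤ y := by
    apply le_of_mul_le_mul_right _ hy0
    linarith
  linarith
theorem shrink_aux (k : ℕ) : ∀ {t : ℕ} {X Y : Finset (ZMod p)} {D ε : ℝ}, 0 < ε → ε ≤ 1 →
    1 ≤ t → (ff t X Y : ℝ) ≤ t * (#X + #Y + D) → t ≤ D → 30 * 4 ^ k * D ≤ ε * #X →
    (#X + 2 * #Y : ℝ) ≤ p + D → ε * #X ≤ #Y → (#Y : ℝ) ≤ (10/9) ^ k * (ε * #X) →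
    ∃ V ⊆ Y, ε ^ 2 / 24 * #X ≤ #V ∧ (#V : ℝ) ≤ ε * #X ∧
      (ff t X V : ℝ) ≤ t * (#X + #V + 4 ^ k * D) := by
  induction k with
  | zero =>
    intro t X Y D ε hε hε1 ht h htD hD hp hyx hyk
    refine ⟨Y, subset_rfl, ?_, by simpa using hyk, by simpa using h⟩
    have : ε ^ 2 / 24 * (#X : ℝ) ≤ ε * #X := by gcongr; nlinarith
    linarith
  | succ k ih =>
    intro t X Y D ε hε hε1 ht h htD hD hp hyx hyk
    have ht1 : (1:ℝ) ≤ t := by exact_mod_cast ht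
    have hD0 : 0 < D := by linarith
    have h4 : (1:ℝ) ≤ 4 ^ k := one_le_pow₀ (by norm_num)
    have h4s : (4:ℝ) ^ (k+1) = 4 * 4 ^ k := by ring
    rw [h4s] at hD ⊢
    have h30 : 120 * D ≤ ε * #X := by nlinarith
    have hxx : ε * #X ≤ (#X : ℝ) := by nlinarith [show (0:ℝ) ≤ #X by positivity]
    have htx : 30 * t ≤ #X := by
      have : (30 * t : ℝ) ≤ #X := by linarith
      exact_mod_cast this
    have hty : 30 * t ≤ #Y := by
      have : (30 * t : ℝ) ≤ #Y := by linarith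
      exact_mod_cast this
    by_cases hy : (#Y : ℝ) ≤ ε * #X
    · refine ⟨Y, subset_rfl, ?_, hy, ?_⟩
      · have : ε ^ 2 / 24 * (#X : ℝ) ≤ ε * #X := by gcongr; nlinarith
        linarith
      · refine h.trans ?_
        gcongr
        nlinarith
    obtain ⟨e, he1, he2⟩ := shrink_step hε hε1 ht h htx hty hD0.le (by linarith) (by linarith) hp hyx
    have hq := ff_qs e h htD (by omega) (by omega) hp
    have hv : ε ^ 2 / 24 * #X ≤ (#(qs Y e) : ℝ) := by
      calc ε ^ 2 / 24 * #X = ε / 24 * (ε * #X) := by ring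
        _ ≤ ε / 24 * #Y := by gcongr
        _ ≤ _ := he1
    by_cases hve : (#(qs Y e) : ℝ) ≤ ε * #X
    · refine ⟨qs Y e, qs_subset _ _, hv, hve, hq.trans ?_⟩
      gcongr
      nlinarith
    · have hle : (#(qs Y e) : ℝ) ≤ #Y := by exact_mod_cast Finset.card_le_card (qs_subset Y e)
      obtain ⟨V, hV, h1, h2, h3⟩ := ih (Y := qs Y e) (D := 4 * D) hε hε1 ht hq (by linarith) (by nlinarith)
        (by linarith) (by linarith) (by rw [pow_succ] at hyk; nlinarith)
      refine ⟨V, hV.trans (qs_subset _ _), h1, h2, ?_⟩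
      convert h3 using 3; ring
/-- Shrinking lemma. -/
theorem shrink (ε K : ℝ) (hε : 0 < ε) (hε1 : ε ≤ 1) : ∃ C η : ℝ, 1 ≤ C ∧ 0 < η ∧
    ∀ (p : ℕ) [Fact p.Prime] (t : ℕ) (X Y : Finset (ZMod p)) (D : ℝ),
    1 ≤ t → (ff t X Y : ℝ) ≤ t * (#X + #Y + D) → t ≤ D → D ≤ η * #X →
    (#X + 2 * #Y : ℝ) ≤ p + D → ε * #X ≤ #Y → (#Y : ℝ) ≤ K * #X →
    ∃ V ⊆ Y, ε ^ 2 / 24 * #X ≤ #V ∧ (#V : ℝ) ≤ ε * #X ∧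
      (ff t X V : ℝ) ≤ t * (#X + #V + C * D) := by
  obtain ⟨k, hk⟩ := pow_unbounded_of_one_lt (K / ε) (show (1:ℝ) < 10/9 by norm_num)
  refine ⟨4 ^ k, ε / (30 * 4 ^ k), one_le_pow₀ (by norm_num), by positivity, ?_⟩
  intro p _ t X Y D ht h htD hD hp hyx hyK
  refine shrink_aux k hε hε1 ht h htD ?_ hp hyx ?_
  · have : (0:ℝ) < 30 * 4 ^ k := by positivity
    calc 30 * 4 ^ k * D ≤ 30 * 4 ^ k * (ε / (30 * 4 ^ k) * #X) := by gcongr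
      _ = ε * #X := by field_simp
  · refine hyK.trans ?_
    rw [← mul_assoc]; gcongr
    rw [div_lt_iff₀ hε] at hk; exact hk.le
end prime
end CD
namespace CD
section fourier
variable {p : ℕ} [hp : Fact p.Prime]
noncomputable def cc (z : ZMod p) : ℝ := (ZMod.stdAddChar (N := p) z).re
theorem cc_zero : cc (0 : ZMod p) = 1 := by simp [cc]
theorem cc_mul (a b : ZMod p) : cc a * cc b = (cc (a + b) + cc (a - b)) / 2 := by
  unfold cc
  rw [sub_eq_add_neg, AddChar.map_add_eq_mul, AddChar.map_add_eq_mul, AddChar.map_neg_eq_conj]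
  simp only [Complex.mul_re, Complex.conj_re, Complex.conj_im]
  ring
theorem sum_cc (z : ZMod p) : ∑ ξ : ZMod p, cc (ξ * z) = if z = 0 then (p:ℝ) else 0 := by
  have := AddChar.sum_mulShift z (ZMod.isPrimitive_stdAddChar p)
  have h := congrArg Complex.re this
  rw [Complex.re_sum] at h
  unfold cc; rw [h]
  split_ifs <;> simp [ZMod.card]
noncomputable def ww (X : Finset (ZMod p)) (ξ : ZMod p) : ℝ :=
  ∑ x ∈ X, ∑ x' ∈ X, cc (ξ * (x - x'))
theorem ww_nonneg (X : Finset (ZMod p)) (ξ : ZMod p) : 0 ≤ ww X ξ := by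
  have : ww X ξ = Complex.normSq (∑ x ∈ X, ZMod.stdAddChar (N := p) (ξ * x)) := by
    have h2 : ((Complex.normSq (∑ x ∈ X, ZMod.stdAddChar (N := p) (ξ * x)) : ℝ) : ℂ) =
        ∑ x ∈ X, ∑ x' ∈ X, ZMod.stdAddChar (N := p) (ξ * (x - x')) := by
      rw [← Complex.mul_conj, map_sum, Finset.sum_mul_sum]
      apply Finset.sum_congr rfl; intro x _
      apply Finset.sum_congr rfl; intro x' _
      rw [← AddChar.map_neg_eq_conj, ← AddChar.map_add_eq_mul]
      congr 1; ring
    have h3 := congrArg Complex.re h2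
    rw [Complex.ofReal_re, Complex.re_sum] at h3
    rw [h3]; unfold ww cc
    apply Finset.sum_congr rfl; intro x _
    rw [Complex.re_sum]
  rw [this]; exact Complex.normSq_nonneg _
theorem ww_zero (X : Finset (ZMod p)) : ww X 0 = (#X : ℝ) * #X := by
  simp [ww, cc_zero]
theorem sum_ww (X : Finset (ZMod p)) : ∑ ξ, ww X ξ = p * (#X : ℝ) := by
  unfold ww
  rw [Finset.sum_comm]
  have : ∀ x ∈ X, ∑ ξ, ∑ x' ∈ X, cc (ξ * (x - x')) = p := by
    intro x hx
    rw [Finset.sum_comm]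
    simp only [sum_cc, sub_eq_zero]
    rw [Finset.sum_ite_eq, if_pos hx]
  rw [Finset.sum_congr rfl this]; simp; ring
theorem sum_ww_cc (X : Finset (ZMod p)) (d : ZMod p) :
    ∑ ξ, ww X ξ * cc (ξ * d) = p * (#(qs X d) : ℝ) := by
  unfold ww
  have h1 : ∀ ξ : ZMod p, (∑ x ∈ X, ∑ x' ∈ X, cc (ξ * (x - x'))) * cc (ξ * d) =
      ∑ x ∈ X, ∑ x' ∈ X, (cc (ξ * (x + d - x')) + cc (ξ * (x + -d - x'))) / 2 := by
    intro ξ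
    rw [Finset.sum_mul]
    apply Finset.sum_congr rfl; intro x _
    rw [Finset.sum_mul]
    apply Finset.sum_congr rfl; intro x' _
    rw [cc_mul]; congr 3 <;> ring
  simp only [h1]
  rw [Finset.sum_comm]
  have h2 : ∀ x ∈ X, ∑ ξ, ∑ x' ∈ X, (cc (ξ * (x + d - x')) + cc (ξ * (x + -d - x'))) / 2 =
      p * ((if x + d ∈ X then 1 else 0) + (if x + -d ∈ X then 1 else 0)) / 2 := by
    intro x _
    rw [Finset.sum_comm]
    have : ∀ x' ∈ X, ∑ ξ : ZMod p, (cc (ξ * (x + d - x')) + cc (ξ * (x + -d - x'))) / 2 =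
      ((if x + d = x' then (p:ℝ) else 0) + (if x + -d = x' then (p:ℝ) else 0)) / 2 := by
      intro x' _
      rw [← Finset.sum_div, Finset.sum_add_distrib, sum_cc, sum_cc]
      simp only [sub_eq_zero]
    rw [Finset.sum_congr rfl this, ← Finset.sum_div, Finset.sum_add_distrib,
      Finset.sum_ite_eq, Finset.sum_ite_eq]
    split_ifs <;> ring
  rw [Finset.sum_congr rfl h2, ← Finset.sum_div, ← Finset.mul_sum, Finset.sum_add_distrib]
  rw [← Finset.natCast_card_filter, ← Finset.natCast_card_filter]
  have h3 := nn_add_qs X d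
  have h4 := nn_add_qs X (-d)
  rw [nn_neg] at h4
  have h5 : #(qs X (-d)) = #(qs X d) := by omega
  change (p:ℝ) * ((#(qs X d) : ℝ) + #(qs X (-d))) / 2 = _
  rw [h5]; ring
theorem one_sub_cc (z : ZMod p) : 8 * ((z.valMinAbs : ℝ) / p)^2 ≤ 1 - cc z := by
  have hp0 : (0:ℝ) < p := by exact_mod_cast hp.out.pos
  have h1 : cc z = Real.cos (2 * (Real.pi * ((z.valMinAbs : ℝ) / p))) := by
    unfold cc
    conv_lhs => rw [← ZMod.coe_valMinAbs z]
    rw [ZMod.stdAddChar_coe]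
    rw [show (2 * (Real.pi:ℂ) * Complex.I * ((z.valMinAbs : ℤ):ℂ) / (p:ℂ)) =
      ((2 * (Real.pi * ((z.valMinAbs : ℝ) / p)) : ℝ) : ℂ) * Complex.I by push_cast; ring]
    rw [Complex.exp_ofReal_mul_I_re]
  rw [h1, Real.cos_two_mul]
  have h2 := Real.sin_sq_add_cos_sq (Real.pi * ((z.valMinAbs : ℝ) / p))
  have h3 := ZMod.valMinAbs_mem_Ioc z
  have h4 : |(z.valMinAbs : ℝ) / p| ≤ 1 / 2 := by
    rw [abs_div, abs_of_pos hp0, div_le_iff₀ hp0, abs_le]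
    obtain ⟨a, b⟩ := h3
    have a' : (-(p:ℝ)) < z.valMinAbs * 2 := by exact_mod_cast a
    have b' : (z.valMinAbs * 2 : ℝ) ≤ p := by exact_mod_cast b
    constructor <;> linarith
  have h5 := Real.mul_abs_le_abs_sin (x := Real.pi * ((z.valMinAbs : ℝ) / p)) (by
    rw [abs_mul, abs_of_pos Real.pi_pos]
    nlinarith [Real.pi_pos])
  rw [abs_mul, abs_of_pos Real.pi_pos, ← mul_assoc, div_mul_cancel₀ _ Real.pi_pos.ne'] at h5
  have h6 : (2 * |(z.valMinAbs : ℝ) / p|)^2 ≤ |Real.sin (Real.pi * ((z.valMinAbs : ℝ) / p))|^2 := by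
    gcongr
  rw [sq_abs, mul_pow, sq_abs] at h6
  nlinarith
theorem fourier {X V : Finset (ZMod p)} {T δ : ℝ} (hV : V.Nonempty) (hδ : 0 < δ)
    (hT : (∑ u ∈ V, ∑ u' ∈ V, (nn X (u - u') : ℝ)) ≤ T) :
    ∃ ξ : ZMod p, ξ ≠ 0 ∧ ∃ u0 ∈ V,
      (#{u ∈ V | δ * p < |((ξ * (u - u0)).valMinAbs : ℝ)|} : ℝ) * (8 * δ^2) * (#X * (p - #X)) * #V ≤ p * T := by
  have hp0 : (0:ℝ) < p := by exact_mod_cast hp.out.pos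
  set g : ZMod p → ℝ := fun ξ => ∑ u ∈ V, ∑ u' ∈ V, (1 - cc (ξ * (u - u'))) with hg
  have hsum : ∑ ξ, ww X ξ * g ξ = p * ∑ u ∈ V, ∑ u' ∈ V, (nn X (u - u') : ℝ) := by
    simp only [hg, Finset.mul_sum]
    rw [Finset.sum_comm]
    apply Finset.sum_congr rfl; intro u _
    rw [Finset.sum_comm]
    apply Finset.sum_congr rfl; intro u' _
    simp only [mul_sub, mul_one, Finset.sum_sub_distrib]
    have := sum_ww_cc X (u - u')
    simp only [mul_sub] at this
    rw [this, sum_ww]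
    have : (nn X (u-u') : ℝ) + #(qs X (u - u')) = #X := by exact_mod_cast nn_add_qs X (u - u')
    rw [← this]; ring
  obtain ⟨ξ, hξ, hmin⟩ := Finset.exists_min_image (univ.erase (0 : ZMod p)) g ⟨1, by simp⟩
  have hξ0 : ξ ≠ 0 := (Finset.mem_erase.mp hξ).1
  have hg0 : g 0 = 0 := by simp [hg, cc_zero]
  have h1 : g ξ * (#X * (p - #X)) ≤ p * T := by
    have e1 : ∑ ξ ∈ univ.erase (0 : ZMod p), ww X ξ = #X * (p - #X) := by
      have := Finset.add_sum_erase univ (fun ξ => ww X ξ) (mem_univ (0 : ZMod p))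
      rw [sum_ww] at this
      rw [ww_zero] at this
      linarith
    have e2 : ∑ ξ ∈ univ.erase (0 : ZMod p), ww X ξ * g ξ = p * ∑ u ∈ V, ∑ u' ∈ V, (nn X (u - u') : ℝ) := by
      rw [← hsum, ← Finset.add_sum_erase univ (fun ξ => ww X ξ * g ξ) (mem_univ (0 : ZMod p))]
      simp [hg0]
    calc g ξ * (#X * (p - #X)) = ∑ ξ' ∈ univ.erase (0 : ZMod p), ww X ξ' * g ξ := by
          rw [← e1, Finset.mul_sum]; apply Finset.sum_congr rfl; intros; ring
      _ ≤ ∑ ξ' ∈ univ.erase (0 : ZMod p), ww X ξ' * g ξ' :=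
          Finset.sum_le_sum fun ξ' h => mul_le_mul_of_nonneg_left (hmin ξ' h) (ww_nonneg _ _)
      _ = p * ∑ u ∈ V, ∑ u' ∈ V, (nn X (u - u') : ℝ) := e2
      _ ≤ _ := by gcongr
  have h2 : ∃ u0 ∈ V, (#V : ℝ) * ∑ u ∈ V, (1 - cc (ξ * (u - u0))) ≤ g ξ := by
    have : g ξ = ∑ u0 ∈ V, ∑ u ∈ V, (1 - cc (ξ * (u - u0))) := by
      rw [hg]; exact Finset.sum_comm
    obtain ⟨u0, hu0, hm⟩ := Finset.exists_min_image V (fun u0 => ∑ u ∈ V, (1 - cc (ξ * (u - u0)))) hV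
    refine ⟨u0, hu0, ?_⟩
    rw [this, ← nsmul_eq_mul]
    exact Finset.card_nsmul_le_sum _ _ _ hm
  obtain ⟨u0, hu0, h3⟩ := h2
  refine ⟨ξ, hξ0, u0, hu0, ?_⟩
  set Bd := {u ∈ V | δ * p < |((ξ * (u - u0)).valMinAbs : ℝ)|}
  have h4 : (#Bd : ℝ) * (8 * δ^2) ≤ ∑ u ∈ V, (1 - cc (ξ * (u - u0))) := by
    calc (#Bd : ℝ) * (8 * δ^2) = ∑ u ∈ Bd, 8 * δ^2 := by simp
      _ ≤ ∑ u ∈ Bd, (1 - cc (ξ * (u - u0))) := by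
        apply Finset.sum_le_sum; intro u hu
        have h5 := (mem_filter.mp hu).2
        refine le_trans ?_ (one_sub_cc _)
        have : δ ≤ |((ξ * (u - u0)).valMinAbs : ℝ) / p| := by
          rw [abs_div, abs_of_pos hp0, le_div_iff₀ hp0]; exact h5.le
        rw [← sq_abs (_ / _)]
        gcongr
      _ ≤ _ := by
        apply Finset.sum_le_sum_of_subset_of_nonneg (Finset.filter_subset _ _)
        intro u _ _
        exact le_trans (by positivity) (one_sub_cc _)
  have hX0 : (0:ℝ) ≤ #X * (p - #X) := by
    have : #X ≤ p := by simpa [ZMod.card] using Finset.card_le_univ X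
    have : (#X : ℝ) ≤ p := by exact_mod_cast this
    apply mul_nonneg (by positivity); linarith
  calc (#Bd : ℝ) * (8 * δ^2) * (#X * (p - #X)) * #V
      ≤ (∑ u ∈ V, (1 - cc (ξ * (u - u0)))) * (#X * (p - #X)) * #V := by gcongr
    _ = (#V * ∑ u ∈ V, (1 - cc (ξ * (u - u0)))) * (#X * (p - #X)) := by ring
    _ ≤ g ξ * (#X * (p - #X)) := by gcongr
    _ ≤ _ := h1
end fourier
end CD
namespace CD
theorem group_lemma {G : Type*} [AddCommGroup G] [Fintype G] [DecidableEq G]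
    (P F : Finset G) (σ : ℝ) (hσ : 0 ≤ σ) (hF : ∀ z ∈ F, (nn P z : ℝ) ≤ σ)
    (hc : (#P : ℝ)^2 < 2 * #F * (#P - 5 * σ)) (h5 : 5 * σ < #P) :
    ∃ H : AddSubgroup G, (∀ z ∈ F, z ∈ H) ∧ (Nat.card H : ℝ) * (#P - 2 * σ) ≤ (#P : ℝ)^2 := by
  classical
  let K : ℝ → Finset G := fun s => univ.filter (fun z => (nn P z : ℝ) ≤ s)
  have hK : ∀ s z, z ∈ K s ↔ (nn P z : ℝ) ≤ s := by intro s z; simp [K]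
  have hKc : ∀ s, (#(K s) : ℝ) * (#P - s) ≤ (#P : ℝ)^2 := by
    intro s
    calc (#(K s) : ℝ) * (#P - s) = ∑ z ∈ K s, ((#P : ℝ) - s) := by rw [Finset.sum_const, nsmul_eq_mul]
      _ ≤ ∑ z ∈ K s, (#(qs P z) : ℝ) := by
        apply Finset.sum_le_sum; intro z hz
        have h1 := (hK s z).mp hz
        have h2 : (nn P z : ℝ) + #(qs P z) = #P := by exact_mod_cast nn_add_qs P z
        linarith
      _ ≤ ∑ z, (#(qs P z) : ℝ) :=
        Finset.sum_le_sum_of_subset_of_nonneg (Finset.subset_univ _) (fun _ _ _ => by positivity)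
      _ = (#P : ℝ)^2 := by rw [sq]; exact_mod_cast sum_qs P
  have key : ∀ z, (nn P z : ℝ) ≤ 4 * σ → (nn P z : ℝ) ≤ 2 * σ := by
    intro z hz
    have hlt : #(K (5 * σ)) < 2 * #F := by
      have h1 := hKc (5 * σ)
      have h2 : (#(K (5*σ)) : ℝ) * (#P - 5 * σ) < (2 * #F) * (#P - 5 * σ) := by linarith
      have := lt_of_mul_lt_mul_right h2 (by linarith)
      exact_mod_cast this
    set F' := F.image (fun x => z - x) with hF'
    have hcF' : #F' = #F := Finset.card_image_of_injective _ (sub_right_injective)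
    have hs1 : F ⊆ K (5 * σ) := by
      intro x hx; rw [hK]; linarith [hF x hx]
    have hs2 : F' ⊆ K (5 * σ) := by
      intro y hy
      rw [hF', mem_image] at hy
      obtain ⟨x, hx, rfl⟩ := hy
      rw [hK]
      have h1 : (nn P (z + -x) : ℝ) ≤ nn P z + nn P (-x) := by exact_mod_cast nn_add P z (-x)
      rw [nn_neg] at h1
      rw [sub_eq_add_neg]
      linarith [hF x hx]
    have hnd : ¬ Disjoint F F' := by
      intro hd
      have := Finset.card_le_card (Finset.union_subset hs1 hs2)
      rw [Finset.card_union_of_disjoint hd] at this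
      omega
    rw [Finset.not_disjoint_iff] at hnd
    obtain ⟨a, ha, ha'⟩ := hnd
    rw [hF', mem_image] at ha'
    obtain ⟨b, hb, hab⟩ := ha'
    have : z = a + b := by rw [← hab]; abel
    rw [this]
    have h1 : (nn P (a + b) : ℝ) ≤ nn P a + nn P b := by exact_mod_cast nn_add P a b
    linarith [hF a ha, hF b hb]
  let H : AddSubgroup G :=
    { carrier := {z | (nn P z : ℝ) ≤ 2 * σ}
      zero_mem' := by
        change (nn P 0 : ℝ) ≤ 2 * σ
        have : nn P 0 = 0 := by simp [nn]
        rw [this]; simp; exact hσ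
      add_mem' := by
        intro a b ha hb
        simp only [Set.mem_ofPred_eq] at ha hb ⊢
        apply key
        have h1 : (nn P (a + b) : ℝ) ≤ nn P a + nn P b := by exact_mod_cast nn_add P a b
        linarith
      neg_mem' := by
        intro a ha
        simp only [Set.mem_ofPred_eq] at ha ⊢
        rwa [nn_neg] }
  refine ⟨H, fun z hz => ?_, ?_⟩
  · change (nn P z : ℝ) ≤ 2 * σ
    linarith [hF z hz]
  · have : Nat.card H = #(K (2 * σ)) := by
      exact Nat.subtype_card _ (fun z => hK (2 * σ) z)
    rw [this]; exact hKc _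
theorem class_lemma (W : Finset ℤ) (ℓ : ℕ) (hℓ : 0 < ℓ) :
    #(W.image (Int.cast : ℤ → ZMod ℓ)) ≤ #{u ∈ W | u + (ℓ:ℤ) ∉ W} := by
  refine le_trans (Finset.card_le_card (t := ({u ∈ W | u + (ℓ:ℤ) ∉ W}).image (Int.cast : ℤ → ZMod ℓ)) ?_)
    Finset.card_image_le
  intro c hc
  rw [mem_image] at hc
  obtain ⟨u0, hu0, rfl⟩ := hc
  obtain ⟨m, hm, hmax⟩ := Finset.exists_max_image (W.filter (fun u : ℤ => (u : ZMod ℓ) = u0)) (fun u : ℤ => u) ⟨u0, by simp [hu0]⟩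
  rw [mem_filter] at hm
  rw [mem_image]
  refine ⟨m, ?_, hm.2⟩
  rw [mem_filter]
  refine ⟨hm.1, fun hcon => ?_⟩
  have := hmax (m + ℓ) (by rw [mem_filter]; exact ⟨hcon, by simp [hm.2]⟩)
  omega
set_option maxHeartbeats 1000000 in
theorem int_lemma {μ : ℝ} (hμ : 0 < μ) (hμ1 : μ ≤ 1/200) {F W S : Finset ℤ}
    (h1f : 1 ≤ μ * #F) (hfw : #F ≤ μ * #W) (hS : (#S : ℝ) ≤ #W + #F + μ * #F)
    (hx : ∀ x ∈ F, (#{u ∈ W | x + u ∉ S} : ℝ) ≤ μ * #F) :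
    ∃ x0 D : ℤ, 0 < D ∧ ∃ h : ℕ, (h : ℝ) ≤ (1 + 60 * μ) * #F ∧ ∀ x ∈ F, ∃ j : ℕ, j ≤ h ∧ x = x0 + j * D := by
  set f : ℝ := ((#F : ℕ) : ℝ) with hf
  set w : ℝ := ((#W : ℕ) : ℝ) with hw
  have hf200 : 200 ≤ f := by nlinarith
  have hfn : 200 ≤ #F := by rw [hf] at hf200; exact_mod_cast hf200
  have hFne : F.Nonempty := Finset.card_pos.mp (by omega)
  set x0 := F.min' hFne with hx0
  set x1 := F.max' hFne with hx1
  have hx0F : x0 ∈ F := F.min'_mem hFne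
  have hx1F : x1 ∈ F := F.max'_mem hFne
  have hlt : x0 < x1 := Finset.min'_lt_max'_of_card F (by omega)
  obtain ⟨ℓ, hℓ⟩ := Int.eq_ofNat_of_zero_le (show 0 ≤ x1 - x0 by omega)
  have hℓ0 : 0 < ℓ := by omega
  have : NeZero ℓ := ⟨by omega⟩
  set P := W.image (Int.cast : ℤ → ZMod ℓ) with hP
  have hbd : ∀ x ∈ F, x0 ≤ x ∧ x ≤ x1 := fun x h => ⟨F.min'_le x h, F.le_max' x h⟩
  set T1 := W.image (fun u => x0 + u) with hT1
  set T2 := ({u ∈ W | u + (ℓ:ℤ) ∉ W}).image (fun u => x1 + u) with hT2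
  have cT1 : #T1 = #W := Finset.card_image_of_injective _ (add_right_injective _)
  have cT2 : #P ≤ #T2 := by
    rw [hT2, Finset.card_image_of_injective _ (add_right_injective _)]
    exact class_lemma W ℓ hℓ0
  have bad : ∀ x ∈ F, ∀ R : Finset ℤ, R ⊆ W.image (fun u => x + u) → (#R : ℝ) ≤ #(R ∩ S) + μ * f := by
    intro x hxF R hR
    have h1 : #R ≤ #(R ∩ S) + #{u ∈ W | x + u ∉ S} := by
      rw [← Finset.card_inter_add_card_sdiff R S]
      apply Nat.add_le_add_left
      refine le_trans (Finset.card_le_card (t := ({u ∈ W | x + u ∉ S}).image (fun u => x + u)) ?_) Finset.card_image_le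
      intro y hy
      rw [mem_sdiff] at hy
      obtain ⟨u, hu, rfl⟩ := mem_image.mp (hR hy.1)
      exact mem_image.mpr ⟨u, mem_filter.mpr ⟨hu, hy.2⟩, rfl⟩
    have h2 : (#R : ℝ) ≤ #(R ∩ S) + #{u ∈ W | x + u ∉ S} := by exact_mod_cast h1
    linarith [hx x hxF]
  have dT : Disjoint T1 T2 := by
    rw [Finset.disjoint_left]
    intro y h1 h2
    rw [hT1, mem_image] at h1
    rw [hT2, mem_image] at h2
    obtain ⟨u, hu, rfl⟩ := h1
    obtain ⟨v, hv, hvu⟩ := h2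
    rw [mem_filter] at hv
    apply hv.2
    rw [show v + (ℓ:ℤ) = u by omega]; exact hu
  have b1 := bad x0 hx0F T1 subset_rfl
  have b2 := bad x1 hx1F T2 (Finset.image_subset_image (Finset.filter_subset _ _))
  have castT : ∀ y ∈ T1 ∪ T2, ((y - x0 : ℤ) : ZMod ℓ) ∈ P := by
    intro y hy
    rw [mem_union] at hy
    rcases hy with h | h
    · obtain ⟨u, hu, rfl⟩ := mem_image.mp h
      rw [hP, mem_image]; exact ⟨u, hu, by simp⟩
    · obtain ⟨u, hu, rfl⟩ := mem_image.mp h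
      rw [hP, mem_image]; refine ⟨u, (mem_filter.mp hu).1, ?_⟩
      rw [show x1 + u - x0 = u + ℓ by omega]; simp
  let N : ℤ → Finset ℤ := fun x => {u ∈ W | ((x - x0 + u : ℤ) : ZMod ℓ) ∉ P}
  have hN : ∀ x ∈ F, (#(N x) : ℝ) ≤ f * (1 + 4 * μ) - #P := by
    intro x hxF
    set R := (N x).image (fun u => x + u) with hR
    have cR : #R = #(N x) := Finset.card_image_of_injective _ (add_right_injective _)
    have b3 := bad x hxF R (Finset.image_subset_image (Finset.filter_subset _ _))
    have dR : Disjoint (T1 ∪ T2) R := by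
      rw [Finset.disjoint_left]
      intro y h1 h2
      obtain ⟨u, hu, rfl⟩ := mem_image.mp h2
      have := castT _ h1
      apply (mem_filter.mp hu).2
      rwa [show x - x0 + u = x + u - x0 by ring]
    have hc : #(T1 ∩ S) + #(T2 ∩ S) + #(R ∩ S) ≤ #S := by
      rw [← Finset.card_union_of_disjoint, ← Finset.card_union_of_disjoint]
      · apply Finset.card_le_card
        rw [← Finset.union_inter_distrib_right, ← Finset.union_inter_distrib_right]
        exact Finset.inter_subset_right
      · rw [← Finset.union_inter_distrib_right]
        exact Finset.disjoint_of_subset_left Finset.inter_subset_left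
          (Finset.disjoint_of_subset_right Finset.inter_subset_left dR)
      · exact Finset.disjoint_of_subset_left Finset.inter_subset_left
          (Finset.disjoint_of_subset_right Finset.inter_subset_left dT)
    have hc' : (#(T1 ∩ S) + #(T2 ∩ S) + #(R ∩ S) : ℝ) ≤ #S := by exact_mod_cast hc
    have cT1' : (#T1 : ℝ) = w := by rw [hw]; exact_mod_cast cT1
    have cT2' : (#P : ℝ) ≤ #T2 := by exact_mod_cast cT2
    have cR' : (#R : ℝ) = #(N x) := by exact_mod_cast cR
    linarith
  have hPup : (#P : ℝ) ≤ f * (1 + 4 * μ) := by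
    have := hN x0 hx0F
    have h0 : (0:ℝ) ≤ #(N x0) := by positivity
    linarith
  have hw0 : 0 < w := by nlinarith
  have hWne : W.Nonempty := Finset.card_pos.mp (by rw [hw] at hw0; exact_mod_cast hw0)
  have hPlow : f - 3 * μ * f - 1 ≤ #P := by
    have hsw : ∑ u ∈ W, #{x ∈ F | ((x - x0 + u : ℤ) : ZMod ℓ) ∉ P} = ∑ x ∈ F, #(N x) := by
      simp only [N, Finset.card_filter]
      rw [Finset.sum_comm]
    obtain ⟨u, hu, hmin⟩ := Finset.exists_min_image W
      (fun u => #{x ∈ F | ((x - x0 + u : ℤ) : ZMod ℓ) ∉ P}) hWne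
    set bu := #{x ∈ F | ((x - x0 + u : ℤ) : ZMod ℓ) ∉ P} with hbu
    have h1 : #W * bu ≤ ∑ x ∈ F, #(N x) := by
      rw [← hsw, ← smul_eq_mul]; exact Finset.card_nsmul_le_sum _ _ _ hmin
    have h2 : (∑ x ∈ F, (#(N x) : ℝ)) ≤ f * (f * (1 + 4 * μ)) := by
      rw [hf, ← nsmul_eq_mul]
      apply Finset.sum_le_card_nsmul
      intro x hxF
      have := hN x hxF
      have h0 : (0:ℝ) ≤ #P := by positivity
      linarith
    have h1' : w * bu ≤ ∑ x ∈ F, (#(N x) : ℝ) := by rw [hw]; exact_mod_cast h1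
    have h3 : (bu : ℝ) ≤ 3 * μ * f := by
      have : w * bu ≤ w * (3 * μ * f) := by
        have e1 : f * (f * (1 + 4 * μ)) ≤ (μ * w) * (f * (1 + 4 * μ)) := by gcongr
        have e2 : (μ * w) * (f * (1 + 4 * μ)) ≤ (μ * w) * (f * 3) := by gcongr; linarith
        nlinarith
      exact le_of_mul_le_mul_left this hw0
    set Gd0 := {x ∈ F | ((x - x0 + u : ℤ) : ZMod ℓ) ∈ P} with hGd0
    set Gd := Gd0.erase x1 with hGd
    have h4 : #F ≤ #Gd + 1 + bu := by
      have e1 := Finset.card_filter_add_card_filter_not (s := F) (fun x => ((x - x0 + u : ℤ) : ZMod ℓ) ∈ P)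
      have e2 := Finset.pred_card_le_card_erase (s := Gd0) (a := x1)
      have e3 : #Gd = #(Gd0.erase x1) := rfl
      have e4 : #Gd0 = #{x ∈ F | ((x - x0 + u : ℤ) : ZMod ℓ) ∈ P} := rfl
      have e5 : bu = #{x ∈ F | ((x - x0 + u : ℤ) : ZMod ℓ) ∉ P} := rfl
      omega
    have h5 : #Gd ≤ #P := by
      apply Finset.card_le_card_of_injOn (fun x => ((x - x0 + u : ℤ) : ZMod ℓ))
      · intro x hxG
        have := mem_of_mem_erase (mem_coe.mp hxG)
        exact (mem_filter.mp this).2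
      · intro x hxG y hyG hxy
        have a1 := mem_erase.mp (mem_coe.mp hxG)
        have a2 := mem_erase.mp (mem_coe.mp hyG)
        have c1 := hbd x (mem_filter.mp a1.2).1
        have c2 := hbd y (mem_filter.mp a2.2).1
        have d1 := a1.1
        have d2 := a2.1
        simp only [ZMod.intCast_eq_intCast_iff] at hxy
        have hdvd := hxy.dvd
        have : y - x0 + u - (x - x0 + u) = y - x := by ring
        rw [this] at hdvd
        have := Int.eq_zero_of_abs_lt_dvd hdvd (by rw [abs_lt]; constructor <;> omega)
        omega
    have h6 : (f : ℝ) ≤ #P + 1 + bu := by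
      rw [hf]
      have : #F ≤ #P + 1 + bu := by omega
      exact_mod_cast this
    linarith
  set σ := 8 * μ * f with hσ
  have hnnP : ∀ x ∈ F, (nn P ((x - x0 : ℤ) : ZMod ℓ) : ℝ) ≤ σ := by
    intro x hxF
    have h1 : nn P ((x - x0 : ℤ) : ZMod ℓ) ≤ #(N x) := by
      refine le_trans (Finset.card_le_card (t := (N x).image (Int.cast : ℤ → ZMod ℓ)) ?_) Finset.card_image_le
      intro c hc
      rw [mem_filter] at hc
      obtain ⟨u, hu, rfl⟩ := mem_image.mp hc.1
      refine mem_image.mpr ⟨u, mem_filter.mpr ⟨hu, ?_⟩, rfl⟩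
      rw [Int.cast_add, add_comm]; exact hc.2
    have h1' : (nn P ((x - x0 : ℤ) : ZMod ℓ) : ℝ) ≤ #(N x) := by exact_mod_cast h1
    have := hN x hxF
    rw [hσ]; linarith
  set Fb := (F.erase x1).image (fun x => ((x - x0 : ℤ) : ZMod ℓ)) with hFb
  have cFb : #Fb = #F - 1 := by
    rw [hFb, Finset.card_image_of_injOn, Finset.card_erase_of_mem hx1F]
    intro x hxG y hyG hxy
    have a1 := mem_erase.mp (mem_coe.mp hxG)
    have a2 := mem_erase.mp (mem_coe.mp hyG)
    have c1 := hbd x a1.2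
    have c2 := hbd y a2.2
    have d1 := a1.1
    have d2 := a2.1
    simp only [ZMod.intCast_eq_intCast_iff] at hxy
    have hdvd := hxy.dvd
    have : y - x0 - (x - x0) = y - x := by ring
    rw [this] at hdvd
    have := Int.eq_zero_of_abs_lt_dvd hdvd (by rw [abs_lt]; constructor <;> omega)
    omega
  have cFb' : (#Fb : ℝ) = f - 1 := by
    rw [cFb, hf, Nat.cast_sub (by omega)]; simp
  have hμf : μ * f ≤ f / 200 := by nlinarith
  have hP1 : (#P : ℝ) ≤ 1.02 * f := by linarith
  have hP2 : 0.98 * f ≤ (#P : ℝ) := by linarith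
  obtain ⟨H, hH1, hH2⟩ := group_lemma P Fb σ (by positivity) (by
      intro z hz
      obtain ⟨x, hxF, rfl⟩ := mem_image.mp hz
      exact hnnP x (mem_of_mem_erase hxF)) (by
      rw [cFb']
      have e1 : (#P : ℝ)^2 ≤ (1.02 * f)^2 := by gcongr
      have e2 : 2 * (0.99 * f) * (0.78 * f) ≤ 2 * (f - 1) * (#P - 5 * σ) := by
        apply mul_le_mul <;> nlinarith
      nlinarith) (by rw [hσ]; nlinarith)
  set h := Nat.card H with hh
  have hdvd : h ∣ ℓ := by
    have := AddSubgroup.card_addSubgroup_dvd_card H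
    simpa using this
  obtain ⟨D, hD⟩ := hdvd
  have hD0 : 0 < D := by
    rcases Nat.eq_zero_or_pos D with h0 | h0
    · rw [h0] at hD; omega
    · exact h0
  have hh0 : 0 < h := by
    rcases Nat.eq_zero_or_pos h with h0 | h0
    · rw [h0] at hD; omega
    · exact h0
  refine ⟨x0, D, by exact_mod_cast hD0, h, ?_, ?_⟩
  · have e1 : 0 < (#P : ℝ) - 2 * σ := by rw [hσ]; nlinarith
    have e2 : (#P : ℝ)^2 ≤ (1 + 60 * μ) * f * (#P - 2 * σ) := by
      rw [hσ]
      set P' := (#P : ℝ)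
      have g1 : P' ≤ f + 4 * (μ * f) := by linarith
      have g2 : f - 4 * (μ * f) ≤ P' := by linarith
      have g3 : P' ^ 2 ≤ P' * (f + 4 * (μ * f)) := by nlinarith
      have g4 : P' * (f + 4 * (μ * f)) ≤ (1 + 60 * μ) * f * (P' - 2 * (8 * μ * f)) := by
        have g5 : (1 + 60 * μ) * f * (16 * (μ * f)) ≤ 1.3 * f * (16 * (μ * f)) := by
          gcongr; linarith
        have g6 : 0 ≤ (μ * f) * (P' - 0.98 * f) := mul_nonneg (by positivity) (by linarith)
        have g7 : 0 ≤ (μ * f) * f := by positivity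
        nlinarith
      linarith
    exact le_of_mul_le_mul_right (hH2.trans e2) e1
  · intro x hxF
    obtain ⟨y, hy⟩ := Int.eq_ofNat_of_zero_le (show 0 ≤ x - x0 by have := (hbd x hxF).1; omega)
    have hmem : ((x - x0 : ℤ) : ZMod ℓ) ∈ H := by
      by_cases hxx : x = x1
      · rw [hxx, hℓ]; simp
      · exact hH1 _ (mem_image.mpr ⟨x, mem_erase.mpr ⟨hxx, hxF⟩, rfl⟩)
    rw [hy] at hmem
    have h0 : h • ((y : ℤ) : ZMod ℓ) = 0 := by
      have := card_nsmul_eq_zero' (x := (⟨_, hmem⟩ : H))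
      have := congrArg Subtype.val this
      rw [AddSubgroup.coe_nsmul] at this
      exact this
    have h1 : ((h * y : ℕ) : ZMod ℓ) = 0 := by push_cast; simpa using h0
    rw [ZMod.natCast_eq_zero_iff, hD] at h1
    have h2 := Nat.dvd_of_mul_dvd_mul_left hh0 h1
    obtain ⟨j, hj⟩ := h2
    refine ⟨j, ?_, ?_⟩
    · have h3 : (y : ℤ) ≤ ℓ := by have := (hbd x hxF).2; omega
      have h4 : y ≤ ℓ := by exact_mod_cast h3
      rw [hj, hD, mul_comm] at h4
      exact Nat.le_of_mul_le_mul_right h4 hD0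
    · have : x = x0 + (y:ℤ) := by omega
      rw [this, hj]; push_cast; ring
end CD
namespace CD
section interval
variable {p : ℕ} [hp : Fact p.Prime]
def arc (d s : ZMod p) (len : ℕ) : Finset (ZMod p) := (range len).image (fun j : ℕ => s + d * j)
theorem mem_arc {d s x : ZMod p} {len : ℕ} : x ∈ arc d s len ↔ ∃ j : ℕ, j < len ∧ x = s + d * j := by
  simp only [arc, mem_image, mem_range]
  constructor
  · rintro ⟨j, hj, rfl⟩; exact ⟨j, hj, rfl⟩
  · rintro ⟨j, hj, rfl⟩; exact ⟨j, hj, rfl⟩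
theorem card_arc_le (d s : ZMod p) (len : ℕ) : #(arc d s len) ≤ len := by
  unfold arc; exact (Finset.card_image_le).trans (by simp)
theorem val_add_small {a : ZMod p} {j : ℕ} (h : a.val + j < p) : (a + j).val = a.val + j := by
  have : a + (j : ZMod p) = ((a.val + j : ℕ) : ZMod p) := by push_cast; simp
  rw [this, ZMod.val_natCast_of_lt h]
set_option maxHeartbeats 1000000 in
theorem lemmaL0 {t L H : ℕ} {A W : Finset (ZMod p)} {Δ : ℝ} (hW : W ⊆ arc 1 0 L)
    (hLW : L ≤ #W + H) (hL : L ≤ p) (ht : 1 ≤ t) (htW : t ≤ #W)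
    (hff : (ff t A W : ℝ) ≤ t * (#A + L + Δ)) (hΔ0 : 0 ≤ Δ) (hΔ : Δ + 4 * H + 4 * t < L)
    (hp' : (#A + L + Δ : ℝ) < p) (ha : 2 * t + H ≤ #A)
    (h0 : #{a ∈ A | p ≤ a.val + L} < t + H) :
    ∃ (s : ZMod p) (len : ℕ), (len : ℝ) ≤ #A + Δ + 1 ∧ #(A \ arc 1 s len) ≤ 5 * t + 3 * H := by
  have hWL : #W ≤ L := (Finset.card_le_card hW).trans (card_arc_le _ _ _)
  have hL0 : 0 < L := by omega
  have hp0 : 0 < p := hp.out.pos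
  let c : ℤ → Finset (ZMod p) := fun z => {a ∈ A | z - L < (a.val : ℤ) ∧ (a.val : ℤ) ≤ z}
  have hc : ∀ z, c z = {a ∈ A | z - L < (a.val : ℤ) ∧ (a.val : ℤ) ≤ z} := fun z => rfl
  have hG : ∀ z : ℤ, t + H ≤ #(c z) → (z : ZMod p) ∈ SS t A W := by
    intro z hz
    simp only [SS, mem_filter, mem_univ, true_and]
    have h1 : #(c z) ≤ rr A W z + H := by
      have h2 : c z ⊆ {a ∈ A | (z : ZMod p) - a ∈ W} ∪ (arc 1 0 L \ W).image (fun j => (z : ZMod p) - j) := by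
        intro a ha
        rw [hc, mem_filter] at ha
        rw [mem_union]
        by_cases hw : (z : ZMod p) - a ∈ W
        · left; exact mem_filter.mpr ⟨ha.1, hw⟩
        · right; rw [mem_image]; refine ⟨(z : ZMod p) - a, mem_sdiff.mpr ⟨?_, hw⟩, by ring⟩
          rw [mem_arc]
          obtain ⟨j, hj⟩ := Int.eq_ofNat_of_zero_le (show 0 ≤ z - a.val by omega)
          refine ⟨j, by omega, ?_⟩
          have : z = a.val + j := by omega
          rw [this]; push_cast; simp
      have h3 : #((arc 1 0 L \ W).image (fun j => (z : ZMod p) - j)) ≤ H := by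
        refine Finset.card_image_le.trans ?_
        rw [Finset.card_sdiff_of_subset hW]
        have := card_arc_le (1 : ZMod p) 0 L
        omega
      have h4 := (Finset.card_le_card h2).trans (Finset.card_union_le _ _)
      unfold rr
      omega
    omega
  have hSc := SS_card_le ht hff
  have dich : ∀ z : ℤ, -1 ≤ z → z ≤ p - 1 → #(c z) < t + H →
      #{a ∈ A | (a.val : ℤ) ≤ z - L} < t ∨ #{a ∈ A | z < (a.val : ℤ) ∧ a.val + L < p} < t := by
    intro z hz1 hz2 hcz
    by_contra! hcon
    obtain ⟨c1, c2⟩ := hcon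
    set A1 := {a ∈ A | (a.val : ℤ) ≤ z - L} with hA1
    set A2 := {a ∈ A | z < (a.val : ℤ) ∧ a.val + L < p} with hA2
    have s1 : A1 ⊆ A := Finset.filter_subset _ _
    have s2 : A2 ⊆ A := Finset.filter_subset _ _
    have hcard : #A ≤ #A1 + #A2 + #(c z) + #{a ∈ A | p ≤ a.val + L} := by
      have : A ⊆ A1 ∪ A2 ∪ c z ∪ {a ∈ A | p ≤ a.val + L} := by
        intro a ha
        simp only [hA1, hA2, hc, mem_union, mem_filter, ha, true_and]
        omega
      refine (Finset.card_le_card this).trans ?_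
      refine (Finset.card_union_le _ _).trans ?_
      apply Nat.add_le_add_right
      refine (Finset.card_union_le _ _).trans ?_
      apply Nat.add_le_add_right
      exact Finset.card_union_le _ _
    have hl1 : #A1 ≤ #A := Finset.card_le_card s1
    have hl2 : #A2 ≤ #A := Finset.card_le_card s2
    have hAL : #A + L ≤ p := by
      have : (#A + L : ℝ) ≤ p := by linarith
      exact_mod_cast this
    have p1 := pollard c1 htW (by omega)
    have p2 := pollard c2 htW (by omega)
    have hadd : ff t A1 W + ff t A2 W ≤ ff t A W := by
      unfold ff; rw [← Finset.sum_add_distrib]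
      apply Finset.sum_le_sum; intro y _
      have m1 := rr_mono_left (B := W) s1 y
      have m2 := rr_mono_left (B := W) s2 y
      have hz : rr A1 W y = 0 ∨ rr A2 W y = 0 := by
        by_contra! hne
        obtain ⟨n1, n2⟩ := hne
        obtain ⟨a1, ha1⟩ := Finset.card_pos.mp (Nat.pos_of_ne_zero n1)
        obtain ⟨a2, ha2⟩ := Finset.card_pos.mp (Nat.pos_of_ne_zero n2)
        rw [mem_filter] at ha1 ha2
        obtain ⟨j1, hj1, e1⟩ := mem_arc.mp (hW ha1.2)
        obtain ⟨j2, hj2, e2⟩ := mem_arc.mp (hW ha2.2)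
        have q1 := (mem_filter.mp ha1.1).2
        have q2 := (mem_filter.mp ha2.1).2
        have v1 := val_add_small (a := a1) (j := j1) (by omega)
        have v2 := val_add_small (a := a2) (j := j2) (by omega)
        have f1 : a1 + (j1 : ZMod p) = y := by linear_combination -e1
        have f2 : a2 + (j2 : ZMod p) = y := by linear_combination -e2
        rw [f1] at v1
        rw [f2] at v2
        omega
      omega
    have hr : t * (#A1 + #W) + t * (#A2 + #W) ≤ ff t A W + 2 * (t * t) := by omega
    have hr' : (t:ℝ) * ((#A1 + #W) + (#A2 + #W)) ≤ t * (#A + L + Δ + 2 * t) := by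
      have : (t * (#A1 + #W) + t * (#A2 + #W) : ℝ) ≤ ff t A W + 2 * (t * t) := by exact_mod_cast hr
      nlinarith
    have hr2 := le_of_mul_le_mul_left hr' (by exact_mod_cast ht)
    have e1 : (#A + 2 : ℝ) ≤ #A1 + #A2 + 2 * (t + H) := by
      have : #A + 2 ≤ #A1 + #A2 + 2 * (t + H) := by omega
      exact_mod_cast this
    have e2 : (L:ℝ) ≤ #W + H := by exact_mod_cast hLW
    linarith
  let Lf : Finset ℤ := (Finset.Icc (-1) (p - 1 : ℤ)).filter
    (fun z => #(c z) < t + H ∧ #{a ∈ A | (a.val : ℤ) ≤ z - L} < t)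
  have hLf : ∀ z, z ∈ Lf ↔ (-1 ≤ z ∧ z ≤ (p - 1 : ℤ)) ∧ #(c z) < t + H ∧ #{a ∈ A | (a.val : ℤ) ≤ z - L} < t := by
    intro z; simp [Lf]
  have hm1 : (-1 : ℤ) ∈ Lf := by
    rw [hLf]
    refine ⟨⟨le_rfl, by omega⟩, ?_, ?_⟩
    · have : c (-1) = ∅ := by
        rw [hc, Finset.filter_eq_empty_iff]; intro a _; omega
      rw [this]; simp; omega
    · have : ({a ∈ A | (a.val : ℤ) ≤ -1 - L} : Finset (ZMod p)) = ∅ := by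
        rw [Finset.filter_eq_empty_iff]; intro a _; omega
      rw [this]; simp; omega
  obtain ⟨s, hs, hsmax⟩ := Finset.exists_max_image Lf (fun z => z) ⟨_, hm1⟩
  have hs' := (hLf s).mp hs
  have hlast : (p - 1 : ℤ) ∉ Lf := by
    intro hmem
    have h2 := ((hLf _).mp hmem).2.2
    have : #A ≤ #{a ∈ A | (a.val : ℤ) ≤ p - 1 - L} + #{a ∈ A | p ≤ a.val + L} := by
      have hsub : A ⊆ {a ∈ A | (a.val : ℤ) ≤ p - 1 - L} ∪ {a ∈ A | p ≤ a.val + L} := by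
        intro a ha
        simp only [mem_union, mem_filter, ha, true_and]
        omega
      exact (Finset.card_le_card hsub).trans (Finset.card_union_le _ _)
    omega
  have hsp : s < p - 1 := by
    rcases lt_or_eq_of_le hs'.1.2 with h | h
    · exact h
    · rw [h] at hs; exact absurd hs hlast
  have hclast : #(c (p - 1)) < t + H := by
    refine lt_of_le_of_lt (Finset.card_le_card ?_) h0
    intro a ha
    rw [hc, mem_filter] at ha
    rw [mem_filter]; exact ⟨ha.1, by omega⟩
  obtain ⟨e, he, hemin⟩ := Finset.exists_min_image
    ((Finset.Ioc s (p - 1 : ℤ)).filter (fun z => #(c z) < t + H)) (fun z => z)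
    ⟨p - 1, by rw [mem_filter, mem_Ioc]; exact ⟨⟨hsp, le_rfl⟩, hclast⟩⟩
  rw [mem_filter, mem_Ioc] at he
  have heR : #{a ∈ A | e < (a.val : ℤ) ∧ a.val + L < p} < t := by
    rcases dich e (by omega) he.1.2 he.2 with h | h
    · have : e ∈ Lf := by rw [hLf]; exact ⟨⟨by omega, he.1.2⟩, he.2, h⟩
      have := hsmax e this
      omega
    · exact h
  have hlen : ((e - s - 1 : ℤ) : ℝ) ≤ #A + L + Δ := by
    refine le_trans ?_ hSc
    have h1 : #((Finset.Ioo s e).image (Int.cast : ℤ → ZMod p)) ≤ #(SS t A W) := by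
      apply Finset.card_le_card
      intro y hy
      obtain ⟨z, hz, rfl⟩ := mem_image.mp hy
      rw [mem_Ioo] at hz
      apply hG
      by_contra hcon
      have := hemin z (by rw [mem_filter, mem_Ioc]; exact ⟨⟨hz.1, by omega⟩, by omega⟩)
      omega
    rw [Finset.card_image_of_injOn, Int.card_Ioo] at h1
    · have h2 : (e - s - 1 : ℤ) ≤ #(SS t A W) := by omega
      exact_mod_cast h2
    · intro x hx y hy hxy
      simp only [coe_Ioo, Set.mem_Ioo] at hx hy
      rw [ZMod.intCast_eq_intCast_iff] at hxy
      have := Int.eq_zero_of_abs_lt_dvd hxy.dvd (by rw [abs_lt]; constructor <;> omega)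
      omega
  refine ⟨((s + 1 : ℤ) : ZMod p), (e - L - s).toNat, ?_, ?_⟩
  · rcases le_or_gt 0 (e - L - s) with h | h
    · have : (((e - L - s).toNat : ℤ) : ℝ) = ((e - L - s : ℤ) : ℝ) := by rw [Int.toNat_of_nonneg h]
      rw [Int.cast_natCast] at this
      rw [this]; push_cast at hlen ⊢; linarith
    · rw [Int.toNat_of_nonpos h.le]; simp; positivity
  · have hsub : A \ arc 1 ((s + 1 : ℤ) : ZMod p) (e - L - s).toNat ⊆
        {a ∈ A | (a.val : ℤ) ≤ s - L} ∪ c s ∪ c e ∪ {a ∈ A | e < (a.val : ℤ) ∧ a.val + L < p} ∪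
        {a ∈ A | p ≤ a.val + L} := by
      intro a ha
      rw [mem_sdiff] at ha
      simp only [mem_union, mem_filter, hc, ha.1, true_and]
      by_contra! hcon
      apply ha.2
      rw [mem_arc]
      refine ⟨(a.val - (s + 1) : ℤ).toNat, by omega, ?_⟩
      have : (((a.val - (s + 1) : ℤ).toNat : ℤ)) = a.val - (s+1) := Int.toNat_of_nonneg (by omega)
      have h2 : (((a.val - (s + 1) : ℤ).toNat : ℕ) : ZMod p) = ((a.val - (s+1) : ℤ) : ZMod p) := by
        rw [← this]; simp
      rw [h2]; push_cast; simp
    have h1 := Finset.card_le_card hsub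
    have h2 := Finset.card_union_le ({a ∈ A | (a.val : ℤ) ≤ s - L} ∪ c s ∪ c e ∪ {a ∈ A | e < (a.val : ℤ) ∧ a.val + L < p}) {a ∈ A | p ≤ a.val + L}
    have h3 := Finset.card_union_le ({a ∈ A | (a.val : ℤ) ≤ s - L} ∪ c s ∪ c e) {a ∈ A | e < (a.val : ℤ) ∧ a.val + L < p}
    have h4 := Finset.card_union_le ({a ∈ A | (a.val : ℤ) ≤ s - L} ∪ c s) (c e)
    have h5 := Finset.card_union_le {a ∈ A | (a.val : ℤ) ≤ s - L} (c s)
    omega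
theorem tr_arc (e d s : ZMod p) (len : ℕ) : tr e (arc d s len) = arc d (s + e) len := by
  ext x; rw [mem_tr, mem_arc, mem_arc]
  constructor
  · rintro ⟨j, hj, h⟩; exact ⟨j, hj, by linear_combination h⟩
  · rintro ⟨j, hj, h⟩; exact ⟨j, hj, by linear_combination h⟩
theorem lemmaL {t L H : ℕ} {A W : Finset (ZMod p)} {Δ : ℝ} (hW : W ⊆ arc 1 0 L)
    (hLW : L ≤ #W + H) (hL : L ≤ p) (ht : 1 ≤ t) (htW : t ≤ #W)
    (hff : (ff t A W : ℝ) ≤ t * (#A + L + Δ)) (hΔ0 : 0 ≤ Δ) (hΔ : Δ + 4 * H + 4 * t < L)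
    (hp' : (#A + L + Δ : ℝ) < p) (ha : 2 * t + H ≤ #A) :
    ∃ (s : ZMod p) (len : ℕ), (len : ℝ) ≤ #A + Δ + 1 ∧ #(A \ arc 1 s len) ≤ 5 * t + 3 * H := by
  have hSc := SS_card_le ht hff
  have hne : ∃ y0, y0 ∉ SS t A W := by
    by_contra! hcon
    have : SS t A W = univ := by ext; simp [hcon]
    rw [this, Finset.card_univ, ZMod.card] at hSc
    linarith
  obtain ⟨y0, hy0⟩ := hne
  set A0 := tr (-(y0 + 1)) A with hA0
  have cA0 : #A0 = #A := card_tr _ _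
  have h0 : #{a ∈ A0 | p ≤ a.val + L} < t + H := by
    by_contra hcon
    apply hy0
    simp only [SS, mem_filter, mem_univ, true_and]
    have h1 : #{a ∈ A0 | p ≤ a.val + L} ≤ rr A W y0 + H := by
      have h2 : ({a ∈ A0 | p ≤ a.val + L}).image (fun a => a + (y0 + 1)) ⊆
          {a ∈ A | y0 - a ∈ W} ∪ (arc 1 0 L \ W).image (fun j => y0 - j) := by
        intro a ha
        obtain ⟨b, hb, rfl⟩ := mem_image.mp ha
        rw [mem_filter, hA0, mem_tr] at hb
        rw [mem_union]
        have hbA : b + (y0 + 1) ∈ A := by rw [show b + (y0 + 1) = b - -(y0 + 1) by ring]; exact hb.1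
        by_cases hw : y0 - (b + (y0 + 1)) ∈ W
        · left; exact mem_filter.mpr ⟨hbA, hw⟩
        · right; rw [mem_image]; refine ⟨y0 - (b + (y0 + 1)), mem_sdiff.mpr ⟨?_, hw⟩, by ring⟩
          rw [mem_arc]
          have hb3 := ZMod.val_lt b
          refine ⟨p - 1 - b.val, by omega, ?_⟩
          rw [Nat.cast_sub (by omega), Nat.cast_sub (by omega)]; simp; ring
      have h3 : #((arc 1 0 L \ W).image (fun j => y0 - j)) ≤ H := by
        refine Finset.card_image_le.trans ?_
        rw [Finset.card_sdiff_of_subset hW]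
        have := card_arc_le (1 : ZMod p) 0 L
        omega
      have h4 := (Finset.card_le_card h2).trans (Finset.card_union_le _ _)
      rw [Finset.card_image_of_injective _ (add_left_injective _)] at h4
      unfold rr
      omega
    omega
  obtain ⟨s, len, hlen, hs⟩ := lemmaL0 (A := A0) hW hLW hL ht htW (by rw [hA0, ff_tr_left, card_tr]; exact hff)
    hΔ0 hΔ (by rw [cA0]; exact hp') (by rw [cA0]; exact ha) h0
  rw [cA0] at hlen
  refine ⟨s + (y0 + 1), len, hlen, le_trans (le_of_eq ?_) hs⟩
  rw [← tr_arc, ← card_tr (y0 + 1) (A0 \ arc 1 s len)]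
  congr 1
  ext x
  simp only [mem_sdiff, mem_tr, hA0]
  rw [show x - (y0 + 1) - -(y0 + 1) = x by ring]
end interval
end CD
namespace CD
section dil
variable {p : ℕ} [hp : Fact p.Prime]
def dl (d : ZMod p) (A : Finset (ZMod p)) : Finset (ZMod p) := A.image (fun x => d * x)
theorem mem_dl {d x : ZMod p} (hd : d ≠ 0) {A : Finset (ZMod p)} : x ∈ dl d A ↔ d⁻¹ * x ∈ A := by
  simp only [dl, mem_image]
  constructor
  · rintro ⟨a, ha, rfl⟩; rwa [inv_mul_cancel_left₀ hd]
  · intro h; exact ⟨_, h, by rw [mul_inv_cancel_left₀ hd]⟩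
theorem card_dl {d : ZMod p} (hd : d ≠ 0) (A : Finset (ZMod p)) : #(dl d A) = #A :=
  Finset.card_image_of_injective _ (mul_right_injective₀ hd)
theorem rr_dl {d : ZMod p} (hd : d ≠ 0) (A B : Finset (ZMod p)) (y : ZMod p) :
    rr (dl d A) (dl d B) y = rr A B (d⁻¹ * y) := by
  unfold rr
  apply Finset.card_bij' (fun a _ => d⁻¹ * a) (fun a _ => d * a)
  · intro a; simp only [mem_filter, mem_dl hd, mul_sub]; exact id
  · intro a; simp only [mem_filter, mem_dl hd, mul_sub, inv_mul_cancel_left₀ hd]; exact id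
  · intro a _; rw [mul_inv_cancel_left₀ hd]
  · intro a _; rw [inv_mul_cancel_left₀ hd]
theorem ff_dl (t : ℕ) {d : ZMod p} (hd : d ≠ 0) (A B : Finset (ZMod p)) :
    ff t (dl d A) (dl d B) = ff t A B := by
  unfold ff
  simp only [rr_dl hd]
  exact Equiv.sum_comp (Equiv.mulLeft₀ d⁻¹ (inv_ne_zero hd)) (fun y => min t (rr A B y))
theorem dl_arc {d : ZMod p} (hd : d ≠ 0) (d' s : ZMod p) (len : ℕ) :
    dl d (arc d' s len) = arc (d * d') (d * s) len := by
  ext x; rw [mem_dl hd, mem_arc, mem_arc]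
  constructor
  · rintro ⟨j, hj, h⟩; refine ⟨j, hj, ?_⟩
    rw [← mul_inv_cancel_left₀ hd x, h]; ring
  · rintro ⟨j, hj, h⟩; refine ⟨j, hj, ?_⟩
    rw [h, ← mul_right_inj' hd, mul_inv_cancel_left₀ hd]; ring
theorem dl_sdiff {d : ZMod p} (hd : d ≠ 0) (A B : Finset (ZMod p)) :
    dl d (A \ B) = dl d A \ dl d B := by
  ext x; simp [mem_dl hd]
theorem lemmaLd {t L H : ℕ} {A W : Finset (ZMod p)} {Δ : ℝ} {d s0 : ZMod p} (hd : d ≠ 0)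
    (hW : W ⊆ arc d s0 L)
    (hLW : L ≤ #W + H) (hL : L ≤ p) (ht : 1 ≤ t) (htW : t ≤ #W)
    (hff : (ff t A W : ℝ) ≤ t * (#A + L + Δ)) (hΔ0 : 0 ≤ Δ) (hΔ : Δ + 4 * H + 4 * t < L)
    (hp' : (#A + L + Δ : ℝ) < p) (ha : 2 * t + H ≤ #A) :
    ∃ (s : ZMod p) (len : ℕ), (len : ℝ) ≤ #A + Δ + 1 ∧ #(A \ arc d s len) ≤ 5 * t + 3 * H := by
  have hdi := inv_ne_zero hd
  set W' := dl d⁻¹ (tr (-s0) W) with hW'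
  set A' := dl d⁻¹ A with hA'
  have cW : #W' = #W := by rw [hW', card_dl hdi, card_tr]
  have cA : #A' = #A := by rw [hA', card_dl hdi]
  have hsub : W' ⊆ arc 1 0 L := by
    intro x hx
    rw [hW', mem_dl hdi, mem_tr, inv_inv] at hx
    obtain ⟨j, hj, h⟩ := mem_arc.mp (hW hx)
    rw [mem_arc]
    refine ⟨j, hj, ?_⟩
    have : d * x = d * j := by linear_combination h
    rw [mul_right_inj' hd] at this
    rw [this]; ring
  obtain ⟨s, len, h1, h2⟩ := lemmaL (A := A') hsub (by omega) hL ht (by omega)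
    (by rw [hA', hW', ff_dl t hdi, ff_tr_right, card_dl hdi]; exact hff) hΔ0 hΔ (by rw [cA]; exact hp')
    (by omega)
  rw [cA] at h1
  refine ⟨d * s, len, h1, ?_⟩
  have : arc d (d * s) len = dl d (arc 1 s len) := by rw [dl_arc hd, mul_one]
  rw [this, ← card_dl hdi, dl_sdiff hdi]
  convert h2 using 4
  ext x; rw [mem_dl hdi, mem_dl hd, inv_inv, inv_mul_cancel_left₀ hd]
theorem S_lower {t : ℕ} {A B : Finset (ZMod p)} {D : ℝ} (ht : 1 ≤ t)
    (hff : (ff t A B : ℝ) ≤ t * (#A + #B + D)) (hta : 2 * t ≤ #A) (htb : 2 * t ≤ #B)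
    (hp : #A + #B ≤ p + 2 * t) :
    (#A + #B - 4 * t - D : ℝ) ≤ #(SS t A B) ∧
    (∑ y ∈ univ.filter (fun y => y ∉ SS t A B), (rr A B y : ℝ)) ≤ t * (2 * D + 4 * t) := by
  have h1 := pollard hta htb hp
  have h2 : ff (2 * t) A B ≤ ff t A B + t * #(SS t A B) := by
    have e : t * #(SS t A B) = ∑ y, if t ≤ rr A B y then t else 0 := by
      rw [← Finset.sum_filter, Finset.sum_const, smul_eq_mul, mul_comm]; rfl
    rw [e]; unfold ff
    rw [← Finset.sum_add_distrib]
    apply Finset.sum_le_sum; intro y _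
    split_ifs <;> omega
  have ht0 : (0:ℝ) < t := by exact_mod_cast ht
  have h3 : (2 * t * (#A + #B) : ℝ) ≤ ff t A B + t * #(SS t A B) + 2 * t * (2 * t) := by
    have : 2 * t * (#A + #B) ≤ ff t A B + t * #(SS t A B) + 2 * t * (2 * t) := by omega
    exact_mod_cast this
  have h4 : (#A + #B - 4 * t - D : ℝ) ≤ #(SS t A B) := by
    apply le_of_mul_le_mul_left _ ht0
    nlinarith
  refine ⟨h4, ?_⟩
  have h5 := ff_eq t A B
  have h6 : (univ.filter (fun y => y ∉ SS t A B)) = univ.filter (fun y => ¬ t ≤ rr A B y) := by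
    ext y; simp [SS]
  rw [h6]
  have h7 : (ff t A B : ℝ) = t * #(SS t A B) + ∑ y ∈ univ.filter (fun y => ¬ t ≤ rr A B y), (rr A B y : ℝ) := by
    exact_mod_cast h5
  nlinarith
theorem sum_rows (A B S : Finset (ZMod p)) :
    ∑ x ∈ A, #{u ∈ B | x + u ∉ S} = ∑ y ∈ univ.filter (fun y => y ∉ S), rr A B y := by
  simp only [rr_eq_sum]
  rw [Finset.sum_comm]
  apply Finset.sum_congr rfl; intro x _
  rw [Finset.sum_filter, ← Finset.sum_filter, ← Finset.card_filter, Finset.filter_filter]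
  apply Finset.card_bij' (fun u _ => x + u) (fun y _ => y - x)
  · intro u; simp only [mem_filter, mem_univ, true_and]; rintro ⟨h1, h2⟩; exact ⟨h2, by simpa using h1⟩
  · intro u; simp only [mem_filter, mem_univ, true_and]; rintro ⟨h1, h2⟩; exact ⟨h2, by simpa using h1⟩
  · simp
  · simp
theorem valMinAbs_small {n : ℤ} (h : 2 * |n| < p) : ((n : ZMod p)).valMinAbs = n := by
  rw [ZMod.valMinAbs_spec]
  refine ⟨rfl, ?_⟩
  rw [Set.mem_Ioc]
  have := abs_lt.mp (show |n| * 2 < p by omega |> fun h => (by rwa [← abs_two (α := ℤ), ← abs_mul] at h : |n * 2| < p))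
  omega
theorem lift_int {μ : ℝ} (hμ : 0 < μ) (hμ1 : μ ≤ 1/200) {F W S : Finset (ZMod p)}
    {ξ u0 v0 : ZMod p} (hξ : ξ ≠ 0)
    (hWs : ∀ u ∈ W, 10 * |(ξ * (u - u0)).valMinAbs| ≤ p)
    (hFs : ∀ u ∈ F, 5 * |(ξ * (u - v0)).valMinAbs| ≤ p)
    (h1f : 1 ≤ μ * #F) (hfw : #F ≤ μ * #W) (hS : (#S : ℝ) ≤ #W + #F + μ * #F)
    (hx : ∀ x ∈ F, (#{u ∈ W | x + u ∉ S} : ℝ) ≤ μ * #F) :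
    ∃ d s : ZMod p, d ≠ 0 ∧ ∃ h : ℕ, (h : ℝ) ≤ (1 + 60 * μ) * #F ∧ F ⊆ arc d s (h + 1) := by
  have hp0 : 0 < p := hp.out.pos
  let φ : ZMod p → ZMod p → ℤ := fun v x => (ξ * (x - v)).valMinAbs
  have hφ : ∀ v x, x = v + ξ⁻¹ * ((φ v x : ℤ) : ZMod p) := by
    intro v x; simp only [φ]; rw [ZMod.coe_valMinAbs, inv_mul_cancel_left₀ hξ]; ring
  have hinj : ∀ v, Function.Injective (φ v) := by
    intro v x y hxy
    rw [hφ v x, hφ v y, hxy]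
  let S' : Finset ℤ := S.image (φ (u0 + v0))
  have hadd : ∀ x ∈ F, ∀ u ∈ W, φ (u0 + v0) (x + u) = φ v0 x + φ u0 u := by
    intro x hxF u huW
    have h1 := hWs u huW
    have h2 := hFs x hxF
    have h3 := abs_add_le (φ v0 x) (φ u0 u)
    have : ξ * (x + u - (u0 + v0)) = ((φ v0 x + φ u0 u : ℤ) : ZMod p) := by
      simp only [φ]; push_cast; ring
    change (ξ * (x + u - (u0 + v0))).valMinAbs = _
    rw [this]; apply valMinAbs_small
    change 10 * |φ u0 u| ≤ p at h1
    change 5 * |φ v0 x| ≤ p at h2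
    omega
  have cF : #(F.image (φ v0)) = #F := Finset.card_image_of_injective _ (hinj _)
  have cW : #(W.image (φ u0)) = #W := Finset.card_image_of_injective _ (hinj _)
  have cS : #S' = #S := Finset.card_image_of_injective _ (hinj _)
  obtain ⟨x0, D, hD, h, hh, hAP⟩ := int_lemma hμ hμ1 (F := F.image (φ v0)) (W := W.image (φ u0)) (S := S')
    (by rw [cF]; exact h1f) (by rw [cF, cW]; exact hfw) (by rw [cF, cW, cS]; exact hS) (by
      intro z hz
      obtain ⟨x, hxF, rfl⟩ := mem_image.mp hz
      rw [cF]
      refine le_trans ?_ (hx x hxF)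
      norm_cast
      rw [← Finset.card_image_of_injective {u ∈ W | x + u ∉ S} (hinj u0)]
      apply Finset.card_le_card
      intro v hv
      rw [mem_filter] at hv
      obtain ⟨u, hu, rfl⟩ := mem_image.mp hv.1
      refine mem_image.mpr ⟨u, mem_filter.mpr ⟨hu, fun hcon => hv.2 ?_⟩, rfl⟩
      rw [← hadd x hxF u hu]
      exact mem_image_of_mem _ hcon)
  rw [cF] at hh
  have hmem : ∀ x ∈ F, ∃ j : ℕ, j ≤ h ∧ x = (v0 + ξ⁻¹ * (x0 : ZMod p)) + (ξ⁻¹ * (D : ZMod p)) * j := by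
    intro x hxF
    obtain ⟨j, hj, e⟩ := hAP _ (mem_image_of_mem _ hxF)
    refine ⟨j, hj, ?_⟩
    rw [hφ v0 x, e]; push_cast; ring
  refine ⟨ξ⁻¹ * (D : ZMod p), v0 + ξ⁻¹ * (x0 : ZMod p), ?_, h, hh, ?_⟩
  · intro h0
    have h2 : (2:ℝ) ≤ #F := by nlinarith
    have h2' : 1 < #F := by
      have : 2 ≤ #F := by exact_mod_cast h2
      omega
    obtain ⟨a, ha, b, hb, hne⟩ := Finset.one_lt_card.mp h2'
    obtain ⟨j, _, e1⟩ := hmem a ha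
    obtain ⟨k, _, e2⟩ := hmem b hb
    rw [h0] at e1 e2
    apply hne; rw [e1, e2]; ring
  · intro x hxF
    obtain ⟨j, hj, e⟩ := hmem x hxF
    exact mem_arc.mpr ⟨j, by omega, e⟩
end dil
end CD
namespace CD
section K
variable {p : ℕ} [hp : Fact p.Prime]
theorem markov {α : Type*} [DecidableEq α] (s : Finset α) (f : α → ℝ) (c M : ℝ) (hf : ∀ x ∈ s, 0 ≤ f x)
    (hc : 0 < c) (h : ∑ x ∈ s, f x ≤ M) : c * #{x ∈ s | c ≤ f x} ≤ M := by
  refine le_trans ?_ h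
  calc c * #{x ∈ s | c ≤ f x} = ∑ x ∈ s.filter (fun x => c ≤ f x), c := by
        rw [Finset.sum_const, nsmul_eq_mul, mul_comm]
    _ ≤ ∑ x ∈ s.filter (fun x => c ≤ f x), f x := by
        apply Finset.sum_le_sum; intro x hx; exact (mem_filter.mp hx).2
    _ ≤ _ := Finset.sum_le_sum_of_subset_of_nonneg (Finset.filter_subset _ _) (fun x hx _ => hf x hx)
theorem card_split {α : Type*} (s : Finset α) (P : α → Prop) [DecidablePred P] :
    (#{x ∈ s | P x} : ℝ) + #{x ∈ s | ¬ P x} = #s := by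
  have := Finset.card_filter_add_card_filter_not (s := s) P
  exact_mod_cast this
set_option maxHeartbeats 1000000 in
theorem K1 {t : ℕ} {V F1 : Finset (ZMod p)} {ξ u0 : ZMod p} {D : ℝ} (hξ : ξ ≠ 0) (ht : 1 ≤ t)
    (htf : (t : ℝ) ≤ 1/30000 * #F1) (hfv : (#F1 : ℝ) ≤ 1/30000 * #V) (hD0 : 0 ≤ D) (hD : D ≤ 1/30000 * #F1)
    (hbad : (#{u ∈ V | (1/10:ℝ) * p < |((ξ * (u - u0)).valMinAbs : ℝ)|} : ℝ) ≤ 1/30000 * #F1)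
    (hff : (ff t V F1 : ℝ) ≤ t * (#V + #F1 + D)) (hvp : #V + #F1 ≤ p) :
    ∃ d s : ZMod p, d ≠ 0 ∧ ∃ F ⊆ F1, 0.999 * (#F1 : ℝ) ≤ #F ∧ ∃ h : ℕ, (h : ℝ) ≤ 1.06 * #F ∧
      F ⊆ arc d s (h + 1) := by
  set f1 : ℝ := ((#F1 : ℕ) : ℝ) with hf1
  set v : ℝ := ((#V : ℕ) : ℝ) with hv
  have ht1 : (1:ℝ) ≤ t := by exact_mod_cast ht
  have hf1pos : 0 < f1 := by linarith
  have hL4 := L4 hff ht (by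
    have : (2 * t : ℝ) ≤ #F1 := by rw [← hf1]; linarith
    exact_mod_cast this)
  rw [← hf1] at hL4
  obtain ⟨v0, hv0, hv0s⟩ : ∃ v0 ∈ F1, ∑ u ∈ F1, (nn V (u - v0) : ℝ) ≤ f1 * (2 * f1) := by
    rw [Finset.sum_comm] at hL4
    apply Finset.exists_le_of_sum_le (s := F1) (by
      rw [← Finset.card_pos]; rw [hf1] at hf1pos; exact_mod_cast hf1pos)
    rw [Finset.sum_const, nsmul_eq_mul, ← hf1]
    refine hL4.trans ?_
    have : f1 + D ≤ 2 * f1 := by linarith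
    calc f1 ^ 2 * (f1 + D) ≤ f1 ^ 2 * (2 * f1) := by gcongr
      _ = _ := by ring
  have hm := markov F1 (fun u => (nn V (u - v0) : ℝ)) (v/2) _ (fun _ _ => by positivity) (by linarith) hv0s
  have hF1' : (#{u ∈ F1 | v/2 ≤ (nn V (u - v0) : ℝ)} : ℝ) ≤ 4/30000 * f1 := by
    have h1 : 0 < v := by linarith
    have : f1 * (2 * f1) ≤ v/2 * (4/30000 * f1) := by nlinarith
    exact le_of_mul_le_mul_left (hm.trans this) (by linarith)
  set F := {u ∈ F1 | ¬ v/2 ≤ (nn V (u - v0) : ℝ)} with hF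
  have cF : f1 - 4/30000 * f1 ≤ #F := by
    have := card_split F1 (fun u => v/2 ≤ (nn V (u - v0) : ℝ)); linarith
  set bad := {u ∈ V | (1/10:ℝ) * p < |((ξ * (u - u0)).valMinAbs : ℝ)|} with hbaddef
  set W := {u ∈ V | ¬ (1/10:ℝ) * p < |((ξ * (u - u0)).valMinAbs : ℝ)|} with hW
  have cW : v - 1/30000 * f1 ≤ #W := by
    have := card_split V (fun u => (1/10:ℝ) * p < |((ξ * (u - u0)).valMinAbs : ℝ)|); linarith
  have hFF : F ⊆ F1 := Finset.filter_subset _ _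
  have hWV : W ⊆ V := Finset.filter_subset _ _
  have cF' : (#F : ℝ) ≤ f1 := by rw [hf1]; exact_mod_cast Finset.card_le_card hFF
  have cW' : (#W : ℝ) ≤ v := by rw [hv]; exact_mod_cast Finset.card_le_card hWV
  have hWs : ∀ u ∈ W, 10 * |(ξ * (u - u0)).valMinAbs| ≤ p := by
    intro u hu
    have := (mem_filter.mp hu).2
    push Not at this
    have h2 : (10 * |((ξ * (u - u0)).valMinAbs : ℝ)|) ≤ p := by linarith
    exact_mod_cast h2
  have hFs : ∀ u ∈ F, 5 * |(ξ * (u - v0)).valMinAbs| ≤ p := by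
    intro u hu
    have h1 := (mem_filter.mp hu).2
    obtain ⟨x, hx, hx'⟩ : ∃ x ∈ W, x + (u - v0) ∈ W := by
      by_contra! hcon
      have hsub : V ⊆ {x ∈ V | x + (u - v0) ∉ V} ∪ bad ∪ (bad.image (fun y => y - (u - v0))) := by
        intro x hx
        by_contra hn
        simp only [mem_union, not_or, mem_filter, not_and, not_not, mem_image, not_exists] at hn
        obtain ⟨⟨h2, h3⟩, h4⟩ := hn
        have h2 := h2 hx
        have hxW : x ∈ W := mem_filter.mpr ⟨hx, fun h => h3 (mem_filter.mpr ⟨hx, h⟩)⟩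
        apply hcon x hxW
        refine mem_filter.mpr ⟨h2, fun h => h4 (x + (u - v0)) (mem_filter.mpr ⟨h2, h⟩) (by ring)⟩
      have h5 := Finset.card_le_card hsub
      have h6 := Finset.card_union_le ({x ∈ V | x + (u - v0) ∉ V} ∪ bad) (bad.image (fun y => y - (u - v0)))
      have h7 := Finset.card_union_le ({x ∈ V | x + (u - v0) ∉ V}) bad
      have h8 : #(bad.image (fun y => y - (u - v0))) ≤ #bad := Finset.card_image_le
      have h9 : #V ≤ nn V (u - v0) + #bad + #bad := by unfold nn; omega
      have h10 : v ≤ nn V (u - v0) + #bad + #bad := by rw [hv]; exact_mod_cast h9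
      linarith
    have e1 := hWs x hx
    have e2 := hWs _ hx'
    have e3 : ξ * (u - v0) = (((ξ * (x + (u - v0) - u0)).valMinAbs - (ξ * (x - u0)).valMinAbs : ℤ) : ZMod p) := by
      push_cast; ring
    have e4 := abs_sub (ξ * (x + (u - v0) - u0)).valMinAbs (ξ * (x - u0)).valMinAbs
    have hp0 : 0 < p := hp.out.pos
    rw [e3, valMinAbs_small (by omega)]
    omega
  have hffWF : (ff t F W : ℝ) ≤ t * (#F + #W + 6/30000 * f1) := by
    have h1 : (ff t F W : ℝ) ≤ ff t V F1 := by
      rw [ff_comm]; exact_mod_cast ff_mono hWV hFF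
    refine h1.trans (hff.trans ?_)
    gcongr t * ?_
    linarith
  have hnp : #F + #W ≤ p + 2 * t := by
    have := Finset.card_le_card hFF
    have := Finset.card_le_card hWV
    omega
  have hS := SS_card_le ht hffWF
  obtain ⟨_, hmiss⟩ := S_lower ht hffWF (by
    have : (2 * t : ℝ) ≤ #F := by linarith
    exact_mod_cast this) (by
    have : (2 * t : ℝ) ≤ #W := by linarith
    exact_mod_cast this) hnp
  set S := SS t F W with hSd
  have hrows : ∑ x ∈ F, (#{u ∈ W | x + u ∉ S} : ℝ) ≤ t * (2 * (6/30000 * f1) + 4 * t) := by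
    have := sum_rows F W S
    have h2 : ∑ x ∈ F, (#{u ∈ W | x + u ∉ S} : ℝ) = ∑ y ∈ univ.filter (fun y => y ∉ S), (rr F W y : ℝ) := by
      exact_mod_cast this
    rw [h2]; exact hmiss
  have hm2 := markov F _ (t:ℝ) _ (fun _ _ => by positivity) (by linarith) hrows
  have hm3 := le_of_mul_le_mul_left hm2 (by linarith)
  set F0 := {x ∈ F | ¬ (t:ℝ) ≤ (#{u ∈ W | x + u ∉ S} : ℝ)} with hF0
  have cF0 : f1 - 20/30000 * f1 ≤ #F0 := by
    have := card_split F (fun x => (t:ℝ) ≤ (#{u ∈ W | x + u ∉ S} : ℝ)); linarith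
  have hF0F : F0 ⊆ F := Finset.filter_subset _ _
  have cF0' : (#F0 : ℝ) ≤ #F := by exact_mod_cast Finset.card_le_card hF0F
  obtain ⟨d, s, hd, h, hh, hsub⟩ := lift_int (μ := 1/1000) (by norm_num) (by norm_num) (F := F0) (W := W) (S := S) hξ hWs
    (fun u hu => hFs u (hF0F hu)) (by linarith) (by linarith) (by linarith) (by
      intro x hx
      have := (mem_filter.mp hx).2
      push Not at this
      linarith)
  exact ⟨d, s, hd, F0, hF0F.trans hFF, by linarith, h, by linarith, hsub⟩
theorem K2 {t : ℕ} {V F1 : Finset (ZMod p)} {ξ u0 : ZMod p} {D : ℝ} (hξ : ξ ≠ 0) (ht : 1 ≤ t)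
    (htf : (t : ℝ) ≤ 1/30000 * #F1) (hfv : (#F1 : ℝ) ≤ 1/30000 * #V) (hD0 : 0 ≤ D) (hD : D ≤ 1/30000 * #F1)
    (hbad : (#{u ∈ V | (1/10:ℝ) * p < |((ξ * (u - u0)).valMinAbs : ℝ)|} : ℝ) ≤ 1/30000 * #F1)
    (hff : (ff t V F1 : ℝ) ≤ t * (#V + #F1 + D)) (hvp : (#V + 3 * #F1 : ℝ) ≤ p) :
    ∃ d s : ZMod p, d ≠ 0 ∧ ∃ len : ℕ, (len : ℝ) ≤ #V + 0.02 * #F1 ∧ (#(V \ arc d s len) : ℝ) ≤ 0.25 * #F1 := by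
  have ht1 : (1:ℝ) ≤ t := by exact_mod_cast ht
  obtain ⟨d, s, hd, F, hF, hc, h, hh, hsub⟩ := K1 hξ ht htf hfv hD0 hD hbad hff (by
    have : (#V + #F1 : ℝ) ≤ p := by
      have : (0:ℝ) ≤ #F1 := by positivity
      linarith
    exact_mod_cast this)
  have hFc : #F ≤ h + 1 := (Finset.card_le_card hsub).trans (card_arc_le _ _ _)
  have hFcr : (#F : ℝ) ≤ h + 1 := by exact_mod_cast hFc
  have hFF : (#F : ℝ) ≤ #F1 := by exact_mod_cast Finset.card_le_card hF
  have hHr : ((h + 1 - #F : ℕ) : ℝ) = h + 1 - #F := by rw [Nat.cast_sub hFc]; push_cast; ring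
  obtain ⟨s', len, h1, h2⟩ := lemmaLd (A := V) (W := F) (t := t) (L := h + 1) (H := h + 1 - #F) (Δ := 0.01 * #F1) hd hsub
    (by omega) (by
      have : (h + 1 : ℝ) ≤ p := by linarith
      exact_mod_cast this) ht (by
      have : (t : ℝ) ≤ #F := by linarith
      exact_mod_cast this) (by
      have : (ff t V F : ℝ) ≤ ff t V F1 := by exact_mod_cast ff_mono (subset_refl _) hF
      refine this.trans (hff.trans ?_)
      push_cast
      gcongr t * ?_
      linarith) (by positivity) (by
      rw [hHr]; push_cast; linarith) (by push_cast; linarith) (by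
      have : (2 * t + (h + 1 - #F : ℕ) : ℝ) ≤ #V := by rw [hHr]; linarith
      exact_mod_cast this)
  refine ⟨d, s', hd, len, by linarith, ?_⟩
  have h3 : (#(V \ arc d s' len) : ℝ) ≤ 5 * t + 3 * (h + 1 - #F : ℕ) := by exact_mod_cast h2
  rw [hHr] at h3; linarith
theorem K3 {t : ℕ} {X V : Finset (ZMod p)} {d s : ZMod p} {len : ℕ} {D f κ : ℝ} (hd : d ≠ 0) (ht : 1 ≤ t)
    (hff : (ff t X V : ℝ) ≤ t * (#X + #V + D)) (hDf : D ≤ 1/30000 * f) (htD : t ≤ D) (hfV : f ≤ 1/30000 * #V)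
    (hVx : (#V : ℝ) ≤ κ / 10 * #X) (hVx' : (#V : ℝ) ≤ 1/1000 * #X) (hxp : (#X : ℝ) ≤ 0.6 * p)
    (hl1 : (len : ℝ) ≤ #V + 0.02 * f) (hl2 : (#(V \ arc d s len) : ℝ) ≤ 0.25 * f) :
    ∃ s : ZMod p, ∃ len : ℕ, (len : ℝ) ≤ (1 + κ) * #X ∧ (#(X \ arc d s len) : ℝ) ≤ κ * #X := by
  have ht1 : (1:ℝ) ≤ t := by exact_mod_cast ht
  set V2 := V ∩ arc d s len with hV2d
  have hV2c : (#V : ℝ) = #V2 + #(V \ arc d s len) := by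
    have := Finset.card_inter_add_card_sdiff V (arc d s len)
    exact_mod_cast this.symm
  have hV2l : #V2 ≤ len := (Finset.card_le_card Finset.inter_subset_right).trans (card_arc_le _ _ _)
  have hV2lr : (#V2 : ℝ) ≤ len := by exact_mod_cast hV2l
  have hHr : ((len - #V2 : ℕ) : ℝ) = len - #V2 := by rw [Nat.cast_sub hV2l]
  obtain ⟨s', len', h1, h2⟩ := lemmaLd (A := X) (W := V2) (t := t) (L := len) (H := len - #V2) (Δ := D + 0.25 * f) hd Finset.inter_subset_right
    (by omega) (by
      have : (len : ℝ) ≤ p := by linarith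
      exact_mod_cast this) ht (by
      have : (t : ℝ) ≤ #V2 := by linarith
      exact_mod_cast this) (by
      have : (ff t X V2 : ℝ) ≤ ff t X V := by exact_mod_cast ff_mono (subset_refl _) Finset.inter_subset_left
      refine this.trans (hff.trans ?_)
      gcongr t * ?_
      linarith) (by linarith) (by
      rw [hHr]; linarith) (by linarith) (by
      have : (2 * t + (len - #V2 : ℕ) : ℝ) ≤ #X := by rw [hHr]; linarith
      exact_mod_cast this)
  refine ⟨s', len', by linarith, ?_⟩
  have h3 : (#(X \ arc d s' len') : ℝ) ≤ 5 * t + 3 * (len - #V2 : ℕ) := by exact_mod_cast h2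
  rw [hHr] at h3; linarith
theorem Kbad {bd x p v D ε e f : ℝ} (hbd0 : 0 ≤ bd) (hp0 : 0 < p) (hx0 : 0 < x) (hv0 : 0 < v) (hε : 0 < ε)
    (hxp : x ≤ 0.6 * p) (hvx : v ≤ ε * x) (hD : D ≤ v) (hbad : bd * (8 * (1/10)^2) * (x * (p - x)) * v ≤ p * (v^2 * (v + D)))
    (he : ε ≤ e^3/2400) (hf : e^2/24 * v ≤ f) (he0 : 0 < e) : bd ≤ e * f := by
  have h1 : bd * 0.032 * (x * p * v) ≤ (2 * ε * v) * (x * p * v) := by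
    calc bd * 0.032 * (x * p * v) = bd * (8 * (1/10)^2) * (x * (0.4 * p)) * v := by ring
      _ ≤ bd * (8 * (1/10)^2) * (x * (p - x)) * v := by gcongr; linarith
      _ ≤ _ := hbad
      _ ≤ p * (v^2 * (ε * x + ε * x)) := by
        gcongr
        linarith
      _ = _ := by ring
  have h2 := le_of_mul_le_mul_right h1 (by positivity)
  have h3 : ε * v ≤ e^3/2400 * v := by gcongr
  have h4 : e * (e^2/24 * v) ≤ e * f := by gcongr
  have h5 : 0 ≤ e^3 * v := by positivity
  nlinarith
set_option maxHeartbeats 1000000 in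
theorem thmK (γ κ : ℝ) (hγ : 0 < γ) (hγ1 : γ ≤ 1) (hκ : 0 < κ) (hκ1 : κ ≤ 1) : ∃ η : ℝ, 0 < η ∧
    ∀ (p : ℕ) [Fact p.Prime] (t : ℕ) (X Y : Finset (ZMod p)) (D : ℝ),
    1 ≤ t → t ≤ D → D ≤ η * #X → γ * #X ≤ #Y → γ * #Y ≤ #X → (#X + 2 * #Y : ℝ) ≤ p + D →
    (2 * #X + #Y : ℝ) ≤ p + D → (ff t X Y : ℝ) ≤ t * (#X + #Y + D) →
    ∃ d s : ZMod p, d ≠ 0 ∧ ∃ len : ℕ, (len : ℝ) ≤ (1 + κ) * #X ∧ (#(X \ arc d s len) : ℝ) ≤ κ * #X := by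
  obtain ⟨ε, hε0, hεγ, hεκ, hεe⟩ : ∃ ε : ℝ, 0 < ε ∧ ε ≤ γ ∧ ε ≤ κ/10 ∧ ε ≤ (1/30000)^3/2400 :=
    ⟨min γ (min (κ/10) ((1/30000)^3/2400)), by positivity, min_le_left _ _,
      (min_le_right _ _).trans (min_le_left _ _), (min_le_right _ _).trans (min_le_right _ _)⟩
  obtain ⟨C1, η1, hC1, hη1, sh1⟩ := shrink ε (1/γ) hε0 (hεγ.trans hγ1)
  obtain ⟨C2, η2, hC2, hη2, sh2⟩ := shrink (1/30000) (24/ε^2) (by norm_num) (by norm_num)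
  obtain ⟨η, hη0, ha, hb, hc⟩ : ∃ η : ℝ, 0 < η ∧ η ≤ η1 ∧ C1 * η ≤ η2 * (ε^2/24) ∧
      C1 * C2 * η ≤ 1/30000 * ((1/30000)^2/24) * (ε^2/24) := by
    refine ⟨min η1 (min (η2 * (ε^2/24) / C1) ((1/30000 * ((1/30000)^2/24) * (ε^2/24)) / (C1 * C2))),
      by positivity, min_le_left _ _, ?_, ?_⟩
    · rw [mul_comm, ← le_div_iff₀ (by positivity)]
      exact (min_le_right _ _).trans (min_le_left _ _)
    · rw [mul_comm, ← le_div_iff₀ (by positivity)]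
      exact (min_le_right _ _).trans (min_le_right _ _)
  refine ⟨η, hη0, ?_⟩
  intro p _ t X Y D ht htD hD hyx hxy hp1 hp2 hff
  have ht1 : (1:ℝ) ≤ t := by exact_mod_cast ht
  have hD1 : 1 ≤ D := ht1.trans htD
  have hx0 : (0:ℝ) < #X := by
    by_contra hcon
    have : (0:ℝ) ≤ #X := by positivity
    have : (#X : ℝ) = 0 := by linarith
    rw [this] at hD; linarith
  obtain ⟨V, hVY, hV1, hV2, hffV⟩ := sh1 p t X Y D ht hff htD
    (hD.trans (by gcongr)) hp1 (le_trans (by gcongr) hyx) (by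
      rw [one_div, ← div_eq_inv_mul, le_div_iff₀ hγ]; linarith)
  have hVYc : (#V : ℝ) ≤ #Y := by exact_mod_cast Finset.card_le_card hVY
  have hDC : C1 * D ≤ η2 * #V := by
    calc C1 * D ≤ C1 * (η * #X) := by gcongr
      _ = C1 * η * #X := by ring
      _ ≤ η2 * (ε^2/24) * #X := by gcongr
      _ = η2 * (ε^2/24 * #X) := by ring
      _ ≤ _ := by gcongr
  have hCD : D ≤ C1 * D := le_mul_of_one_le_left (by linarith) hC1
  have hε1 : ε ≤ 1 := hεγ.trans hγ1
  obtain ⟨F, hFX, hF1, hF2, hffF⟩ := sh2 p t V X (C1 * D) ht (by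
      rw [ff_comm]; convert hffV using 2; ring) (htD.trans hCD) hDC (by linarith) (by
      have : ε * (#X:ℝ) ≤ 1 * #X := by gcongr
      linarith) (by
      rw [div_mul_eq_mul_div, le_div_iff₀ (by positivity)]; linarith)
  have hCC : C1 * C2 * D ≤ 1/30000 * #F := by
    calc C1 * C2 * D ≤ C1 * C2 * (η * #X) := by gcongr
      _ = C1 * C2 * η * #X := by ring
      _ ≤ 1/30000 * ((1/30000)^2/24) * (ε^2/24) * #X := by gcongr
      _ = 1/30000 * ((1/30000)^2/24 * (ε^2/24 * #X)) := by ring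
      _ ≤ 1/30000 * ((1/30000)^2/24 * #V) := by gcongr
      _ ≤ _ := by gcongr
  have hCC1 : C1 * D ≤ C1 * C2 * D := by
    calc C1 * D = C1 * 1 * D := by ring
      _ ≤ _ := by gcongr
  have hC1F : C1 * D ≤ 1/30000 * #F := hCC1.trans hCC
  have hV0 : (0:ℝ) < #V := lt_of_lt_of_le (by positivity) hV1
  have htF : (t:ℝ) ≤ 1/30000 * #F := by linarith
  have hεx : ε * (#X:ℝ) ≤ 1/1000 * #X := by
    gcongr; refine hεe.trans (by norm_num)
  have hxp : (#X : ℝ) ≤ 0.6 * p := by linarith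
  have hL4 := L4 hffV ht (by
    have : (2 * t : ℝ) ≤ #V := by linarith
    exact_mod_cast this)
  obtain ⟨ξ, hξ, u0, hu0, hbad⟩ := fourier (δ := 1/10) (Finset.card_pos.mp (by exact_mod_cast hV0)) (by norm_num) hL4
  have hbad' := Kbad (e := 1/30000) (f := #F) (by positivity) (lt_of_lt_of_le hx0 (by
      have : (0:ℝ) ≤ p := by positivity
      linarith)) hx0 hV0 hε0 hxp hV2 (by linarith) hbad hεe hF1 (by norm_num)
  obtain ⟨d, s, hd, len, hl1, hl2⟩ := K2 (D := C1 * C2 * D) hξ ht htF hF2 (by positivity) hCC hbad' (by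
      convert hffF using 3; ring) (by linarith)
  obtain ⟨s', len', h1, h2⟩ := K3 (κ := κ) hd ht hffV hC1F (htD.trans hCD) hF2 (hV2.trans (by gcongr)) (hV2.trans hεx) hxp hl1 hl2
  exact ⟨d, s', hd, len', h1, h2⟩
end K
end CD
namespace CD
section S
variable {p : ℕ} [hp : Fact p.Prime]
theorem rr_negc (t : ℕ) (A B S : Finset (ZMod p)) :
    ff t A (univ.filter (fun y => -y ∉ S)) + t * #B ≤ t * p + ∑ y ∈ univ.filter (fun y => y ∉ S), rr A B y := by
  have hr : ∀ z, rr A (univ.filter (fun y => -y ∉ S)) z = #{a ∈ A | a - z ∉ S} := by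
    intro z; unfold rr; congr 1; ext a
    simp [neg_sub]
  rw [← Finset.sum_congr rfl (fun y _ => rr_comm B A y), ← sum_rows B A S]
  unfold ff
  simp only [hr]
  have e1 : ∑ y, min t #{a ∈ A | a - y ∉ S} = ∑ y, min t #{a ∈ A | y + a ∉ S} := by
    apply Fintype.sum_equiv (Equiv.neg _)
    intro x; simp only [Equiv.neg_apply]
    congr 2; ext a
    simp only [mem_filter, neg_add_eq_sub]
  rw [e1, ← Finset.sum_add_sum_compl B]
  have h1 : ∑ x ∈ B, min t #{a ∈ A | x + a ∉ S} ≤ ∑ x ∈ B, #{a ∈ A | x + a ∉ S} :=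
    Finset.sum_le_sum fun _ _ => min_le_right _ _
  have h2 : ∑ x ∈ Bᶜ, min t #{a ∈ A | x + a ∉ S} ≤ #Bᶜ * t := by
    rw [← smul_eq_mul, ← Finset.sum_const]
    exact Finset.sum_le_sum fun _ _ => min_le_left _ _
  have h3 : #Bᶜ + #B = p := by rw [Finset.card_compl_add_card, ZMod.card]
  have h4 : t * p = #Bᶜ * t + t * #B := by
    calc t * p = t * (#Bᶜ + #B) := by rw [h3]
      _ = _ := by ring
  omega
theorem struct_half1 (α β κ : ℝ) (hα : 0 < α) (hα1 : α ≤ 1) (hβ : 0 < β) (hβ1 : β ≤ 1) (hκ : 0 < κ) (hκ1 : κ ≤ 1) :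
    ∃ η : ℝ, 0 < η ∧ ∀ (p : ℕ) [Fact p.Prime] (t : ℕ) (A B : Finset (ZMod p)), 1 ≤ t → t ≤ η * #A →
    α * #B ≤ (#A : ℝ) → #A ≤ #B → (#A + #B : ℝ) ≤ (1 - β) * p → (ff t A B : ℝ) ≤ t * (#A + #B + t) →
    ∃ d s : ZMod p, d ≠ 0 ∧ ∃ len : ℕ, (len : ℝ) ≤ (1 + κ) * #A ∧ (#(A \ arc d s len) : ℝ) ≤ κ * #A := by
  obtain ⟨η, hη, hK⟩ := thmK (α * β / 6) κ (by positivity) (by nlinarith) hκ hκ1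
  refine ⟨min (η / 10) (β / 20), by positivity, ?_⟩
  intro p hp t A B ht hta hba hab hsum hff
  have ht1 : (1:ℝ) ≤ t := by exact_mod_cast ht
  have hta1 : (t:ℝ) ≤ η / 10 * #A := hta.trans (by gcongr; exact min_le_left _ _)
  have hta2 : (t:ℝ) ≤ β / 20 * #A := hta.trans (by gcongr; exact min_le_right _ _)
  have habr : (#A : ℝ) ≤ #B := by exact_mod_cast hab
  have hA0 : (0:ℝ) ≤ #A := by positivity
  have hB0 : (0:ℝ) ≤ #B := by positivity
  have hp0 : (0:ℝ) ≤ p := by positivity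
  have hβA : β / 20 * #A ≤ 1/20 * #A := by gcongr
  have hαβ : α * β ≤ 1 := by nlinarith
  by_cases hcase : (#A + 2 * #B : ℝ) ≤ p
  · refine hK p t A B t ht le_rfl (by linarith [mul_nonneg hη.le hA0]) ?_ ?_ (by linarith) (by linarith) hff
    · nlinarith
    · have : α * β / 6 * #B ≤ α * #B := by gcongr; nlinarith
      linarith
  · push Not at hcase
    have hβp : 0 ≤ β * p := by positivity
    have hS1 := SS_card_le ht hff
    obtain ⟨hS2, hS3⟩ := S_lower ht hff (by
      have : (2 * t : ℝ) ≤ #A := by linarith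
      exact_mod_cast this) (by
      have : (2 * t : ℝ) ≤ #B := by linarith
      exact_mod_cast this) (by
      have : (#A + #B : ℝ) ≤ p + 2 * t := by linarith
      exact_mod_cast this)
    have hn := rr_negc t A B (SS t A B)
    set S := SS t A B with hS
    set C : Finset (ZMod p) := univ.filter (fun y => -y ∉ S) with hC
    have hcC : (#C : ℝ) = p - #S := by
      have h1 : #C = #(univ.filter (fun y => y ∉ S)) := by
        rw [hC]; apply Finset.card_bij' (fun y _ => -y) (fun y _ => -y) <;> simp
      have h2 : #(univ.filter (fun y => y ∉ S)) + #S = p := by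
        have := Finset.card_compl_add_card S
        rw [ZMod.card] at this
        convert this using 3
        ext; simp
      rw [h1, eq_sub_iff_add_eq]; exact_mod_cast h2
    have hnr : (ff t A C : ℝ) + t * #B ≤ t * p + ∑ y ∈ univ.filter (fun y => y ∉ S), (rr A B y : ℝ) := by
      exact_mod_cast hn
    have hffC : (ff t A C : ℝ) ≤ t * (#A + #C + 10 * t) := by
      have : (t:ℝ) * p + t * (2 * t + 4 * t) - t * #B ≤ t * (#A + #C + 10 * t) := by
        rw [hcC]
        have : (t:ℝ) * p + t * (2 * t + 4 * t) - t * #B = t * (p + 6 * t - #B) := by ring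
        rw [this]; gcongr; linarith
      linarith
    have hAp : β * #A ≤ β * p := mul_le_mul_of_nonneg_left (by linarith) hβ.le
    refine hK p t A C (10 * t) ht (by linarith) (by linarith [mul_nonneg hη.le hA0]) ?_ ?_ (by linarith) (by linarith) hffC
    · have : α * β / 6 * #A ≤ β / 6 * #A := by gcongr; nlinarith
      linarith
    · have h1 : (#C : ℝ) ≤ #A + 2 * #B := by linarith [show (0:ℝ) ≤ #S by positivity]
      have : α * β / 6 * #C ≤ α / 6 * (#A + 2 * #B) := by gcongr; nlinarith
      have h3 : α * #A ≤ 1 * #A := by gcongr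
      linarith
theorem struct_half (α β κ : ℝ) (hα : 0 < α) (hα1 : α ≤ 1) (hβ : 0 < β) (hβ1 : β ≤ 1) (hκ : 0 < κ) (hκ1 : κ ≤ 1) :
    ∃ η : ℝ, 0 < η ∧ ∀ (p : ℕ) [Fact p.Prime] (t : ℕ) (A B : Finset (ZMod p)), 1 ≤ t → t ≤ η * #A →
    α * #B ≤ (#A : ℝ) → #A ≤ #B → (#A + #B : ℝ) ≤ (1 - β) * p → (ff t A B : ℝ) ≤ t * (#A + #B + t) →
    ∃ d : ZMod p, d ≠ 0 ∧ ∃ (s s' : ZMod p) (len len' : ℕ), (len : ℝ) ≤ (1 + κ) * #A ∧ (#(A \ arc d s len) : ℝ) ≤ κ * #A ∧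
    (len' : ℝ) ≤ (1 + κ) * #B ∧ (#(B \ arc d s' len') : ℝ) ≤ κ * #B := by
  obtain ⟨μ, hμ0, hμκ, hμβ⟩ : ∃ μ : ℝ, 0 < μ ∧ μ ≤ κ / 40 ∧ μ ≤ β / 40 :=
    ⟨min (κ/40) (β/40), by positivity, min_le_left _ _, min_le_right _ _⟩
  obtain ⟨η, hη, hK⟩ := struct_half1 α β μ hα hα1 hβ hβ1 hμ0 (by linarith)
  refine ⟨min η μ, by positivity, ?_⟩
  intro p hp t A B ht hta hba hab hsum hff
  have ht1 : (1:ℝ) ≤ t := by exact_mod_cast ht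
  have hta1 : (t:ℝ) ≤ η * #A := hta.trans (by gcongr; exact min_le_left _ _)
  have hta2 : (t:ℝ) ≤ μ * #A := hta.trans (by gcongr; exact min_le_right _ _)
  have habr : (#A : ℝ) ≤ #B := by exact_mod_cast hab
  have hA0 : (0:ℝ) ≤ #A := by positivity
  have hB0 : (0:ℝ) ≤ #B := by positivity
  have hp0 : (0:ℝ) ≤ p := by positivity
  obtain ⟨d, s, hd, len, hl1, hl2⟩ := hK p t A B ht hta1 hba hab hsum hff
  have hβp0 : 0 ≤ β * p := by positivity
  have m1 : μ * #A ≤ κ / 40 * #A := by gcongr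
  have m2 : μ * #A ≤ β / 40 * p := by
    calc μ * #A ≤ β / 40 * #A := by gcongr
      _ ≤ _ := mul_le_mul_of_nonneg_left (by linarith) (by linarith)
  have m3 : κ / 40 * #A ≤ 1/40 * #A := by gcongr
  have m4 : κ / 40 * #A ≤ κ / 40 * #B := by gcongr
  set W := A ∩ arc d s len with hW
  have hWc : (#A : ℝ) = #W + #(A \ arc d s len) := by
    have := Finset.card_inter_add_card_sdiff A (arc d s len)
    exact_mod_cast this.symm
  have hWl : #W ≤ len := (Finset.card_le_card Finset.inter_subset_right).trans (card_arc_le _ _ _)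
  have hWlr : (#W : ℝ) ≤ len := by exact_mod_cast hWl
  have hHr : ((len - #W : ℕ) : ℝ) = len - #W := by rw [Nat.cast_sub hWl]
  obtain ⟨s', len', h1, h2⟩ := lemmaLd (A := B) (W := W) (t := t) (L := len) (H := len - #W) (Δ := μ * #A + t) hd Finset.inter_subset_right
    (by omega) (by
      have : (len : ℝ) ≤ p := by linarith
      exact_mod_cast this) ht (by
      have : (t : ℝ) ≤ #W := by linarith
      exact_mod_cast this) (by
      have : (ff t B W : ℝ) ≤ ff t A B := by
        rw [ff_comm]; exact_mod_cast ff_mono Finset.inter_subset_left (subset_refl _)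
      refine this.trans (hff.trans ?_)
      gcongr t * ?_
      linarith) (by positivity) (by
      rw [hHr]; linarith) (by linarith) (by
      have : (2 * t + (len - #W : ℕ) : ℝ) ≤ #B := by rw [hHr]; linarith
      exact_mod_cast this)
  refine ⟨d, hd, s, s', len, len', by linarith, by linarith, by linarith, ?_⟩
  have h3 : (#(B \ arc d s' len') : ℝ) ≤ 5 * t + 3 * (len - #W : ℕ) := by exact_mod_cast h2
  rw [hHr] at h3; linarith
theorem struct (α β κ : ℝ) (hα : 0 < α) (hα1 : α ≤ 1) (hβ : 0 < β) (hβ1 : β ≤ 1) (hκ : 0 < κ) (hκ1 : κ ≤ 1) :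
    ∃ η : ℝ, 0 < η ∧ ∀ (p : ℕ) [Fact p.Prime] (t : ℕ) (A B : Finset (ZMod p)), 1 ≤ t → t ≤ η * #A → t ≤ η * #B →
    α * #B ≤ (#A : ℝ) → α * #A ≤ (#B : ℝ) → (#A + #B : ℝ) ≤ (1 - β) * p → (ff t A B : ℝ) ≤ t * (#A + #B + t) →
    ∃ d : ZMod p, d ≠ 0 ∧ ∃ (s s' : ZMod p) (len len' : ℕ), (len : ℝ) ≤ (1 + κ) * #A ∧ (#(A \ arc d s len) : ℝ) ≤ κ * #A ∧
    (len' : ℝ) ≤ (1 + κ) * #B ∧ (#(B \ arc d s' len') : ℝ) ≤ κ * #B := by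
  obtain ⟨η, hη, hK⟩ := struct_half α β κ hα hα1 hβ hβ1 hκ hκ1
  refine ⟨η, hη, ?_⟩
  intro p hp t A B ht hta htb hba hab hsum hff
  rcases le_total #A #B with h | h
  · exact hK p t A B ht hta hba h hsum hff
  · obtain ⟨d, hd, s, s', len, len', h1, h2, h3, h4⟩ := hK p t B A ht htb hab h (by linarith) (by
      rw [ff_comm]; convert hff using 2; ring)
    exact ⟨d, hd, s', s, len', len, h3, h4, h1, h2⟩
end S
end CD
namespace CD
section R
variable {G : Type*} [AddCommGroup G] [DecidableEq G]
theorem sum3 {α β γ : Type*} (s : Finset α) (t : Finset β) (u : Finset γ) (f : α → β → γ → ℝ) :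
    ∑ x ∈ s, ∑ y ∈ t, ∑ z ∈ u, f x y z = ∑ z ∈ u, ∑ x ∈ s, ∑ y ∈ t, f x y z := by
  rw [Finset.sum_comm (s := u)]
  apply Finset.sum_congr rfl; intro x _
  rw [Finset.sum_comm]
def ii (S : Finset G) (x : G) : ℝ := if x ∈ S then 1 else 0
theorem sum_ii (A : Finset G) (k : ℕ) (x x' : G) :
    ∑ S ∈ powersetCard k A, ii S x * ii S x' = #{S ∈ powersetCard k A | ({x, x'} : Finset G) ⊆ S} := by
  rw [Finset.card_filter]; push_cast
  apply Finset.sum_congr rfl; intro S _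
  simp only [ii, insert_subset_iff, singleton_subset_iff]
  split_ifs <;> simp_all
theorem cnt1 {A : Finset G} {k : ℕ} (hk : 1 ≤ k) (hkA : k ≤ #A) {x : G} (hx : x ∈ A) :
    (∑ S ∈ powersetCard k A, ii S x * ii S x) * #A = k * (#A).choose k := by
  rw [sum_ii]
  have h1 : ({x, x} : Finset G) = {x} := by simp
  rw [h1, Finset.card_filter_powersetCard_subset _ _ _ (by simpa using hx) (by simpa using hk), card_singleton]
  obtain ⟨k, rfl⟩ : ∃ j, k = j + 1 := ⟨k - 1, by omega⟩
  obtain ⟨a, ha⟩ : ∃ j, #A = j + 1 := ⟨#A - 1, by omega⟩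
  rw [ha]
  have := Nat.add_one_mul_choose_eq a k
  simp only [Nat.add_sub_cancel]
  norm_cast; linarith
theorem cnt2 {A : Finset G} {k : ℕ} (hk : 1 ≤ k) (hkA : k ≤ #A) {x x' : G} (hx : x ∈ A) (hx' : x' ∈ A) (hne : x ≠ x') :
    (∑ S ∈ powersetCard k A, ii S x * ii S x') * (#A)^2 ≤ k^2 * (#A).choose k := by
  rw [sum_ii]
  by_cases hk2 : 2 ≤ k
  · rw [Finset.card_filter_powersetCard_subset _ _ _ (by simp [insert_subset_iff, hx, hx']) (by rw [card_pair hne]; exact hk2), card_pair hne]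
    obtain ⟨k, rfl⟩ : ∃ j, k = j + 2 := ⟨k - 2, by omega⟩
    obtain ⟨a, ha⟩ : ∃ j, #A = j + 2 := ⟨#A - 2, by omega⟩
    rw [ha] at hkA ⊢
    have h1 := Nat.add_one_mul_choose_eq a k
    have h2 := Nat.add_one_mul_choose_eq (a+1) (k+1)
    simp only [Nat.add_sub_cancel]
    norm_cast
    set c0 := a.choose k
    set c1 := (a+1).choose (k+1)
    have e : (a+2).choose (k+2) = (a+1+1).choose (k+1+1) := rfl
    rw [e]
    set c2 := (a+1+1).choose (k+1+1)
    have h3 : (a+2) * ((a+1) * c0) = (k+2) * ((k+1) * c2) := by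
      rw [h1]; nlinarith
    have h4 : c0 * (a+2)^2 * (a+1) = (k+2) * (k+1) * (a+2) * c2 := by nlinarith
    have h5 : (k+1) * (a+2) ≤ (k+2) * (a+1) := by nlinarith
    apply Nat.le_of_mul_le_mul_right (c := a+1) _ (by omega)
    rw [h4]
    calc (k+2) * (k+1) * (a+2) * c2 = (k+2) * c2 * ((k+1) * (a+2)) := by ring
      _ ≤ (k+2) * c2 * ((k+2) * (a+1)) := by gcongr
      _ = _ := by ring
  · have : #{S ∈ powersetCard k A | ({x, x'} : Finset G) ⊆ S} = 0 := by
      rw [Finset.card_eq_zero, Finset.filter_eq_empty_iff]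
      intro S hS hsub
      rw [mem_powersetCard] at hS
      have := Finset.card_le_card hsub
      rw [card_pair hne] at this; omega
    rw [this]; simp; positivity
theorem random_lemma {A B : Finset G} (Q : Finset G) {c₁ c₂ : ℕ} (h1 : 1 ≤ c₁) (h1A : c₁ ≤ #A) (h2 : 1 ≤ c₂) (h2B : c₂ ≤ #B) :
    ∃ A' ⊆ A, ∃ B' ⊆ B, #A' = c₁ ∧ #B' = c₂ ∧
      ∑ y ∈ Q, (rr A B y : ℝ) / (rr A B y + (#A * #B : ℝ) / (c₁ * c₂)) ≤ #((A' + B') ∩ Q) := by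
  set a : ℝ := ((#A : ℕ) : ℝ) with ha
  set b : ℝ := ((#B : ℕ) : ℝ) with hb
  have ha0 : 0 < a := by rw [ha]; exact_mod_cast (by omega)
  have hb0 : 0 < b := by rw [hb]; exact_mod_cast (by omega)
  have hc1 : (0:ℝ) < c₁ := by exact_mod_cast h1
  have hc2 : (0:ℝ) < c₂ := by exact_mod_cast h2
  set τ : ℝ := a * b / (c₁ * c₂) with hτ
  have hτ0 : 0 < τ := by positivity
  set PA := powersetCard c₁ A with hPA
  set PB := powersetCard c₂ B with hPB
  set MA : ℝ := ((#A).choose c₁ : ℝ) with hMA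
  set MB : ℝ := ((#B).choose c₂ : ℝ) with hMB
  have hMA0 : 0 < MA := by rw [hMA]; exact_mod_cast Nat.choose_pos h1A
  have hMB0 : 0 < MB := by rw [hMB]; exact_mod_cast Nat.choose_pos h2B
  have cA : (#PA : ℝ) = MA := by rw [hPA, card_powersetCard]
  have cB : (#PB : ℝ) = MB := by rw [hPB, card_powersetCard]
  let R : G → Finset G := fun y => {x ∈ A | y - x ∈ B}
  have cR : ∀ y, (#(R y) : ℝ) = rr A B y := fun y => rfl
  let N : Finset G → Finset G → G → ℝ := fun S T y => ∑ x ∈ R y, ii S x * ii T (y - x)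
  have iisq : ∀ (S : Finset G) (x : G), ii S x * ii S x = ii S x := by
    intro S x; unfold ii; split_ifs <;> simp
  have s1 : ∀ y, ∑ S ∈ PA, ∑ T ∈ PB, N S T y = rr A B y / τ * (MA * MB) := by
    intro y
    have e1 : ∑ S ∈ PA, ∑ T ∈ PB, N S T y = ∑ x ∈ R y, (∑ S ∈ PA, ii S x) * (∑ T ∈ PB, ii T (y - x)) := by
      simp only [N, Finset.sum_mul_sum]
      exact sum3 _ _ _ _
    rw [e1, Finset.sum_congr rfl (g := fun _ => MA * MB / τ)]
    · rw [Finset.sum_const, nsmul_eq_mul, cR]; ring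
    · intro x hx
      obtain ⟨hxA, hxB⟩ := mem_filter.mp hx
      have k1 := cnt1 h1 h1A hxA
      have k2 := cnt1 h2 h2B hxB
      simp only [iisq] at k1 k2
      rw [← ha, ← hMA] at k1; rw [← hb, ← hMB] at k2
      have k1' := eq_div_of_mul_eq ha0.ne' k1
      have k2' := eq_div_of_mul_eq hb0.ne' k2
      rw [k1', k2', hτ]; field_simp
  have s2 : ∀ y, ∑ S ∈ PA, ∑ T ∈ PB, (N S T y)^2 ≤ (rr A B y / τ + (rr A B y / τ)^2) * (MA * MB) := by
    intro y
    have e1 : ∑ S ∈ PA, ∑ T ∈ PB, (N S T y)^2 = ∑ x ∈ R y, ∑ x' ∈ R y, (∑ S ∈ PA, ii S x * ii S x') * (∑ T ∈ PB, ii T (y - x) * ii T (y - x')) := by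
      simp only [N, sq, Finset.sum_mul_sum]
      rw [sum3]
      apply Finset.sum_congr rfl; intro x _
      rw [sum3]
      refine Finset.sum_congr rfl fun _ _ => Finset.sum_congr rfl fun _ _ => Finset.sum_congr rfl fun _ _ => by ring
    rw [e1]
    have e2 : ∀ x ∈ R y, ∀ x' ∈ R y, (∑ S ∈ PA, ii S x * ii S x') * (∑ T ∈ PB, ii T (y - x) * ii T (y - x')) ≤
        (if x = x' then MA * MB / τ else 0) + MA * MB / τ^2 := by
      intro x hx x' hx'
      obtain ⟨hxA, hxB⟩ := mem_filter.mp hx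
      obtain ⟨hxA', hxB'⟩ := mem_filter.mp hx'
      split_ifs with he
      · subst he
        have k1 := cnt1 h1 h1A hxA
        have k2 := cnt1 h2 h2B hxB
        rw [← ha, ← hMA] at k1; rw [← hb, ← hMB] at k2
        have k1' := eq_div_of_mul_eq ha0.ne' k1
        have k2' := eq_div_of_mul_eq hb0.ne' k2
        have : (∑ S ∈ PA, ii S x * ii S x) * (∑ T ∈ PB, ii T (y - x) * ii T (y - x)) = MA * MB / τ := by
          rw [k1', k2', hτ]; field_simp
        rw [this]
        have : 0 ≤ MA * MB / τ^2 := by positivity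
        linarith
      · have k1 := cnt2 h1 h1A hxA hxA' he
        have k2 := cnt2 h2 h2B hxB hxB' (by simpa using he)
        rw [← ha, ← hMA, ← le_div_iff₀ (by positivity)] at k1
        rw [← hb, ← hMB, ← le_div_iff₀ (by positivity)] at k2
        rw [zero_add]
        refine (mul_le_mul k1 k2 (Finset.sum_nonneg fun T _ => ?_) (by positivity)).trans (le_of_eq ?_)
        · unfold ii; split_ifs <;> simp
        · rw [hτ]; field_simp
    refine (Finset.sum_le_sum fun x hx => Finset.sum_le_sum fun x' hx' => e2 x hx x' hx').trans (le_of_eq ?_)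
    simp only [Finset.sum_add_distrib, Finset.sum_const, nsmul_eq_mul, cR]
    rw [Finset.sum_congr rfl (g := fun _ => MA * MB / τ)]
    · rw [Finset.sum_const, nsmul_eq_mul, cR]; ring
    · intro x hx; rw [Finset.sum_ite_eq]; simp [hx]
  have hind : ∀ S ∈ PA, ∀ T ∈ PB, ∀ (y : G) (c : ℝ), 2 * c * N S T y - c^2 * (N S T y)^2 ≤ if y ∈ S + T then 1 else 0 := by
    intro S hS T hT y c
    split_ifs with h
    · nlinarith [sq_nonneg (1 - c * N S T y)]
    · have : N S T y = 0 := by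
        apply Finset.sum_eq_zero; intro x _
        unfold ii
        split_ifs with h3 h4 <;> simp
        apply h
        rw [Finset.mem_add]; exact ⟨x, h3, y - x, h4, by abel⟩
      rw [this]; simp
  set tgt : ℝ := ∑ y ∈ Q, (rr A B y : ℝ) / (rr A B y + τ) with htgt
  have hmain : tgt * (MA * MB) ≤ ∑ S ∈ PA, ∑ T ∈ PB, (#((S + T) ∩ Q) : ℝ) := by
    have e1 : ∀ S ∈ PA, ∀ T ∈ PB, ∑ y ∈ Q, (2 * (τ / (τ + rr A B y)) * N S T y - (τ / (τ + rr A B y))^2 * (N S T y)^2) ≤ (#((S + T) ∩ Q) : ℝ) := by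
      intro S hS T hT
      refine (Finset.sum_le_sum fun y _ => hind S hS T hT y _).trans (le_of_eq ?_)
      rw [Finset.inter_comm, ← Finset.filter_mem_eq_inter, Finset.card_filter]; push_cast; rfl
    refine le_trans ?_ (Finset.sum_le_sum fun S hS => Finset.sum_le_sum fun T hT => e1 S hS T hT)
    have e2 : ∑ S ∈ PA, ∑ T ∈ PB, ∑ y ∈ Q, (2 * (τ / (τ + rr A B y)) * N S T y - (τ / (τ + rr A B y))^2 * (N S T y)^2) =
        ∑ y ∈ Q, (2 * (τ / (τ + rr A B y)) * (∑ S ∈ PA, ∑ T ∈ PB, N S T y) - (τ / (τ + rr A B y))^2 * ∑ S ∈ PA, ∑ T ∈ PB, (N S T y)^2) := by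
      simp only [Finset.mul_sum, ← Finset.sum_sub_distrib]
      exact sum3 _ _ _ _
    rw [e2, htgt, Finset.sum_mul]
    apply Finset.sum_le_sum; intro y _
    rw [s1]
    have := s2 y
    set r : ℝ := (rr A B y : ℝ)
    have hr : 0 ≤ r := by positivity
    have e3 : r / (r + τ) * (MA * MB) = 2 * (τ / (τ + r)) * (r / τ * (MA * MB)) - (τ / (τ + r))^2 * ((r / τ + (r / τ)^2) * (MA * MB)) := by
      have : τ + r ≠ 0 := by positivity
      have : r + τ ≠ 0 := by positivity
      field_simp
      ring
    rw [e3]; gcongr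
  by_contra! hcon
  have : ∑ S ∈ PA, ∑ T ∈ PB, (#((S + T) ∩ Q) : ℝ) < ∑ S ∈ PA, ∑ T ∈ PB, tgt := by
    have hA : PA.Nonempty := by rw [← card_pos]; exact_mod_cast (cA ▸ hMA0 : (0:ℝ) < #PA)
    have hB : PB.Nonempty := by rw [← card_pos]; exact_mod_cast (cB ▸ hMB0 : (0:ℝ) < #PB)
    refine Finset.sum_lt_sum_of_nonempty hA fun S hS => Finset.sum_lt_sum_of_nonempty hB fun T hT => ?_
    rw [hPA, mem_powersetCard] at hS
    rw [hPB, mem_powersetCard] at hT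
    exact hcon S hS.1 T hT.1 hS.2 hT.2
  simp only [Finset.sum_const, nsmul_eq_mul, cA, cB] at this
  have h3 : MA * (MB * tgt) = tgt * (MA * MB) := by ring
  linarith
theorem random_ff [Fintype G] {A B : Finset G} {t c₁ c₂ : ℕ} (h1 : 1 ≤ c₁) (h1A : c₁ ≤ #A) (h2 : 1 ≤ c₂) (h2B : c₂ ≤ #B) (ht : 1 ≤ t) :
    ∃ A' ⊆ A, ∃ B' ⊆ B, #A' = c₁ ∧ #B' = c₂ ∧
      (ff t A B : ℝ) ≤ #(A' + B') * (t + (#A * #B : ℝ) / (c₁ * c₂)) := by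
  obtain ⟨A', hA', B', hB', e1, e2, h⟩ := random_lemma (univ : Finset G) h1 h1A h2 h2B
  refine ⟨A', hA', B', hB', e1, e2, ?_⟩
  rw [Finset.inter_univ] at h
  set τ : ℝ := (#A * #B : ℝ) / (c₁ * c₂) with hτ
  have hτ0 : 0 < τ := by
    have : 0 < #A := by omega
    have : 0 < #B := by omega
    have : 0 < c₁ := by omega
    have : 0 < c₂ := by omega
    positivity
  have ht0 : (1:ℝ) ≤ t := by exact_mod_cast ht
  rw [← div_le_iff₀ (by positivity)]
  refine le_trans ?_ h
  unfold ff; push_cast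
  rw [Finset.sum_div]
  apply Finset.sum_le_sum; intro y _
  set r : ℝ := (rr A B y : ℝ)
  have hr : 0 ≤ r := by positivity
  rcases le_total (t:ℝ) r with h4 | h4
  · rw [min_eq_left h4, div_le_div_iff₀ (by positivity) (by positivity)]; nlinarith
  · rw [min_eq_right h4]
    rcases hr.eq_or_lt with h5 | h5
    · rw [← h5]; simp
    · gcongr
end R
end CD
namespace CD
section D
theorem avg_pick {W : Finset ℤ} {M H : Finset ℤ} {w h : ℕ} (hw : 1 ≤ w) (hW : w ≤ 2 * #W) (hH : #H ≤ h) :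
    ∃ x ∈ W, w * #{z ∈ M | z - x ∈ H} ≤ 2 * h * #M := by
  have hne : W.Nonempty := by rw [← card_pos]; omega
  have hsum : ∑ x ∈ W, #{z ∈ M | z - x ∈ H} ≤ h * #M := by
    simp only [Finset.card_filter]
    rw [Finset.sum_comm, mul_comm, ← smul_eq_mul, ← Finset.sum_const]
    apply Finset.sum_le_sum; intro z hz
    rw [← Finset.card_filter]
    refine le_trans ?_ hH
    apply Finset.card_le_card_of_injOn (fun x => z - x)
    · intro x hx; exact (mem_filter.mp hx).2
    · intro x hx y hy e; simpa using e
  obtain ⟨x, hx, hmin⟩ := Finset.exists_min_image W (fun x => #{z ∈ M | z - x ∈ H}) hne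
  refine ⟨x, hx, ?_⟩
  have h1 : #W * #{z ∈ M | z - x ∈ H} ≤ ∑ x ∈ W, #{z ∈ M | z - x ∈ H} := by
    rw [← smul_eq_mul, ← Finset.sum_const]
    exact Finset.sum_le_sum fun y hy => hmin y hy
  nlinarith
theorem dense {A B : Finset ℤ} {ℓ L w N h : ℕ} (hA : A ⊆ Icc 0 (ℓ:ℤ)) (h0 : (0:ℤ) ∈ A) (hℓ : (ℓ:ℤ) ∈ A)
    (hB : B ⊆ Icc 0 (L:ℤ)) (hw : 1 ≤ w) (h4 : 4 * w ≤ L) (hwℓ : w ≤ ℓ)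
    (hwin : ∀ j : ℤ, 0 ≤ j → j + w ≤ ℓ + 1 → w ≤ 2 * #{x ∈ A | j ≤ x ∧ x < j + w})
    (hN : ℓ ≤ N * w) (hh : L + 1 ≤ #B + h) (hhw : 2 * (N + 2) * h ≤ w) :
    ∃ A' ⊆ A, #A' ≤ 2 * N + 6 ∧ ℓ + L + 1 ≤ #(A' + B) + h := by
  set H := Icc 0 (L:ℤ) \ B with hHdef
  have hHc : #H ≤ h := by
    rw [hHdef, Finset.card_sdiff_of_subset hB, Int.card_Icc]; omega
  set Hm := {x ∈ H | (w:ℤ) ≤ x ∧ x ≤ (L:ℤ) - w} with hHm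
  set Hl := {x ∈ H | x < (w:ℤ)} with hHl
  set Hh := {x ∈ H | (L:ℤ) - w < x} with hHh
  have hHsum : #Hl + #Hm + #Hh ≤ h := by
    refine le_trans ?_ hHc
    rw [← Finset.card_union_of_disjoint, ← Finset.card_union_of_disjoint]
    · apply Finset.card_le_card
      intro x; simp only [mem_union, hHl, hHm, hHh, mem_filter]; tauto
    · rw [Finset.disjoint_left]; intro x; simp only [mem_union, hHl, hHm, hHh, mem_filter]; omega
    · rw [Finset.disjoint_left]; intro x; simp only [mem_union, hHl, hHm, hHh, mem_filter]; omega
  set Z := Icc (w:ℤ) ((ℓ:ℤ) + L - w) with hZ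
  let idx : ℤ → ℕ := fun z => if z ≤ (L:ℤ) - w then 0 else if (ℓ:ℤ) + w ≤ z then N + 1 else (z / w - 2).toNat
  have hwz : (0:ℤ) < w := by exact_mod_cast hw
  have hpieces : ∀ i : ℕ, ∃ fl ∈ A, ∃ W ⊆ A, w ≤ 2 * #W ∧ ∀ z ∈ Z, idx z = i →
      ((w:ℤ) ≤ z - fl ∧ z - fl ≤ (L:ℤ) - w) ∧ ∀ x ∈ W, 0 ≤ z - x ∧ z - x ≤ L := by
    intro i
    by_cases hi : ∃ z ∈ Z, idx z = i
    swap
    · push Not at hi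
      refine ⟨0, h0, {x ∈ A | (0:ℤ) ≤ x ∧ x < 0 + w}, Finset.filter_subset _ _, hwin 0 le_rfl (by omega), ?_⟩
      intro z hz e; exact absurd e (hi z hz)
    obtain ⟨z0, hz0, e0⟩ := hi
    rw [hZ, mem_Icc] at hz0
    by_cases c1 : z0 ≤ (L:ℤ) - w
    · refine ⟨0, h0, {x ∈ A | (0:ℤ) ≤ x ∧ x < 0 + w}, Finset.filter_subset _ _, hwin 0 le_rfl (by omega), ?_⟩
      have ei : i = 0 := by rw [← e0]; simp only [idx, if_pos c1]
      intro z hz e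
      rw [hZ, mem_Icc] at hz
      have hzL : z ≤ (L:ℤ) - w := by
        by_contra hc
        simp only [idx, if_neg hc] at e
        split_ifs at e with c2
        · omega
        · have : (3:ℤ) ≤ z / w := by rw [Int.le_ediv_iff_mul_le hwz]; omega
          omega
      refine ⟨by omega, fun x hx => ?_⟩
      have := (mem_filter.mp hx).2
      omega
    · by_cases c2 : (ℓ:ℤ) + w ≤ z0
      · refine ⟨ℓ, hℓ, {x ∈ A | (ℓ:ℤ) + 1 - w ≤ x ∧ x < (ℓ:ℤ) + 1 - w + w}, Finset.filter_subset _ _, hwin _ (by omega) (by omega), ?_⟩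
        have ei : i = N + 1 := by rw [← e0]; simp only [idx, if_neg c1, if_pos c2]
        intro z hz e
        rw [hZ, mem_Icc] at hz
        have hzL : (ℓ:ℤ) + w ≤ z := by
          by_contra hc
          simp only [idx, if_neg hc] at e
          split_ifs at e with c2
          · omega
          · have : z / w < N + 1 := by
              rw [Int.ediv_lt_iff_lt_mul hwz]
              have : (ℓ:ℤ) ≤ N * w := by exact_mod_cast hN
              nlinarith
            omega
        refine ⟨by omega, fun x hx => ?_⟩
        have := (mem_filter.mp hx).2
        omega
      · have ei : i = (z0 / w - 2).toNat := by rw [← e0]; simp only [idx, if_neg c1, if_neg c2]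
        have h3 : (3:ℤ) ≤ z0 / w := by rw [Int.le_ediv_iff_mul_le hwz]; omega
        have hiN : i < N + 1 := by
          have : z0 / w < N + 1 := by
            rw [Int.ediv_lt_iff_lt_mul hwz]
            have : (ℓ:ℤ) ≤ N * w := by exact_mod_cast hN
            nlinarith
          omega
        have hm0 := Int.mul_ediv_add_emod z0 w
        have hm1 := Int.emod_nonneg z0 hwz.ne'
        have hm2 := Int.emod_lt_of_pos z0 hwz
        have ei' : (w:ℤ) * (i:ℤ) = w * (z0 / w) - 2 * w := by
          have : (i:ℤ) = z0 / w - 2 := by omega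
          rw [this]; ring
        have hst0 : 0 ≤ (w:ℤ) * i := by positivity
        have hW := hwin ((w:ℤ) * i) hst0 (by omega)
        obtain ⟨y, hy⟩ : {x ∈ A | (w:ℤ) * i ≤ x ∧ x < (w:ℤ) * i + w}.Nonempty := by
          rw [← card_pos]; omega
        refine ⟨y, (mem_filter.mp hy).1, {x ∈ A | (w:ℤ) * i ≤ x ∧ x < (w:ℤ) * i + w}, Finset.filter_subset _ _, hW, ?_⟩
        intro z hz e
        have k1 : ¬ z ≤ (L:ℤ) - w := by
          intro hc; simp only [idx, if_pos hc] at e; omega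
        have k2 : ¬ (ℓ:ℤ) + w ≤ z := by
          intro hc; simp only [idx, if_neg k1, if_pos hc] at e; omega
        simp only [idx, if_neg k1, if_neg k2] at e
        have g3 : (3:ℤ) ≤ z / w := by rw [Int.le_ediv_iff_mul_le hwz]; omega
        have g0 := Int.mul_ediv_add_emod z w
        have g1 := Int.emod_nonneg z hwz.ne'
        have g2 := Int.emod_lt_of_pos z hwz
        have gi : (w:ℤ) * (i:ℤ) = w * (z / w) - 2 * w := by
          have : (i:ℤ) = z / w - 2 := by omega
          rw [this]; ring
        have hy2 := (mem_filter.mp hy).2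
        refine ⟨by omega, fun x hx => ?_⟩
        have := (mem_filter.mp hx).2
        omega
  choose fl hfl W hWA hWc hpz using hpieces
  set M1 : ℕ → Finset ℤ := fun i => {z ∈ Z | idx z = i ∧ z - fl i ∉ B} with hM1
  have hM1c : ∀ i, #(M1 i) ≤ #Hm := by
    intro i
    apply Finset.card_le_card_of_injOn (fun z => z - fl i)
    · intro z hz
      have hz := mem_filter.mp hz
      have := (hpz i z hz.1 hz.2.1).1
      simp only [hHm, hHdef, mem_coe, mem_filter, mem_sdiff, mem_Icc]
      exact ⟨⟨by omega, hz.2.2⟩, this⟩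
    · intro x hx y hy e; simpa using e
  have hpick : ∀ i, ∃ x ∈ W i, w * #{z ∈ M1 i | z - x ∈ H} ≤ 2 * h * #(M1 i) :=
    fun i => avg_pick hw (hWc i) hHc
  choose xx hxx hxc using hpick
  set A' : Finset ℤ := {0, (ℓ:ℤ)} ∪ ((range (N+2)).image fl ∪ (range (N+2)).image xx) with hA'
  have hidx : ∀ z ∈ Z, idx z < N + 2 := by
    intro z hz
    simp only [idx]
    split_ifs with c1 c2
    · omega
    · omega
    · have : z / w < N + 1 := by
        rw [Int.ediv_lt_iff_lt_mul hwz]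
        have : (ℓ:ℤ) ≤ N * w := by exact_mod_cast hN
        nlinarith
      omega
  refine ⟨A', ?_, ?_, ?_⟩
  · intro x hx
    simp only [hA', mem_union, mem_insert, mem_singleton, mem_image] at hx
    rcases hx with (rfl | rfl) | ⟨i, _, rfl⟩ | ⟨i, _, rfl⟩
    · exact h0
    · exact hℓ
    · exact hfl i
    · exact hWA i (hxx i)
  · refine (Finset.card_union_le _ _).trans ?_
    have e1 := Finset.card_union_le ((range (N+2)).image fl) ((range (N+2)).image xx)
    have e2 : #((range (N+2)).image fl) ≤ N + 2 := by simpa using Finset.card_image_le (s := range (N+2)) (f := fl)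
    have e3 : #((range (N+2)).image xx) ≤ N + 2 := by simpa using Finset.card_image_le (s := range (N+2)) (f := xx)
    have e4 : #({0, (ℓ:ℤ)} : Finset ℤ) ≤ 2 := Finset.card_le_two
    omega
  · set M2 := (range (N+2)).biUnion (fun i => {z ∈ M1 i | z - xx i ∈ H}) with hM2
    have hM2c : #M2 ≤ #Hm := by
      have k1 : w * #M2 ≤ w * #Hm := by
        calc w * #M2 ≤ w * ∑ i ∈ range (N+2), #{z ∈ M1 i | z - xx i ∈ H} := by
              gcongr; exact Finset.card_biUnion_le
          _ = ∑ i ∈ range (N+2), w * #{z ∈ M1 i | z - xx i ∈ H} := Finset.mul_sum _ _ _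
          _ ≤ ∑ i ∈ range (N+2), 2 * h * #Hm := Finset.sum_le_sum fun i _ =>
              (hxc i).trans (Nat.mul_le_mul_left _ (hM1c i))
          _ = 2 * (N+2) * h * #Hm := by rw [Finset.sum_const, card_range, smul_eq_mul]; ring
          _ ≤ w * #Hm := by gcongr
      exact Nat.le_of_mul_le_mul_left k1 hw
    have hmiss : Icc 0 ((ℓ:ℤ) + L) ⊆ (A' + B) ∪ (Hl ∪ (M2 ∪ Hh.image (fun x => x + (ℓ:ℤ)))) := by
      intro z hz
      rw [mem_Icc] at hz
      by_cases hzT : z ∈ A' + B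
      · exact mem_union_left _ hzT
      apply mem_union_right
      have hnot : ∀ x ∈ A', z - x ∉ B := by
        intro x hx hb
        apply hzT
        rw [Finset.mem_add]; exact ⟨x, hx, z - x, hb, by ring⟩
      by_cases c1 : z < w
      · apply mem_union_left
        have := hnot 0 (by simp [hA'])
        simp only [hHl, hHdef, mem_filter, mem_sdiff, mem_Icc]
        rw [sub_zero] at this
        exact ⟨⟨by omega, this⟩, c1⟩
      apply mem_union_right
      by_cases c2 : (ℓ:ℤ) + L - w < z
      · apply mem_union_right
        have := hnot ℓ (by simp [hA'])
        rw [mem_image]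
        refine ⟨z - ℓ, ?_, by ring⟩
        simp only [hHh, hHdef, mem_filter, mem_sdiff, mem_Icc]
        exact ⟨⟨by omega, this⟩, by omega⟩
      apply mem_union_left
      have hzZ : z ∈ Z := by rw [hZ, mem_Icc]; omega
      have hi := hidx z hzZ
      rw [hM2, mem_biUnion]
      refine ⟨idx z, by simpa using hi, ?_⟩
      rw [mem_filter, hM1, mem_filter]
      have n1 := hnot (fl (idx z)) (by
        rw [hA']; exact mem_union_right _ (mem_union_left _ (mem_image_of_mem _ (by simpa using hi))))
      have n2 := hnot (xx (idx z)) (by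
        rw [hA']; exact mem_union_right _ (mem_union_right _ (mem_image_of_mem _ (by simpa using hi))))
      refine ⟨⟨hzZ, rfl, n1⟩, ?_⟩
      have := (hpz (idx z) z hzZ rfl).2 _ (hxx (idx z))
      rw [hHdef, mem_sdiff, mem_Icc]
      exact ⟨this, n2⟩
    have hc := Finset.card_le_card hmiss
    rw [Int.card_Icc] at hc
    have u1 := Finset.card_union_le (A' + B) (Hl ∪ (M2 ∪ Hh.image (fun x => x + (ℓ:ℤ))))
    have u2 := Finset.card_union_le Hl (M2 ∪ Hh.image (fun x => x + (ℓ:ℤ)))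
    have u3 := Finset.card_union_le M2 (Hh.image (fun x => x + (ℓ:ℤ)))
    have u4 := Finset.card_image_le (s := Hh) (f := fun x => x + (ℓ:ℤ))
    omega
end D
end CD
namespace CD
section D
theorem rescale {S : Finset ℤ} {t lA : ℕ} (ht : 1 ≤ t) {s : ZMod t} (hS : S.Nonempty) (hs : ∀ x ∈ S, ((x:ℤ) : ZMod t) = s)
    {R : ℕ} (hr : S ⊆ Icc 0 (R:ℤ)) :
    ∃ (S0 : Finset ℤ) (m : ℤ) (ℓ : ℕ), S = S0.image (fun y => m + t * y) ∧ #S0 = #S ∧ (0:ℤ) ∈ S0 ∧ (ℓ:ℤ) ∈ S0 ∧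
      S0 ⊆ Icc 0 (ℓ:ℤ) ∧ ℓ ≤ R / t := by
  have htz : (0:ℤ) < t := by exact_mod_cast ht
  set m := S.min' hS with hm
  set M := S.max' hS with hM
  have hmS : m ∈ S := Finset.min'_mem _ _
  have hMS : M ∈ S := Finset.max'_mem _ _
  have hd : ∀ x ∈ S, ∃ y : ℤ, x = m + t * y := by
    intro x hx
    have h1 := (hs m hmS).trans (hs x hx).symm
    rw [ZMod.intCast_eq_intCast_iff_dvd_sub] at h1
    obtain ⟨y, hy⟩ := h1
    exact ⟨y, by linarith⟩
  have hdiv : ∀ y : ℤ, (m + t * y - m) / t = y := by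
    intro y
    rw [add_sub_cancel_left, Int.mul_ediv_cancel_left _ htz.ne']
  have e1 : S = (S.image (fun x => (x - m) / (t:ℤ))).image (fun y => m + t * y) := by
    rw [Finset.image_image]
    conv_lhs => rw [← Finset.image_id (s := S)]
    apply Finset.image_congr
    intro x hx
    obtain ⟨y, hy⟩ := hd x hx
    simp only [Function.comp, id]
    rw [hy, hdiv]
  have hcard : #(S.image (fun x => (x - m) / (t:ℤ))) = #S := by
    apply Finset.card_image_of_injOn
    intro x hx x' hx' e
    obtain ⟨y, hy⟩ := hd x hx
    obtain ⟨y', hy'⟩ := hd x' hx'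
    simp only [hy, hy', hdiv] at e
    rw [hy, hy', e]
  obtain ⟨yM, hyM⟩ := hd M hMS
  have hyM0 : 0 ≤ yM := by
    have : m ≤ M := Finset.min'_le S M hMS
    by_contra hc
    push Not at hc
    nlinarith
  refine ⟨S.image (fun x => (x - m) / (t:ℤ)), m, yM.toNat, e1, hcard, ?_, ?_, ?_, ?_⟩
  · rw [mem_image]; exact ⟨m, hmS, by simp⟩
  · rw [mem_image]; refine ⟨M, hMS, ?_⟩
    rw [hyM, hdiv]; omega
  · intro y hy
    obtain ⟨x, hx, rfl⟩ := mem_image.mp hy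
    have h1 : m ≤ x := Finset.min'_le S x hx
    have h2 : x ≤ M := Finset.le_max' S x hx
    obtain ⟨y, hy⟩ := hd x hx
    simp only [hy, hdiv]
    rw [mem_Icc]
    constructor
    · by_contra hc; push Not at hc; nlinarith
    · by_contra hc
      have : yM < y := by omega
      nlinarith
  · have h1 := mem_Icc.mp (hr hMS)
    have h2 := mem_Icc.mp (hr hmS)
    rw [Nat.le_div_iff_mul_le ht]
    have : (yM.toNat : ℤ) * t ≤ R := by
      have : (yM.toNat : ℤ) = yM := by omega
      rw [this]; nlinarith
    exact_mod_cast this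
theorem dense_step {S R : Finset ℤ} {t rA rB w N h : ℕ} (ht : 1 ≤ t) {s r : ZMod t} (hS : ∀ x ∈ S, ((x:ℤ) : ZMod t) = s)
    (hR : ∀ x ∈ R, ((x:ℤ) : ZMod t) = r) (hSA : S ⊆ Icc 0 (rA:ℤ)) (hRB : R ⊆ Icc 0 (rB:ℤ)) (hw : 1 ≤ w)
    (hc : 2 * (rA / t + 1) ≤ 2 * #S + w) (h2 : 2 * w ≤ rA / t) (h5 : 5 * w ≤ rB / t)
    (hN : rA / t ≤ N * w) (hh : rB / t + 1 ≤ #R + h) (hhw : 2 * (N + 2) * h ≤ w) :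
    ∃ S' ⊆ S, #S' ≤ 2 * N + 6 ∧ #S + #R ≤ #(S' + R) + 1 := by
  have hhw' : 4 * h ≤ w := by nlinarith
  have hSne : S.Nonempty := by rw [← card_pos]; omega
  have hRne : R.Nonempty := by rw [← card_pos]; omega
  obtain ⟨S0, m, ℓ, eS, cS, s0, sℓ, sI, hℓ⟩ := rescale (lA := 0) ht hSne hS hSA
  obtain ⟨R0, m', L, eR, cR, r0, rL, rI, hL⟩ := rescale (lA := 0) ht hRne hR hRB
  have c1 := Finset.card_le_card sI
  have c2 := Finset.card_le_card rI
  rw [Int.card_Icc] at c1 c2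
  have hh0 : L + 1 - #R ≤ h := by omega
  have hwin : ∀ j : ℤ, 0 ≤ j → j + w ≤ ℓ + 1 → w ≤ 2 * #{x ∈ S0 | j ≤ x ∧ x < j + w} := by
    intro j hj hjw
    have k1 : Ico j (j+w) ⊆ {x ∈ S0 | j ≤ x ∧ x < j + w} ∪ (Icc 0 (ℓ:ℤ) \ S0) := by
      intro x hx
      rw [mem_Ico] at hx
      by_cases hx0 : x ∈ S0
      · exact mem_union_left _ (mem_filter.mpr ⟨hx0, hx⟩)
      · exact mem_union_right _ (mem_sdiff.mpr ⟨by rw [mem_Icc]; omega, hx0⟩)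
    have k2 := (Finset.card_le_card k1).trans (Finset.card_union_le _ _)
    rw [Int.card_Ico, Finset.card_sdiff_of_subset sI, Int.card_Icc] at k2
    omega
  obtain ⟨S1, hS1, hS1c, hS1s⟩ := dense (N := N) (h := L + 1 - #R0) sI s0 sℓ rI hw (by omega) (by omega) hwin (hℓ.trans hN) (by omega)
    (by
      rw [cR]
      exact (Nat.mul_le_mul_left _ hh0).trans hhw)
  refine ⟨S1.image (fun y => m + t * y), ?_, Finset.card_image_le.trans hS1c, ?_⟩
  · rw [eS]; exact Finset.image_subset_image hS1
  · have htz : (0:ℤ) < t := by exact_mod_cast ht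
    have e : S1.image (fun y => m + t * y) + R = (S1 + R0).image (fun y => m + m' + t * y) := by
      ext z
      rw [eR]
      simp only [Finset.mem_add, mem_image]
      constructor
      · rintro ⟨_, ⟨a, ha, rfl⟩, _, ⟨b, hb, rfl⟩, rfl⟩
        exact ⟨a + b, ⟨a, ha, b, hb, rfl⟩, by ring⟩
      · rintro ⟨_, ⟨a, ha, b, hb, rfl⟩, rfl⟩
        exact ⟨_, ⟨a, ha, rfl⟩, _, ⟨b, hb, rfl⟩, by ring⟩
    rw [e, Finset.card_image_of_injective]
    · omega
    · intro x y e
      simp only [add_right_inj] at e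
      exact mul_left_cancel₀ htz.ne' e
end D
end CD
namespace CD
section D
theorem rank_sum {ι : Type*} [DecidableEq ι] (P : Finset ι) (f : ι → ℤ) (hf : Set.InjOn f P) :
    2 * ∑ r ∈ P, #{r' ∈ P | f r' < f r} = #P * (#P - 1) := by
  have e1 : ∑ r ∈ P, #{r' ∈ P | f r' < f r} = ∑ r ∈ P, #{r' ∈ P | f r < f r'} := by
    simp only [Finset.card_filter]; rw [Finset.sum_comm]
  have e2 : ∑ r ∈ P, (#{r' ∈ P | f r' < f r} + #{r' ∈ P | f r < f r'}) = ∑ r ∈ P, (#P - 1) := by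
    apply Finset.sum_congr rfl; intro r hr
    rw [← Finset.card_erase_of_mem hr, ← Finset.card_union_of_disjoint]
    · congr 1; ext x
      simp only [mem_union, mem_filter, mem_erase]
      constructor
      · rintro (⟨h1, h2⟩ | ⟨h1, h2⟩)
        · exact ⟨by rintro rfl; omega, h1⟩
        · exact ⟨by rintro rfl; omega, h1⟩
      · rintro ⟨h1, h2⟩
        rcases lt_trichotomy (f x) (f r) with h | h | h
        · exact Or.inl ⟨h2, h⟩
        · exact absurd (hf h2 hr h) h1
        · exact Or.inr ⟨h2, h⟩
    · rw [Finset.disjoint_left]; intro x; simp only [mem_filter]; omega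
  rw [Finset.sum_add_distrib, ← e1, Finset.sum_const, smul_eq_mul] at e2
  omega
theorem choose_r0 {t : ℕ} [NeZero t] (B : Finset ℤ) (htb : t ≤ #B) (m M : ZMod t → ℤ)
    (P : Finset (ZMod t)) (hP : P = B.image (Int.cast : ℤ → ZMod t))
    (hm : ∀ r ∈ P, ((m r : ℤ) : ZMod t) = r) (hM : ∀ r ∈ P, ((M r : ℤ) : ZMod t) = r) :
    ∃ r0 ∈ P, #B + t ≤ t * #{x ∈ B | ((x:ℤ) : ZMod t) = r0} + #{r ∈ P | m r < m r0} + #{r ∈ P | M r0 < M r} + 1 := by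
  have ht : 0 < t := Nat.pos_of_ne_zero (NeZero.ne t)
  have hBne : B.Nonempty := by rw [← card_pos]; omega
  have hPne : P.Nonempty := by rw [hP]; exact hBne.image _
  have hPt : #P ≤ t := by
    have := Finset.card_le_univ P; rwa [ZMod.card] at this
  have h1 := rank_sum P m (fun x hx y hy e => by rw [← hm x hx, ← hm y hy, e])
  have h2 := rank_sum P (fun r => - M r) (fun x hx y hy e => by
    have : M x = M y := by simpa using e
    rw [← hM x hx, ← hM y hy, this])
  have h3 : #B = ∑ r ∈ P, #{x ∈ B | ((x:ℤ) : ZMod t) = r} := by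
    apply Finset.card_eq_sum_card_fiberwise
    intro x hx; rw [hP]; simp only [coe_image]; exact Set.mem_image_of_mem _ hx
  simp only [neg_lt_neg_iff] at h2
  by_contra! hcon
  have hlt : ∑ r ∈ P, (t * #{x ∈ B | ((x:ℤ) : ZMod t) = r} + #{r' ∈ P | m r' < m r} + #{r' ∈ P | M r < M r'} + 1) <
      ∑ r ∈ P, (#B + t) := Finset.sum_lt_sum_of_nonempty hPne hcon
  simp only [Finset.sum_add_distrib, ← Finset.mul_sum, ← h3, Finset.sum_const, smul_eq_mul] at hlt
  obtain ⟨q, hq⟩ : ∃ q, #P = q + 1 := ⟨#P - 1, by have := hPne.card_pos; omega⟩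
  rw [hq] at h1 h2 hlt hPt
  simp only [Nat.add_sub_cancel] at h1 h2
  obtain ⟨g, hg⟩ : ∃ g, t = q + 1 + g := ⟨t - (q+1), by omega⟩
  set s1 := ∑ r ∈ P, #{r' ∈ P | m r' < m r}
  set s2 := ∑ r ∈ P, #{r' ∈ P | M r < M r'}
  have e5 : s1 + s2 = (q+1) * q := by omega
  have hlt' : t * #B + (q+1)*q + (q+1) < (q+1) * #B + (q+1) * t := by
    rw [← e5]
    have : (q+1) * #B + (q+1) * t = (q+1)*(#B + t) := by ring
    nlinarith
  rw [hg] at hlt' htb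
  nlinarith
theorem card_cls_le {X : Finset ℤ} {t R : ℕ} (ht : 1 ≤ t) (hX : X ⊆ Icc 0 (R:ℤ)) (r : ZMod t) :
    #{x ∈ X | ((x:ℤ) : ZMod t) = r} ≤ R / t + 1 := by
  rcases ({x ∈ X | ((x:ℤ) : ZMod t) = r}).eq_empty_or_nonempty with h | h
  · rw [h]; simp
  · obtain ⟨S0, m, ℓ, eS, cS, s0, sℓ, sI, hℓ⟩ := rescale (lA := 0) ht h (s := r) (fun x hx => (mem_filter.mp hx).2)
      ((Finset.filter_subset _ _).trans hX)
    rw [← cS]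
    have := Finset.card_le_card sI
    rw [Int.card_Icc] at this
    omega
theorem card_cls_ge {t : ℕ} (ht : 1 ≤ t) (u v : ℤ) (r : ZMod t) :
    ((v - u : ℤ) : ℝ) / t - 1 ≤ #{x ∈ Icc u v | ((x:ℤ) : ZMod t) = r} := by
  obtain ⟨k, rfl⟩ := ZMod.intCast_surjective r
  have htz : (0:ℤ) < t := by exact_mod_cast ht
  have h1 := Int.Ioc_filter_modEq_card u v htz k
  have h2 : {x ∈ Ioc u v | x ≡ k [ZMOD (t:ℤ)]} ⊆ {x ∈ Icc u v | ((x:ℤ) : ZMod t) = (k : ZMod t)} := by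
    intro x
    simp only [mem_filter, mem_Icc, mem_Ioc]
    rintro ⟨h3, h4⟩
    exact ⟨by omega, by rw [ZMod.intCast_eq_intCast_iff]; exact h4⟩
  have h3 := Finset.card_le_card h2
  have h4 : ((v - u : ℤ) : ℝ) / t - 1 ≤ (#{x ∈ Ioc u v | x ≡ k [ZMOD (t:ℤ)]} : ℝ) := by
    have h5 : (⌊((v:ℚ) - k) / (t:ℤ)⌋ - ⌊((u:ℚ) - k) / (t:ℤ)⌋ : ℤ) ≤ (#{x ∈ Ioc u v | x ≡ k [ZMOD (t:ℤ)]} : ℤ) := by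
      rw [h1]; exact le_max_left _ _
    have f1 := Int.lt_floor_add_one (((v:ℚ) - k) / (t:ℤ))
    have f2 := Int.floor_le (((u:ℚ) - k) / (t:ℤ))
    have h6 : ((⌊((v:ℚ) - k) / (t:ℤ)⌋ : ℚ) - (⌊((u:ℚ) - k) / (t:ℤ)⌋ : ℚ)) ≤ (#{x ∈ Ioc u v | x ≡ k [ZMOD (t:ℤ)]} : ℚ) := by
      exact_mod_cast h5
    have h7 : ((v - u : ℤ) : ℚ) / t - 1 ≤ (#{x ∈ Ioc u v | x ≡ k [ZMOD (t:ℤ)]} : ℚ) := by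
      have : ((v - u : ℤ) : ℚ) / t = ((v:ℚ) - k) / (t:ℤ) - ((u:ℚ) - k) / (t:ℤ) := by push_cast; ring
      rw [this]; linarith
    exact_mod_cast h7
  refine h4.trans ?_
  exact_mod_cast h3
theorem rr_lower {A B : Finset ℤ} {ℓA ℓB g hA hB : ℕ} (hAI : A ⊆ Icc 0 (ℓA:ℤ)) (hBI : B ⊆ Icc 0 (ℓB:ℤ))
    (cA : ℓA + 1 ≤ #A + hA) (cB : ℓB + 1 ≤ #B + hB) (gA : g ≤ ℓA) (gB : g ≤ ℓB) {y : ℤ} (hy0 : (g:ℤ) ≤ y) (hy1 : y ≤ (ℓA:ℤ) + ℓB - g) :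
    g ≤ rr A B y + hA + hB := by
  have k1 : Icc (max 0 (y - ℓB)) (min (ℓA:ℤ) y) ⊆ ({a ∈ A | y - a ∈ B} ∪ (Icc 0 (ℓA:ℤ) \ A)) ∪ (Icc 0 (ℓB:ℤ) \ B).image (fun x => y - x) := by
    intro x hx
    rw [mem_Icc] at hx
    by_cases h1 : x ∈ A
    · by_cases h2 : y - x ∈ B
      · exact mem_union_left _ (mem_union_left _ (mem_filter.mpr ⟨h1, h2⟩))
      · apply mem_union_right
        rw [mem_image]; refine ⟨y - x, ?_, by ring⟩
        rw [mem_sdiff, mem_Icc]; exact ⟨by omega, h2⟩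
    · apply mem_union_left; apply mem_union_right
      rw [mem_sdiff, mem_Icc]; exact ⟨by omega, h1⟩
  have k2 := Finset.card_le_card k1
  have k3 := Finset.card_union_le ({a ∈ A | y - a ∈ B} ∪ (Icc 0 (ℓA:ℤ) \ A)) ((Icc 0 (ℓB:ℤ) \ B).image (fun x => y - x))
  have k4 := Finset.card_union_le {a ∈ A | y - a ∈ B} (Icc 0 (ℓA:ℤ) \ A)
  have k5 := Finset.card_image_le (s := Icc 0 (ℓB:ℤ) \ B) (f := fun x => y - x)
  rw [Finset.card_sdiff_of_subset hBI, Int.card_Icc] at k5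
  rw [Finset.card_sdiff_of_subset hAI, Int.card_Icc] at k4
  rw [Int.card_Icc] at k2
  have e : rr A B y = #{a ∈ A | y - a ∈ B} := rfl
  omega
end D
end CD
namespace CD
section D
def cls {t : ℕ} (X : Finset ℤ) (r : ZMod t) : Finset ℤ := {x ∈ X | ((x:ℤ) : ZMod t) = r}
theorem mem_cls {t : ℕ} {X : Finset ℤ} {r : ZMod t} {x : ℤ} : x ∈ cls X r ↔ x ∈ X ∧ ((x:ℤ) : ZMod t) = r := mem_filter
theorem combine {t : ℕ} [NeZero t] {A B : Finset ℤ} {ℓA C D d1 d2 : ℕ} (hAI : A ⊆ Icc 0 (ℓA:ℤ)) (h0 : (0:ℤ) ∈ A) (hℓ : (ℓA:ℤ) ∈ A)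
    (htb : t ≤ #B) (Bad : Finset (ZMod t))
    (hgood : ∀ r0 : ZMod t, #B + 1 ≤ t * #(cls B r0) + t → ∀ s, s ∉ Bad → ∃ S' ⊆ cls A s, #S' ≤ C ∧ #(cls A s) + #(cls B r0) ≤ #(S' + cls B r0) + 1)
    (hbad : ∀ r0 : ZMod t, ∃ A1 ⊆ A, ∃ B1 ⊆ B, #A1 ≤ d1 ∧ #B1 ≤ d2 ∧
      ∑ s ∈ Bad, (#(cls A s) + #(cls B r0) + 1) ≤ #{y ∈ A1 + B1 | ((y:ℤ) : ZMod t) - r0 ∈ Bad})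
    (hD : ∀ r : ZMod t, #(cls B r) ≤ D) :
    ∃ A' ⊆ A, ∃ B' ⊆ B, #A' ≤ C * t + 2 + d1 ∧ #B' ≤ D + 2 * t + d2 ∧ #A + #B ≤ #(A' + B') + 1 := by
  have ht : 0 < t := Nat.pos_of_ne_zero (NeZero.ne t)
  set P := B.image (Int.cast : ℤ → ZMod t) with hP
  have hmm : ∀ r : ZMod t, ∃ m M : ℤ, r ∈ P → (m ∈ cls B r ∧ M ∈ cls B r ∧ ∀ x ∈ cls B r, m ≤ x ∧ x ≤ M) := by
    intro r
    by_cases hr : r ∈ P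
    · have hne : (cls B r).Nonempty := by
        obtain ⟨x, hx, e⟩ := mem_image.mp hr
        exact ⟨x, mem_cls.mpr ⟨hx, e⟩⟩
      exact ⟨(cls B r).min' hne, (cls B r).max' hne, fun _ => ⟨Finset.min'_mem _ _, Finset.max'_mem _ _,
        fun x hx => ⟨Finset.min'_le _ _ hx, Finset.le_max' _ _ hx⟩⟩⟩
    · exact ⟨0, 0, fun h => absurd h hr⟩
  choose m M hmM using hmm
  obtain ⟨r0, hr0, hr0c⟩ := choose_r0 B htb m M P hP (fun r hr => (mem_cls.mp (hmM r hr).1).2) (fun r hr => (mem_cls.mp (hmM r hr).2.1).2)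
  set R1 := {r ∈ P | m r < m r0} with hR1
  set R2 := {r ∈ P | M r0 < M r} with hR2
  have hr0c' : #B + t ≤ t * #(cls B r0) + #R1 + #R2 + 1 := hr0c
  have hPt : #P ≤ t := by
    have := Finset.card_le_univ P; rwa [ZMod.card] at this
  have hR1c : #R1 + 1 ≤ t := by
    refine le_trans ?_ hPt
    have : R1 ⊆ P.erase r0 := by
      intro r hr; rw [mem_filter] at hr; rw [mem_erase]; exact ⟨by rintro rfl; omega, hr.1⟩
    have := Finset.card_le_card this
    rw [Finset.card_erase_of_mem hr0] at this
    have := Finset.card_pos.mpr ⟨r0, hr0⟩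
    omega
  have hR2c : #R2 + 1 ≤ t := by
    refine le_trans ?_ hPt
    have : R2 ⊆ P.erase r0 := by
      intro r hr; rw [mem_filter] at hr; rw [mem_erase]; exact ⟨by rintro rfl; omega, hr.1⟩
    have := Finset.card_le_card this
    rw [Finset.card_erase_of_mem hr0] at this
    have := Finset.card_pos.mpr ⟨r0, hr0⟩
    omega
  have hgr := hgood r0 (by omega)
  have hgr' : ∀ s, ∃ S' ⊆ cls A s, #S' ≤ C ∧ (s ∉ Bad → #(cls A s) + #(cls B r0) ≤ #(S' + cls B r0) + 1) := by
    intro s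
    by_cases hs : s ∈ Bad
    · exact ⟨∅, by simp, by simp, fun h => absurd hs h⟩
    · obtain ⟨S', k1, k2, k3⟩ := hgr s hs
      exact ⟨S', k1, k2, fun _ => k3⟩
  choose S' hS' hS'c hS's using hgr'
  obtain ⟨A1, hA1, B1, hB1, cA1, cB1, hb⟩ := hbad r0
  set A' : Finset ℤ := (univ.biUnion S' ∪ {0, (ℓA:ℤ)}) ∪ A1 with hA'
  set B' : Finset ℤ := (cls B r0 ∪ (P.image m ∪ P.image M)) ∪ B1 with hB'
  refine ⟨A', ?_, B', ?_, ?_, ?_, ?_⟩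
  · apply Finset.union_subset (Finset.union_subset _ _) hA1
    · rw [Finset.biUnion_subset]; intro s _
      exact (hS' s).trans (Finset.filter_subset _ _)
    · simp [insert_subset_iff, h0, hℓ]
  · apply Finset.union_subset (Finset.union_subset (Finset.filter_subset _ _) (Finset.union_subset _ _)) hB1
    · intro x hx; obtain ⟨r, hr, rfl⟩ := mem_image.mp hx
      exact (mem_cls.mp (hmM r hr).1).1
    · intro x hx; obtain ⟨r, hr, rfl⟩ := mem_image.mp hx
      exact (mem_cls.mp (hmM r hr).2.1).1
  · have u1 := Finset.card_union_le (univ.biUnion S' ∪ {0, (ℓA:ℤ)}) A1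
    have u2 := Finset.card_union_le (univ.biUnion S') {0, (ℓA:ℤ)}
    have u3 : #({0, (ℓA:ℤ)} : Finset ℤ) ≤ 2 := Finset.card_le_two
    have u4 : #(univ.biUnion S') ≤ C * t := by
      refine Finset.card_biUnion_le.trans ?_
      refine (Finset.sum_le_sum fun s _ => hS'c s).trans ?_
      rw [Finset.sum_const, card_univ, ZMod.card, smul_eq_mul, mul_comm]
    rw [hA']; omega
  · have u1 := Finset.card_union_le (cls B r0 ∪ (P.image m ∪ P.image M)) B1
    have u2 := Finset.card_union_le (cls B r0) (P.image m ∪ P.image M)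
    have u3 := Finset.card_union_le (P.image m) (P.image M)
    have u4 := Finset.card_image_le (s := P) (f := m)
    have u5 := Finset.card_image_le (s := P) (f := M)
    have := hD r0
    rw [hB']; omega
  set T := A' + B' with hT
  let F : ZMod t → ℕ := fun s => #{y ∈ T | ((y:ℤ) : ZMod t) - r0 = s}
  let ind : ZMod t → ℕ := fun s => (if r0 + s ∈ R1 then 1 else 0) + (if (r0 - (ℓA:ZMod t)) + s ∈ R2 then 1 else 0)
  have hTF : #T = ∑ s, F s := Finset.card_eq_sum_card_fiberwise (fun x _ => by simp)
  have hAF : #A = ∑ s, #(cls A s) := Finset.card_eq_sum_card_fiberwise (f := fun x : ℤ => (x : ZMod t)) (fun x _ => by simp)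
  have hind1 : ∀ (z : ZMod t) (R : Finset (ZMod t)), ∑ s, (if z + s ∈ R then 1 else 0) = #R := by
    intro z R
    rw [Fintype.sum_equiv (Equiv.addLeft z) (fun s => if z + s ∈ R then 1 else 0) (fun s => if s ∈ R then 1 else 0) (fun s => rfl)]
    rw [← Finset.card_filter]; congr 1; ext; simp
  have hindsum : ∑ s, ind s = #R1 + #R2 := by
    simp only [ind, Finset.sum_add_distrib]
    rw [hind1, hind1]
  have hg : ∀ s, s ∉ Bad → #(cls A s) + #(cls B r0) + ind s ≤ F s + 1 := by
    intro s hs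
    have k1 := hS's s hs
    set X1 : Finset ℤ := if r0 + s ∈ R1 then {m (r0+s)} else ∅ with hX1
    set X2 : Finset ℤ := if (r0 - (ℓA:ZMod t)) + s ∈ R2 then {(ℓA:ℤ) + M ((r0 - (ℓA:ZMod t))+s)} else ∅ with hX2
    have b0 := (hmM r0 hr0).2.2
    have hrange : ∀ y ∈ S' s + cls B r0, m r0 ≤ y ∧ y ≤ (ℓA:ℤ) + M r0 := by
      intro y hy
      obtain ⟨x, hx, b, hb', rfl⟩ := Finset.mem_add.mp hy
      have g1 := mem_Icc.mp (hAI (mem_cls.mp (hS' s hx)).1)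
      have g2 := b0 b hb'
      omega
    have hm0M0 : m r0 ≤ M r0 := (b0 _ (hmM r0 hr0).1).2
    have d1 : Disjoint (S' s + cls B r0) X1 := by
      rw [hX1]; split_ifs with h
      · rw [Finset.disjoint_singleton_right]; intro hc
        have := hrange _ hc
        have := (mem_filter.mp h).2
        omega
      · simp
    have d2 : Disjoint ((S' s + cls B r0) ∪ X1) X2 := by
      rw [hX2]; split_ifs with h
      · rw [Finset.disjoint_singleton_right]; intro hc
        have h2 := mem_filter.mp h
        rw [mem_union] at hc
        rcases hc with hc | hc
        · have := hrange _ hc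
          omega
        · rw [hX1] at hc
          split_ifs at hc with h'
          · rw [mem_singleton] at hc
            have := (mem_filter.mp h').2
            omega
          · simp at hc
      · simp
    have hsub : ((S' s + cls B r0) ∪ X1) ∪ X2 ⊆ {y ∈ T | ((y:ℤ) : ZMod t) - r0 = s} := by
      apply Finset.union_subset (Finset.union_subset _ _)
      · rw [hX2]; split_ifs with h
        · have hp := (mem_filter.mp h).1
          have g1 := (hmM _ hp).2.1
          have g2 := (hmM _ hp).1
          rw [Finset.singleton_subset_iff, mem_filter]
          refine ⟨Finset.add_mem_add (by simp [hA']) (by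
            rw [hB']; exact mem_union_left _ (mem_union_right _ (mem_union_right _ (mem_image_of_mem _ hp)))), ?_⟩
          push_cast
          rw [(mem_cls.mp g1).2]
          ring
        · simp
      · intro y hy
        obtain ⟨x, hx, b, hb', rfl⟩ := Finset.mem_add.mp hy
        rw [mem_filter]
        refine ⟨Finset.add_mem_add ?_ ?_, ?_⟩
        · rw [hA']; exact mem_union_left _ (mem_union_left _ (mem_biUnion.mpr ⟨s, mem_univ _, hx⟩))
        · rw [hB']; exact mem_union_left _ (mem_union_left _ hb')
        · push_cast
          rw [(mem_cls.mp (hS' s hx)).2, (mem_cls.mp hb').2]; ring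
      · rw [hX1]; split_ifs with h
        · have hp := (mem_filter.mp h).1
          have g2 := (hmM _ hp).1
          rw [Finset.singleton_subset_iff, mem_filter]
          refine ⟨?_, ?_⟩
          · have : (0:ℤ) + m (r0+s) ∈ T := Finset.add_mem_add (by simp [hA']) (by
              rw [hB']; exact mem_union_left _ (mem_union_right _ (mem_union_left _ (mem_image_of_mem _ hp))))
            rwa [zero_add] at this
          · rw [(mem_cls.mp g2).2]; ring
        · simp
    have hc := Finset.card_le_card hsub
    rw [Finset.card_union_of_disjoint d2, Finset.card_union_of_disjoint d1] at hc
    have i1 : #X1 = if r0 + s ∈ R1 then 1 else 0 := by rw [hX1]; split_ifs <;> simp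
    have i2 : #X2 = if (r0 - (ℓA:ZMod t)) + s ∈ R2 then 1 else 0 := by rw [hX2]; split_ifs <;> simp
    have i3 : ind s = #X1 + #X2 := by rw [i1, i2]
    have i4 : F s = #{y ∈ T | ((y:ℤ) : ZMod t) - r0 = s} := rfl
    omega
  have hbT : ∑ s ∈ Bad, (#(cls A s) + #(cls B r0) + 1) ≤ ∑ s ∈ Bad, F s := by
    refine hb.trans ?_
    have e1 : #{y ∈ A1 + B1 | ((y:ℤ) : ZMod t) - r0 ∈ Bad} ≤ #{y ∈ T | ((y:ℤ) : ZMod t) - r0 ∈ Bad} := by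
      apply Finset.card_le_card
      apply Finset.filter_subset_filter
      rw [hT, hA', hB']
      exact Finset.add_subset_add (Finset.subset_union_right) (Finset.subset_union_right)
    refine e1.trans ?_
    have e2 : ∀ x ∈ {y ∈ T | ((y:ℤ) : ZMod t) - r0 ∈ Bad}, ((x:ℤ) : ZMod t) - r0 ∈ Bad := fun x hx => (mem_filter.mp hx).2
    rw [Finset.card_eq_sum_card_fiberwise (s := {y ∈ T | ((y:ℤ) : ZMod t) - r0 ∈ Bad}) (f := fun y : ℤ => (y : ZMod t) - r0) (t := Bad) e2]
    apply Finset.sum_le_sum; intro s hs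
    apply Finset.card_le_card
    intro y; simp only [mem_filter]; tauto
  have hbT' : ∑ s ∈ Bad, (#(cls A s) + #(cls B r0) + ind s) ≤ ∑ s ∈ Bad, (F s + 1) := by
    have e1 : ∑ s ∈ Bad, (#(cls A s) + #(cls B r0) + ind s) ≤ ∑ s ∈ Bad, ((#(cls A s) + #(cls B r0) + 1) + 1) := by
      apply Finset.sum_le_sum; intro s _
      simp only [ind]; split_ifs <;> omega
    refine e1.trans ?_
    rw [Finset.sum_add_distrib, Finset.sum_add_distrib (f := F)]
    omega
  have hgT : ∑ s ∈ univ \ Bad, (#(cls A s) + #(cls B r0) + ind s) ≤ ∑ s ∈ univ \ Bad, (F s + 1) :=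
    Finset.sum_le_sum fun s hs => hg s (mem_sdiff.mp hs).2
  have h1 := Finset.sum_sdiff (subset_univ Bad) (f := fun s => #(cls A s) + #(cls B r0) + ind s)
  have h2 := Finset.sum_sdiff (subset_univ Bad) (f := fun s => F s + 1)
  have h3 : ∑ s, (#(cls A s) + #(cls B r0) + ind s) = #A + t * #(cls B r0) + (#R1 + #R2) := by
    rw [Finset.sum_add_distrib, Finset.sum_add_distrib, hindsum, ← hAF, Finset.sum_const, card_univ, ZMod.card, smul_eq_mul]
  have h4 : ∑ s, (F s + 1) = #T + t := by
    rw [Finset.sum_add_distrib, ← hTF]; simp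
  omega
end D
end CD
namespace CD
section D
/-- random filling of the bad classes -/
theorem bad_fill {t : ℕ} [NeZero t] {A B : Finset ℤ} {ℓA ℓB d1 d2 g K w hA hB : ℕ} (hK : 1 ≤ K)
    (hAI : A ⊆ Icc 0 (ℓA:ℤ)) (hBI : B ⊆ Icc 0 (ℓB:ℤ)) (cA : ℓA + 1 ≤ #A + hA) (cB : ℓB + 1 ≤ #B + hB)
    (gA : g ≤ ℓA) (gB : g ≤ ℓB) (h1 : 1 ≤ d1) (h1A : d1 ≤ #A) (h2 : 1 ≤ d2) (h2B : d2 ≤ #B)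
    (hw : 40 ≤ w) (hg8 : 8 * g ≤ t * w) (hg : (t * w : ℝ) ≤ 16 * ((g:ℝ) - hA - hB))
    (hlen : (ℓA + ℓB : ℝ) ≤ 80 * K * w * t)
    (hτ : (#A * #B : ℝ) / (d1 * d2) * (640 * K) ≤ t * w / 16)
    (Bad : Finset (ZMod t)) (hBad : ∀ s ∈ Bad, 2 * #(cls A s) + w + 1 ≤ 2 * (ℓA / t + 1)) (r0 : ZMod t) :
    ∃ A1 ⊆ A, ∃ B1 ⊆ B, #A1 ≤ d1 ∧ #B1 ≤ d2 ∧
      ∑ s ∈ Bad, (#(cls A s) + #(cls B r0) + 1) ≤ #{y ∈ A1 + B1 | ((y:ℤ) : ZMod t) - r0 ∈ Bad} := by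
  have ht : 0 < t := Nat.pos_of_ne_zero (NeZero.ne t)
  set Q : Finset ℤ := {y ∈ Icc (g:ℤ) ((ℓA:ℤ) + ℓB - g) | ((y:ℤ) : ZMod t) - r0 ∈ Bad} with hQ
  obtain ⟨A1, hA1, B1, hB1, c1, c2, hsum⟩ := random_lemma Q h1 h1A h2 h2B
  refine ⟨A1, hA1, B1, hB1, c1.le, c2.le, ?_⟩
  set τ : ℝ := (#A * #B : ℝ) / (d1 * d2) with hτd
  have hτ0 : 0 ≤ τ := by positivity
  have hK0 : (1:ℝ) ≤ K := by exact_mod_cast hK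
  have hw0 : (40:ℝ) ≤ w := by exact_mod_cast hw
  have ht0 : (1:ℝ) ≤ t := by exact_mod_cast ht
  set ε : ℝ := 1 / (640 * K) with hε
  have hε0 : 0 ≤ ε := by positivity
  have hεK : ε * (640 * K) = 1 := by rw [hε]; field_simp
  have hterm : ∀ y ∈ Q, 1 - ε ≤ (rr A B y : ℝ) / (rr A B y + τ) := by
    intro y hy
    obtain ⟨hy1, _⟩ := mem_filter.mp hy
    rw [mem_Icc] at hy1
    have k1 := rr_lower hAI hBI cA cB gA gB hy1.1 hy1.2
    have k2 : (g:ℝ) ≤ rr A B y + hA + hB := by exact_mod_cast k1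
    set r : ℝ := (rr A B y : ℝ)
    have k3 : (t:ℝ) * w / 16 ≤ r := by linarith
    have k4 : 0 < (t:ℝ) * w / 16 := by positivity
    have k5 : τ ≤ ε * r := by
      have : τ * (640 * K) ≤ r := hτ.trans k3
      calc τ = ε * (τ * (640 * K)) := by linear_combination (-τ) * hεK
        _ ≤ ε * r := mul_le_mul_of_nonneg_left this hε0
    rw [le_div_iff₀ (by linarith)]
    nlinarith [mul_nonneg hε0 hτ0]
  have hQc : (1 - ε) * #Q ≤ #((A1 + B1) ∩ Q) := by
    refine le_trans ?_ hsum
    rw [mul_comm, ← nsmul_eq_mul]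
    exact Finset.card_nsmul_le_sum _ _ _ hterm
  have hQs : #Q = ∑ s ∈ Bad, #{y ∈ Icc (g:ℤ) ((ℓA:ℤ) + ℓB - g) | ((y:ℤ) : ZMod t) = r0 + s} := by
    have e2 : ∀ x ∈ Q, ((x:ℤ) : ZMod t) - r0 ∈ Bad := fun x hx => (mem_filter.mp hx).2
    rw [Finset.card_eq_sum_card_fiberwise (s := Q) (f := fun y : ℤ => (y : ZMod t) - r0) (t := Bad) e2]
    apply Finset.sum_congr rfl; intro s hs
    congr 1; ext y
    simp only [hQ, mem_filter]
    constructor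
    · rintro ⟨⟨k1, k2⟩, k3⟩; exact ⟨k1, by rw [← k3]; ring⟩
    · rintro ⟨k1, k2⟩
      have : ((y:ℤ) : ZMod t) - r0 = s := by rw [k2]; ring
      exact ⟨⟨k1, by rwa [this]⟩, this⟩
  have hfin : (∑ s ∈ Bad, (#(cls A s) + #(cls B r0) + 1) : ℝ) ≤ (1 - ε) * #Q := by
    rw [hQs]; push_cast; rw [Finset.mul_sum]
    apply Finset.sum_le_sum; intro s hs
    have q1 := card_cls_ge ht (g:ℤ) ((ℓA:ℤ) + ℓB - g) (r0 + s)
    push_cast at q1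
    have q2 := hBad s hs
    have q3 : #(cls B r0) ≤ ℓB / t + 1 := card_cls_le ht hBI r0
    have q4 : ((ℓA / t : ℕ) : ℝ) ≤ ℓA / t := Nat.cast_div_le
    have q5 : ((ℓB / t : ℕ) : ℝ) ≤ ℓB / t := Nat.cast_div_le
    have q2' : (2:ℝ) * #(cls A s) + w + 1 ≤ 2 * ((ℓA / t : ℕ) + 1) := by exact_mod_cast q2
    have q3' : (#(cls B r0) : ℝ) ≤ (ℓB / t : ℕ) + 1 := by exact_mod_cast q3
    have q6 : (g:ℝ) / t ≤ w / 8 := by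
      rw [div_le_div_iff₀ (by positivity) (by norm_num)]
      have : (8:ℝ) * g ≤ t * w := by exact_mod_cast hg8
      linarith
    have q7 : ((ℓA:ℝ) + ℓB) / t ≤ 80 * K * w := by
      rw [div_le_iff₀ (by positivity)]; exact hlen
    set nq : ℝ := (#{y ∈ Icc (g:ℤ) ((ℓA:ℤ) + ℓB - g) | ((y:ℤ) : ZMod t) = r0 + s} : ℝ)
    set uA : ℝ := (ℓA:ℝ) / t
    set uB : ℝ := (ℓB:ℝ) / t
    set ug : ℝ := (g:ℝ) / t
    have q8 : ((ℓA:ℝ) + ℓB - g - g) / t = uA + uB - 2 * ug := by simp only [uA, uB, ug]; ring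
    have q9 : ((ℓA:ℝ) + ℓB) / t = uA + uB := by simp only [uA, uB]; ring
    rw [q8] at q1; rw [q9] at q7
    have q10 : ε * (uA + uB) ≤ w / 8 := by
      calc ε * (uA + uB) ≤ ε * (80 * K * w) := mul_le_mul_of_nonneg_left q7 hε0
        _ = w / 8 := by linear_combination (w/8) * hεK
    have hε1 : ε ≤ 1 := by
      rw [hε, div_le_one (by positivity)]; linarith
    have hug : 0 ≤ ug := by positivity
    have q11 : (1 - ε) * (uA + uB - 2 * ug - 1) ≤ (1 - ε) * nq := mul_le_mul_of_nonneg_left q1 (by linarith)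
    have q12 := mul_nonneg hε0 hug
    have q13 : (1 - ε) * (uA + uB - 2 * ug - 1) = uA + uB - 2 * ug - 1 - ε * (uA + uB) + 2 * (ε * ug) + ε := by ring
    rw [q13] at q11
    linarith
  have hle : #((A1 + B1) ∩ Q) ≤ #{y ∈ A1 + B1 | ((y:ℤ) : ZMod t) - r0 ∈ Bad} := by
    apply Finset.card_le_card
    intro y hy
    rw [mem_inter] at hy
    exact mem_filter.mpr ⟨hy.1, (mem_filter.mp hy.2).2⟩
  have hle' : (#((A1 + B1) ∩ Q) : ℝ) ≤ #{y ∈ A1 + B1 | ((y:ℤ) : ZMod t) - r0 ∈ Bad} := by exact_mod_cast hle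
  have := hfin.trans (hQc.trans hle')
  exact_mod_cast this
set_option maxHeartbeats 1000000 in
theorem intP (K : ℕ) (hK : 1 ≤ K) : ∃ κ : ℝ, 0 < κ ∧ ∃ C : ℕ, 1 ≤ C ∧ ∀ (n t d1 d2 ℓA ℓB : ℕ) (A B : Finset ℤ),
    A ⊆ Icc 0 (ℓA:ℤ) → (0:ℤ) ∈ A → (ℓA:ℤ) ∈ A → B ⊆ Icc 0 (ℓB:ℤ) → n ≤ K * ℓA → n ≤ K * ℓB → ℓA ≤ 2 * n → ℓB ≤ 2 * n →
    (ℓA + 1 : ℝ) ≤ #A + κ * n → (ℓB + 1 : ℝ) ≤ #B + κ * n → 1 ≤ t → C * t ≤ n → C * n ≤ d1 * d2 → 1 ≤ d1 → d1 ≤ #A → 1 ≤ d2 → d2 ≤ #B →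
    ∃ A' ⊆ A, ∃ B' ⊆ B, #A' ≤ C * t + d1 ∧ #B' ≤ ℓB / t + 1 + 2 * t + d2 ∧ #A + #B ≤ #(A' + B') + 1 := by
  set N := 40 * K with hN
  refine ⟨1 / (80 * K * (N + 2)), by positivity, 2000000 * K ^ 2, by nlinarith, ?_⟩
  intro n t d1 d2 ℓA ℓB A B hAI h0 hℓ hBI hnA hnB hA2 hB2 hholeA hholeB ht hCt hCd h1 h1A h2 h2B
  have : NeZero t := ⟨by omega⟩
  set w := n / (10 * K * t) with hw
  have hKt : 0 < 10 * K * t := by positivity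
  have hwn : w * (10 * K * t) ≤ n := Nat.div_mul_le_self _ _
  have hnw : n < (w + 1) * (10 * K * t) := by
    have := Nat.lt_div_mul_add (a := n) hKt
    rw [← hw] at this; linarith
  have hwb : 200000 * K ≤ w := by
    rw [hw, Nat.le_div_iff_mul_le hKt]
    refine le_trans (le_of_eq ?_) hCt
    ring
  have hnw2 : n ≤ 20 * K * t * w := by
    have : (w + 1) * (10 * K * t) ≤ (2 * w) * (10 * K * t) := Nat.mul_le_mul_right _ (by omega)
    have e : (2 * w) * (10 * K * t) = 20 * K * t * w := by ring
    omega
  have hlA : 10 * w ≤ ℓA / t := by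
    rw [Nat.le_div_iff_mul_le ht]
    have : K * (10 * w * t) ≤ K * ℓA := by
      have e : K * (10 * w * t) = w * (10 * K * t) := by ring
      omega
    exact Nat.le_of_mul_le_mul_left this hK
  have hlB : 10 * w ≤ ℓB / t := by
    rw [Nat.le_div_iff_mul_le ht]
    have : K * (10 * w * t) ≤ K * ℓB := by
      have e : K * (10 * w * t) = w * (10 * K * t) := by ring
      omega
    exact Nat.le_of_mul_le_mul_left this hK
  have hlA2 : ℓA / t ≤ N * w := by
    apply Nat.div_le_of_le_mul
    have e : t * (N * w) = 2 * (20 * K * t * w) := by rw [hN]; ring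
    omega
  have hKr : (1:ℝ) ≤ K := by exact_mod_cast hK
  have htr : (1:ℝ) ≤ t := by exact_mod_cast ht
  have hwr : (200000 * K:ℝ) ≤ w := by exact_mod_cast hwb
  have hnr : (n:ℝ) ≤ 20 * K * t * w := by exact_mod_cast hnw2
  have hNr : (N:ℝ) = 40 * K := by rw [hN]; push_cast; ring
  set κ : ℝ := 1 / (80 * K * (N + 2)) with hκ
  have hκn : κ * n ≤ t * w / (4 * (N + 2)) := by
    calc κ * n ≤ κ * (20 * K * t * w) := mul_le_mul_of_nonneg_left hnr (by positivity)
      _ = t * w / (4 * (N + 2)) := by rw [hκ]; field_simp; ring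
  have hκn2 : κ * n ≤ t * w / 160 := by
    refine hκn.trans ?_
    apply div_le_div_of_nonneg_left (by positivity) (by norm_num)
    rw [hNr]; linarith
  set h := w / (2 * (N + 2)) with hh
  have hh1 : 2 * (N + 2) * h ≤ w := by rw [mul_comm]; exact Nat.div_mul_le_self _ _
  have hh2 : (w:ℝ) / (2 * (N + 2)) ≤ h + 1 := by
    have : w < (h + 1) * (2 * (N+2)) := by
      have := Nat.lt_div_mul_add (a := w) (b := 2 * (N+2)) (by positivity)
      rw [← hh] at this; linarith
    rw [div_le_iff₀ (by positivity)]
    exact_mod_cast this.le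
  have hAle : #A ≤ ℓA + 1 := by
    have := Finset.card_le_card hAI; rw [Int.card_Icc] at this; omega
  have hBle : #B ≤ ℓB + 1 := by
    have := Finset.card_le_card hBI; rw [Int.card_Icc] at this; omega
  have htb : t ≤ #B := by
    have k1 : 10 * w * t ≤ ℓB := (Nat.le_div_iff_mul_le ht).mp hlB
    have k2 : (10 * w * t : ℝ) ≤ ℓB := by exact_mod_cast k1
    have k4 : (t:ℝ) ≤ w * t := le_mul_of_one_le_left (by linarith) (by linarith)
    have k3 : (t:ℝ) ≤ #B := by linarith
    exact_mod_cast k3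
  set Bad : Finset (ZMod t) := {s | ¬ 2 * (ℓA / t + 1) ≤ 2 * #(cls A s) + w} with hBad
  have key := combine (t := t) (C := 2 * N + 6) (D := ℓB / t + 1) (d1 := d1) (d2 := d2) hAI h0 hℓ htb Bad ?_ ?_ (fun r => card_cls_le ht hBI r)
  · obtain ⟨A', hA', B', hB', k1, k2, k3⟩ := key
    refine ⟨A', hA', B', hB', k1.trans ?_, k2, k3⟩
    have : (2 * N + 6) * t + 2 ≤ 2000000 * K ^ 2 * t := by
      rw [hN]
      have e1 : K ≤ K ^ 2 := Nat.le_self_pow (by norm_num) K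
      have e2 : (2 * (40 * K) + 8) * t = (2 * (40 * K) + 6) * t + 2 * t := by ring
      have e3 : (2 * (40 * K) + 6) * t + 2 ≤ (2 * (40 * K) + 8) * t := by omega
      refine e3.trans (Nat.mul_le_mul_right _ ?_)
      omega
    omega
  · intro r0 hr0 s hs
    have hs' : 2 * (ℓA / t + 1) ≤ 2 * #(cls A s) + w := by
      by_contra hc; exact hs (by rw [hBad]; simpa using hc)
    refine dense_step (h := h) (w := w) (N := N) ht (fun x hx => (mem_cls.mp hx).2) (fun x hx => (mem_cls.mp hx).2) ((Finset.filter_subset _ _).trans hAI)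
      ((Finset.filter_subset _ _).trans hBI) (by omega) hs' (by omega) (by omega) hlA2 ?_ hh1
    have k1 : ((ℓB / t : ℕ) : ℝ) ≤ ℓB / t := Nat.cast_div_le
    have k2 : (#B + 1 : ℝ) ≤ t * #(cls B r0) + t := by exact_mod_cast hr0
    have k3 : (ℓB:ℝ) / t ≤ #(cls B r0) + 1 + w / (4 * (N+2)) := by
      rw [div_le_iff₀ (by positivity)]
      have e7 : (t:ℝ) * w / (4 * (N+2)) = w / (4 * (N+2)) * t := by ring
      rw [e7] at hκn
      have e8 : ((#(cls B r0):ℝ) + 1 + w / (4 * (N+2))) * t = t * #(cls B r0) + t + w / (4 * (N+2)) * t := by ring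
      rw [e8]; linarith
    have k4 : (3:ℝ) ≤ w / (4 * (N+2)) := by
      rw [le_div_iff₀ (by positivity), hNr]; linarith
    have k5 : (w:ℝ) / (2 * (N+2)) = 2 * (w / (4 * (N+2))) := by field_simp; ring
    have k6 : ((ℓB / t : ℕ) : ℝ) + 1 ≤ #(cls B r0) + h := by linarith
    exact_mod_cast k6
  · intro r0
    have hg1 : ((t * w / 8 : ℕ) : ℝ) ≥ t * w / 8 - 1 := by
      have : t * w < (t * w / 8 + 1) * 8 := by omega
      have : (t * w : ℝ) < ((t * w / 8 : ℕ) + 1) * 8 := by exact_mod_cast this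
      linarith
    have gA : t * w / 8 ≤ ℓA := by
      have e1 := (Nat.le_div_iff_mul_le ht).mp hlA
      have e2 : t * w / 8 ≤ t * w := Nat.div_le_self _ _
      have e3 : 10 * w * t = 10 * (t * w) := by ring
      omega
    have gB : t * w / 8 ≤ ℓB := by
      have e1 := (Nat.le_div_iff_mul_le ht).mp hlB
      have e2 : t * w / 8 ≤ t * w := Nat.div_le_self _ _
      have e3 : 10 * w * t = 10 * (t * w) := by ring
      omega
    have cAr : ((ℓA + 1 - #A : ℕ) : ℝ) ≤ κ * n := by rw [Nat.cast_sub hAle]; push_cast; linarith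
    have cBr : ((ℓB + 1 - #B : ℕ) : ℝ) ≤ κ * n := by rw [Nat.cast_sub hBle]; push_cast; linarith
    have htw : (200000:ℝ) ≤ t * w := by
      have e1 : (200000:ℝ) ≤ w := by linarith
      calc (200000:ℝ) ≤ 1 * w := by linarith
        _ ≤ t * w := mul_le_mul_of_nonneg_right htr (by linarith)
    refine bad_fill (g := t * w / 8) (K := K) (w := w) (hA := ℓA + 1 - #A) (hB := ℓB + 1 - #B) hK hAI hBI (by omega) (by omega) gA gB h1 h1A h2 h2B (by omega) (by omega) ?_ ?_ ?_ Bad ?_ r0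
    · linarith
    · have : (ℓA + ℓB : ℝ) ≤ 4 * n := by
        have : ℓA + ℓB ≤ 4 * n := by omega
        exact_mod_cast this
      linarith
    · have hn0 : 0 < n := lt_of_lt_of_le (by positivity) hCt
      have hn0r : (1:ℝ) ≤ n := by exact_mod_cast hn0
      have e1 : (#A:ℝ) ≤ 3 * n := by
        have : #A ≤ 3 * n := by omega
        exact_mod_cast this
      have e2 : (#B:ℝ) ≤ 3 * n := by
        have : #B ≤ 3 * n := by omega
        exact_mod_cast this
      have e3 : (#A * #B : ℝ) ≤ 9 * n * n := by
        calc (#A * #B : ℝ) ≤ (3 * n) * (3 * n) := by gcongr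
          _ = _ := by ring
      have e4 : (2000000 * K^2 * n : ℝ) ≤ d1 * d2 := by exact_mod_cast hCd
      have e5 : (#A * #B : ℝ) / (d1 * d2) ≤ 9 * n * n / (2000000 * K^2 * n) := by gcongr
      have e6 : 9 * (n:ℝ) * n / (2000000 * K^2 * n) * (640 * K) = n * (9 * 640 / (2000000 * K)) := by field_simp
      calc (#A * #B : ℝ) / (d1 * d2) * (640 * K) ≤ 9 * n * n / (2000000 * K^2 * n) * (640 * K) := by gcongr
        _ = n * (9 * 640 / (2000000 * K)) := e6
        _ ≤ (20 * K * t * w) * (9 * 640 / (2000000 * K)) := by gcongr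
        _ = t * w * (20 * 9 * 640 / 2000000) := by field_simp
        _ ≤ t * w / 16 := by linarith
    · intro s hs
      rw [hBad, mem_filter] at hs
      omega
end D
end CD
namespace CD
section D
variable {p : ℕ} [Fact p.Prime]
theorem lift_arc {A : Finset (ZMod p)} {s : ZMod p} {len : ℕ} (hA : A.Nonempty) (hI : A ⊆ arc 1 s len) (hlen : len ≤ p) :
    ∃ (A0 : Finset ℤ) (u : ZMod p) (ℓ : ℕ), A = A0.image (fun j : ℤ => u + (j : ZMod p)) ∧ #A0 = #A ∧ (0:ℤ) ∈ A0 ∧ (ℓ:ℤ) ∈ A0 ∧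
      A0 ⊆ Icc 0 (ℓ:ℤ) ∧ ℓ + 1 ≤ len := by
  have hv : ∀ x ∈ A, (x - s).val < len := by
    intro x hx
    obtain ⟨j, hj, rfl⟩ := mem_arc.mp (hI hx)
    have : s + 1 * (j : ZMod p) - s = j := by ring
    rw [this, ZMod.val_natCast, Nat.mod_eq_of_lt (by omega)]
    exact hj
  obtain ⟨x0, hx0, hmin⟩ := Finset.exists_min_image A (fun x => (x - s).val) hA
  obtain ⟨x1, hx1, hmax⟩ := Finset.exists_max_image A (fun x => (x - s).val) hA
  set m := (x0 - s).val with hm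
  have hinj : ∀ x y : ZMod p, (((x - s).val : ℤ) - m) = ((y - s).val : ℤ) - m → x = y := by
    intro x y e
    have : (x - s).val = (y - s).val := by omega
    have := ZMod.val_injective p this
    simpa using this
  refine ⟨A.image (fun x => ((x - s).val : ℤ) - m), s + m, (x1 - s).val - m, ?_, ?_, ?_, ?_, ?_, ?_⟩
  · rw [Finset.image_image]
    conv_lhs => rw [← Finset.image_id (s := A)]
    apply Finset.image_congr
    intro x hx
    simp only [Function.comp, id]
    have h := ZMod.natCast_zmod_val (x - s)
    rw [Int.cast_sub, Int.cast_natCast, Int.cast_natCast, h]; ring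
  · exact Finset.card_image_of_injective _ (fun x y e => hinj x y e)
  · rw [mem_image]; exact ⟨x0, hx0, by omega⟩
  · rw [mem_image]; refine ⟨x1, hx1, ?_⟩
    have := hmin x1 hx1
    omega
  · intro j hj
    obtain ⟨x, hx, rfl⟩ := mem_image.mp hj
    have := hmin x hx
    have := hmax x hx
    rw [mem_Icc]; omega
  · have := hv x1 hx1
    omega
theorem cast_inj_range {T : Finset ℤ} {R : ℕ} (hT : T ⊆ Icc 0 (R:ℤ)) (hR : R < p) (u : ZMod p) :
    #(T.image (fun j : ℤ => u + (j : ZMod p))) = #T := by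
  apply Finset.card_image_of_injOn
  intro x hx y hy e
  have h1 := mem_Icc.mp (hT hx)
  have h2 := mem_Icc.mp (hT hy)
  have e' : ((x:ℤ) : ZMod p) = (y : ZMod p) := by simpa using e
  rw [ZMod.intCast_eq_intCast_iff_dvd_sub] at e'
  have := Int.eq_zero_of_abs_lt_dvd e' (by rw [abs_lt]; omega)
  omega
/-- choice of the modulus -/
theorem choose_t {C n c₁ c₂ ℓB : ℕ} (hC : 1 ≤ C) (hc : 40000 * C * C * n ≤ c₁ * c₂) (h12 : c₁ ≤ c₂) (hn : 1 ≤ n) (hc2 : c₂ ≤ 4 * n) (hℓ : ℓB ≤ 2 * n) :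
    ∃ t, 1 ≤ t ∧ 6 * (C * t) ≤ c₁ ∧ 3 * (ℓB / t + 1 + 2 * t + c₂ / 12) ≤ c₂ ∧ 10000 ≤ c₂ := by
  have hCC : C * n ≤ C * C * n := Nat.mul_le_mul_right n (Nat.le_mul_self C)
  have hc1b : 10000 * C ≤ c₁ := by
    by_contra! hlt
    have h1 : c₁ * c₂ ≤ c₁ * (4 * n) := Nat.mul_le_mul_left _ hc2
    have h2 : c₁ * (4 * n) < 10000 * C * (4 * n) := Nat.mul_lt_mul_of_pos_right hlt (by omega)
    have h3 : 10000 * C * (4 * n) = 40000 * (C * n) := by ring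
    have h4 : 40000 * C * C * n = 40000 * (C * C * n) := by ring
    omega
  have hc2b : 10000 ≤ c₂ := by omega
  set s := Nat.sqrt n with hs
  have hs1 : s * s ≤ n := Nat.sqrt_le n
  have hs2 : n < (s+1) * (s+1) := Nat.lt_succ_sqrt n
  have hs0 : 1 ≤ s := Nat.sqrt_pos.mpr hn
  have hsc : 200 * C * s ≤ c₂ := by
    by_contra! hlt
    have h1 : c₁ * c₂ ≤ c₂ * c₂ := Nat.mul_le_mul_right _ h12
    have h2 : c₂ * c₂ < (200 * C * s) * (200 * C * s) := Nat.mul_lt_mul'' hlt hlt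
    have h3 : (200 * C * s) * (200 * C * s) = 40000 * C * C * (s * s) := by ring
    have h4 : 40000 * C * C * (s * s) ≤ 40000 * C * C * n := Nat.mul_le_mul_left _ hs1
    omega
  have hsc' : 200 * s ≤ c₂ := by
    have : 200 * s ≤ 200 * C * s := by nlinarith
    omega
  by_cases hcase : 6 * C * s ≤ c₁
  · refine ⟨s, hs0, by linarith, ?_, hc2b⟩
    have : ℓB / s ≤ 8 * s := by
      apply Nat.div_le_of_le_mul
      nlinarith
    omega
  · push Not at hcase
    set t := c₁ / (6 * C) with ht
    have h6C : 0 < 6 * C := by omega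
    have ht1 : t * (6 * C) ≤ c₁ := Nat.div_mul_le_self _ _
    have ht2 : c₁ < (t + 1) * (6 * C) := by
      have := Nat.lt_div_mul_add (a := c₁) h6C
      rw [← ht] at this; linarith
    have ht0 : 1 ≤ t := by rw [ht, Nat.le_div_iff_mul_le h6C]; omega
    have hts : t ≤ s := by
      by_contra! hlt
      have : s * (6 * C) ≤ t * (6 * C) := Nat.mul_le_mul_right _ hlt.le
      nlinarith
    refine ⟨t, ht0, by linarith, ?_, hc2b⟩
    have : 100 * (ℓB / t) ≤ c₂ := by
      have k1 : ℓB / t * t ≤ ℓB := Nat.div_mul_le_self _ _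
      by_contra! hlt
      have k2 : c₁ * c₂ ≤ c₁ * (100 * (ℓB / t)) := Nat.mul_le_mul_left _ hlt.le
      have k3 : c₁ * (100 * (ℓB / t)) ≤ (2 * t * (6 * C)) * (100 * (ℓB / t)) := Nat.mul_le_mul_right _ (by nlinarith)
      have k4 : (2 * t * (6 * C)) * (100 * (ℓB / t)) = 1200 * C * (ℓB / t * t) := by ring
      have k5 : 1200 * C * (ℓB / t * t) ≤ 1200 * C * (2 * n) := Nat.mul_le_mul_left _ (k1.trans hℓ)
      have k6 : 1200 * C * (2 * n) = 2400 * (C * n) := by ring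
      have k7 : 40000 * C * C * n = 40000 * (C * C * n) := by ring
      have k8 : 0 < C * n := by positivity
      omega
    omega
theorem arcP0 (K : ℕ) (hK : 1 ≤ K) : ∃ κ : ℝ, 0 < κ ∧ ∃ C : ℕ, 1 ≤ C ∧ ∀ (p : ℕ) [Fact p.Prime] (n c₁ c₂ : ℕ) (A B : Finset (ZMod p)) (s s' : ZMod p) (len len' : ℕ),
    A ⊆ arc 1 s len → B ⊆ arc 1 s' len' → n + K ≤ K * #A → n + K ≤ K * #B → len ≤ 2 * n → len' ≤ 2 * n →
    (len : ℝ) ≤ #A + κ * n → (len' : ℝ) ≤ #B + κ * n → len + len' ≤ p → C * n ≤ c₁ * c₂ → c₁ ≤ 2 * #A → c₂ ≤ 2 * #B → c₁ ≤ c₂ →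
    ∃ A' ⊆ A, ∃ B' ⊆ B, 3 * #A' ≤ c₁ ∧ 3 * #B' ≤ c₂ ∧ #A + #B ≤ #(A' + B') + 1 := by
  obtain ⟨κ, hκ, C, hC, H⟩ := intP K hK
  refine ⟨κ, hκ, 40000 * C * C, by nlinarith, ?_⟩
  intro p _ n c₁ c₂ A B s s' len len' hA hB hnA hnB hl hl' hh hh' hp hc hc1 hc2 h12
  have hAne : A.Nonempty := by
    rw [← card_pos]; by_contra hc; have : #A = 0 := by omega
    rw [this] at hnA; omega
  have hBne : B.Nonempty := by
    rw [← card_pos]; by_contra hc; have : #B = 0 := by omega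
    rw [this] at hnB; omega
  obtain ⟨A0, u, ℓA, eA, cA, a0, aℓ, aI, haℓ⟩ := lift_arc hAne hA (by omega)
  obtain ⟨B0, v, ℓB, eB, cB, b0, bℓ, bI, hbℓ⟩ := lift_arc hBne hB (by omega)
  have hAle : #A0 ≤ ℓA + 1 := by
    have := Finset.card_le_card aI; rw [Int.card_Icc] at this; omega
  have hBle : #B0 ≤ ℓB + 1 := by
    have := Finset.card_le_card bI; rw [Int.card_Icc] at this; omega
  have hn1 : 1 ≤ n := by omega
  have hAn : #A ≤ 2 * n := by omega
  have hBn : #B ≤ 2 * n := by omega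
  have hc2n : c₂ ≤ 4 * n := by omega
  rw [← cA] at hnA
  rw [← cB] at hnB
  have hcc : C * n ≤ C * C * n := Nat.mul_le_mul_right n (Nat.le_mul_self C)
  obtain ⟨t, ht1, ht2, ht3, ht4⟩ := choose_t (ℓB := ℓB) hC hc h12 hn1 hc2n (by omega)
  have hCt : C ≤ C * t := Nat.le_mul_of_pos_right _ ht1
  have hd : C * n ≤ (c₁ / 6) * (c₂ / 12) := by
    have e1 : c₁ ≤ 12 * (c₁ / 6) := by omega
    have e2 : c₂ ≤ 24 * (c₂ / 12) := by omega
    have e3 := Nat.mul_le_mul e1 e2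
    have e4 : 12 * (c₁ / 6) * (24 * (c₂ / 12)) = 288 * ((c₁ / 6) * (c₂ / 12)) := by ring
    have e5 : 40000 * C * C * n = 40000 * (C * C * n) := by ring
    omega
  have hKA : K * #A0 ≤ K * ℓA + K := by
    have := Nat.mul_le_mul_left K hAle
    rw [Nat.mul_add] at this; omega
  have hKB : K * #B0 ≤ K * ℓB + K := by
    have := Nat.mul_le_mul_left K hBle
    rw [Nat.mul_add] at this; omega
  have hr1 : ((ℓA : ℝ) + 1) ≤ len := by exact_mod_cast haℓ
  have hr2 : ((ℓB : ℝ) + 1) ≤ len' := by exact_mod_cast hbℓ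
  have hne2 : 1 ≤ c₂ / 12 := by omega
  obtain ⟨A', hA', B', hB', q1, q2, q3⟩ := H n t (c₁ / 6) (c₂ / 12) ℓA ℓB A0 B0 aI a0 aℓ bI (by omega) (by omega) (by omega) (by omega)
    (by rw [cA]; linarith) (by rw [cB]; linarith) ht1 (by omega) hd (by omega) (by omega) hne2 (by omega)
  refine ⟨A'.image (fun j : ℤ => u + (j : ZMod p)), by rw [eA]; exact image_subset_image hA',
    B'.image (fun j : ℤ => v + (j : ZMod p)), by rw [eB]; exact image_subset_image hB', ?_, ?_, ?_⟩
  · have := Finset.card_image_le (s := A') (f := (fun j : ℤ => u + (j : ZMod p)))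
    omega
  · have := Finset.card_image_le (s := B') (f := (fun j : ℤ => v + (j : ZMod p)))
    omega
  · have hsum : A'.image (fun j : ℤ => u + (j : ZMod p)) + B'.image (fun j : ℤ => v + (j : ZMod p))
        = (A' + B').image (fun j : ℤ => (u + v) + (j : ZMod p)) := by
      ext y
      simp only [mem_add, mem_image]
      constructor
      · rintro ⟨_, ⟨a, ha, rfl⟩, _, ⟨b, hb, rfl⟩, rfl⟩
        exact ⟨a + b, ⟨a, ha, b, hb, rfl⟩, by push_cast; ring⟩
      · rintro ⟨_, ⟨a, ha, b, hb, rfl⟩, rfl⟩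
        exact ⟨_, ⟨a, ha, rfl⟩, _, ⟨b, hb, rfl⟩, by push_cast; ring⟩
    rw [hsum, cast_inj_range (R := ℓA + ℓB) _ (by omega)]
    · omega
    · intro y hy
      obtain ⟨a, ha, b, hb, rfl⟩ := mem_add.mp hy
      have h1 := mem_Icc.mp (aI (hA' ha))
      have h2 := mem_Icc.mp (bI (hB' hb))
      rw [mem_Icc]; push_cast; omega
theorem arcP (K : ℕ) (hK : 1 ≤ K) : ∃ κ : ℝ, 0 < κ ∧ ∃ C : ℕ, 1 ≤ C ∧ ∀ (p : ℕ) [Fact p.Prime] (n c₁ c₂ : ℕ) (A B : Finset (ZMod p)) (s s' : ZMod p) (len len' : ℕ),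
    A ⊆ arc 1 s len → B ⊆ arc 1 s' len' → n + K ≤ K * #A → n + K ≤ K * #B → len ≤ 2 * n → len' ≤ 2 * n →
    (len : ℝ) ≤ #A + κ * n → (len' : ℝ) ≤ #B + κ * n → len + len' ≤ p → C * n ≤ c₁ * c₂ → c₁ ≤ 2 * #A → c₂ ≤ 2 * #B →
    ∃ A' ⊆ A, ∃ B' ⊆ B, 3 * #A' ≤ c₁ ∧ 3 * #B' ≤ c₂ ∧ #A + #B ≤ #(A' + B') + 1 := by
  obtain ⟨κ, hκ, C, hC, H⟩ := arcP0 K hK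
  refine ⟨κ, hκ, C, hC, ?_⟩
  intro p _ n c₁ c₂ A B s s' len len' hA hB hnA hnB hl hl' hh hh' hp hc hc1 hc2
  rcases le_total c₁ c₂ with h12 | h12
  · exact H p n c₁ c₂ A B s s' len len' hA hB hnA hnB hl hl' hh hh' hp hc hc1 hc2 h12
  · obtain ⟨B', hB', A', hA', q1, q2, q3⟩ := H p n c₂ c₁ B A s' s len' len hB hA hnB hnA hl' hl hh' hh (by omega) (by rw [mul_comm c₂]; exact hc) hc2 hc1 h12
    exact ⟨A', hA', B', hB', q2, q1, by rw [add_comm A' B']; omega⟩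
end D
end CD
namespace CD
section D
variable {p : ℕ} [Fact p.Prime]
theorem natCast_inj_lt {a b : ℕ} (ha : a < p) (hb : b < p) (e : (a : ZMod p) = b) : a = b := by
  have := congrArg ZMod.val e
  rwa [ZMod.val_natCast, ZMod.val_natCast, Nat.mod_eq_of_lt ha, Nat.mod_eq_of_lt hb] at this
theorem outlier {s s' x : ZMod p} {len len' θ : ℕ} (hx : x ∉ arc 1 (s - (θ : ZMod p)) (len + 2 * θ)) (h1 : θ ≤ len') (h2 : len + len' + θ ≤ p) :
    θ ≤ #((arc 1 s' len').filter (fun b => x + b ∉ arc 1 (s + s') (len + len'))) := by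
  set v := (x - s).val with hv
  have hvp : v < p := ZMod.val_lt _
  have hxv : x = s + (v : ZMod p) := by rw [hv, ZMod.natCast_zmod_val]; ring
  have hv1 : len + θ ≤ v := by
    by_contra! hlt
    apply hx
    rw [mem_arc]
    exact ⟨v + θ, by omega, by rw [hxv]; push_cast; ring⟩
  have hv2 : v + θ < p := by
    by_contra! hlt
    apply hx
    rw [mem_arc]
    refine ⟨v + θ - p, by omega, ?_⟩
    rw [hxv, Nat.cast_sub hlt]; push_cast; rw [ZMod.natCast_self]; ring
  set J := Ico (len + len' - v) (min len' (p - v)) with hJ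
  have hJc : θ ≤ #J := by rw [hJ, Nat.card_Ico]; omega
  refine hJc.trans ?_
  apply Finset.card_le_card_of_injOn (fun j : ℕ => s' + 1 * (j : ZMod p))
  · intro j hj
    have hj' : j ∈ J := hj
    rw [hJ, mem_Ico] at hj'
    have : s' + 1 * (j : ZMod p) ∈ (arc 1 s' len').filter (fun b => x + b ∉ arc 1 (s + s') (len + len')) := by
      rw [mem_filter]
      refine ⟨mem_arc.mpr ⟨j, by omega, rfl⟩, ?_⟩
      intro hm
      obtain ⟨i, hi, e⟩ := mem_arc.mp hm
      have e2 : ((v + j : ℕ) : ZMod p) = (i : ℕ) := by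
        rw [hxv] at e
        push_cast
        linear_combination e
      have := natCast_inj_lt (by omega) (by omega) e2
      omega
    exact this
  · intro i hi j hj e
    have hi' : i ∈ J := hi
    have hj' : j ∈ J := hj
    rw [hJ, mem_Ico] at hi' hj'
    have e' : s' + 1 * (i : ZMod p) = s' + 1 * (j : ZMod p) := e
    have e2 : (i : ZMod p) = j := by linear_combination e'
    exact natCast_inj_lt (by omega) (by omega) e2
theorem sum_rr_Q (O B Q : Finset (ZMod p)) : ∑ y ∈ Q, rr O B y = ∑ x ∈ O, #(B.filter (fun b => x + b ∈ Q)) := by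
  have h1 : ∀ y, rr O B y = ∑ x ∈ O, if y - x ∈ B then 1 else 0 := by
    intro y; rw [rr, card_filter]
  simp_rw [h1]
  rw [sum_comm]
  apply sum_congr rfl
  intro x _
  rw [← card_filter]
  apply card_bij (fun y _ => y - x)
  · intro y hy
    rw [mem_filter] at hy ⊢
    exact ⟨hy.2, by rw [add_sub_cancel]; exact hy.1⟩
  · intro y _ y' _ e
    simpa using e
  · intro b hb
    rw [mem_filter] at hb
    exact ⟨x + b, mem_filter.mpr ⟨hb.2, by rw [add_sub_cancel_left]; exact hb.1⟩, by ring⟩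
theorem outlier2 {s s' x : ZMod p} {len len' θ e z : ℕ} {B T Q : Finset (ZMod p)} (hQ : Q = univ \ (arc 1 (s + s') (len + len') ∪ T)) (hx : x ∉ arc 1 (s - (θ : ZMod p)) (len + 2 * θ)) (h1 : θ ≤ len') (h2 : len + len' + θ ≤ p)
    (he : len' ≤ #(B ∩ arc 1 s' len') + e) (hz : #(T \ arc 1 (s + s') (len + len')) ≤ z) :
    θ ≤ #((B ∩ arc 1 s' len').filter (fun b => x + b ∈ Q)) + e + z := by
  subst hQ
  have h := outlier (s' := s') hx h1 h2
  set J := arc 1 s' len' with hJ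
  set S := arc 1 (s + s') (len + len') with hS
  have hsub : J.filter (fun b => x + b ∉ S) ⊆ (B ∩ J).filter (fun b => x + b ∈ univ \ (S ∪ T)) ∪ (J \ B) ∪ (T \ S).image (fun y => y - x) := by
    intro b hb
    rw [mem_filter] at hb
    simp only [mem_union, mem_filter, mem_inter, mem_sdiff, mem_univ, mem_image, true_and]
    by_cases hbB : b ∈ B
    · by_cases hbT : x + b ∈ T
      · right; exact ⟨x + b, ⟨hbT, hb.2⟩, by ring⟩
      · left; left; exact ⟨⟨hbB, hb.1⟩, by tauto⟩
    · left; right; exact ⟨hb.1, hbB⟩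
  have c1 := card_le_card hsub
  have c2 := card_union_le ((B ∩ J).filter (fun b => x + b ∈ univ \ (S ∪ T)) ∪ (J \ B)) ((T \ S).image (fun y => y - x))
  have c3 := card_union_le ((B ∩ J).filter (fun b => x + b ∈ univ \ (S ∪ T))) (J \ B)
  have c4 : #((T \ S).image (fun y => y - x)) ≤ #(T \ S) := card_image_le
  have c5 : #(J \ B) + #(B ∩ J) = #J := by rw [inter_comm]; exact card_sdiff_add_card_inter J B
  have c6 : #J ≤ len' := card_arc_le _ _ _
  omega
/-- the new elements obtained from outliers -/
theorem outlier_new {O BJ Q : Finset (ZMod p)} {n c₁ c₂ θ : ℕ} (hk : 1 ≤ #O) (hkn : #O ≤ n) (hBn : #BJ ≤ n)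
    (h3 : 3 ≤ c₁) (h4 : 3 ≤ c₂) (hcB : c₂ ≤ 3 * #BJ) (hk8 : 8 * #O ≤ θ) (hb : 48 * n ≤ θ * c₂) (hcc : 288 * (n * n) ≤ θ * (c₁ * c₂))
    (hQ : ∀ x ∈ O, θ ≤ 2 * #(BJ.filter (fun b => x + b ∈ Q))) :
    ∃ O' ⊆ O, ∃ B' ⊆ BJ, 3 * #O' ≤ c₁ ∧ 3 * #B' ≤ c₂ ∧ 2 * #O ≤ #((O' + B') ∩ Q) := by
  obtain ⟨O', hO', B', hB', e1, e2, h⟩ := random_lemma (A := O) (B := BJ) Q (c₁ := min (#O) (c₁ / 3)) (c₂ := c₂ / 3) (by omega) (by omega) (by omega) (by omega)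
  refine ⟨O', hO', B', hB', by omega, by omega, ?_⟩
  set m₁ := min (#O) (c₁ / 3) with hm₁
  set m₂ := c₂ / 3 with hm₂
  set k := #O with hkd
  have hsum : k * θ ≤ 2 * ∑ y ∈ Q, rr O BJ y := by
    rw [sum_rr_Q, mul_sum]
    have := Finset.card_nsmul_le_sum O (fun x => 2 * #(BJ.filter (fun b => x + b ∈ Q))) θ hQ
    rwa [smul_eq_mul] at this
  have hm1 : 1 ≤ m₁ := by omega
  have hm2 : 1 ≤ m₂ := by omega
  have hτN : 8 * (k * #BJ) ≤ θ * (m₁ * m₂) := by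
    have g2 : c₂ ≤ 6 * m₂ := by omega
    have g0 : k * #BJ ≤ k * n := Nat.mul_le_mul_left _ hBn
    rcases Nat.le_total k (c₁ / 3) with hc | hc
    · have : m₁ = k := by omega
      rw [this]
      have g3 : θ * c₂ ≤ θ * (6 * m₂) := Nat.mul_le_mul_left _ g2
      have g4 : k * (48 * n) ≤ k * (θ * (6 * m₂)) := Nat.mul_le_mul_left _ (hb.trans g3)
      have g5 : k * (48 * n) = 48 * (k * n) := by ring
      have g6 : k * (θ * (6 * m₂)) = 6 * (θ * (k * m₂)) := by ring
      omega
    · have : m₁ = c₁ / 3 := by omega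
      have g1 : c₁ ≤ 6 * m₁ := by omega
      have g3 : θ * (c₁ * c₂) ≤ θ * ((6 * m₁) * (6 * m₂)) := Nat.mul_le_mul_left _ (Nat.mul_le_mul g1 g2)
      have g4 : θ * ((6 * m₁) * (6 * m₂)) = 36 * (θ * (m₁ * m₂)) := by ring
      have g5 : k * n ≤ n * n := Nat.mul_le_mul_right _ hkn
      omega
  set τ : ℝ := ((k:ℕ) * #BJ : ℝ) / ((m₁:ℕ) * (m₂:ℕ)) with hτ
  have hm1r : (0:ℝ) < m₁ := by exact_mod_cast hm1
  have hm2r : (0:ℝ) < m₂ := by exact_mod_cast hm2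
  have hkr : (0:ℝ) < k := by exact_mod_cast hk
  have hBJr : (0:ℝ) < #BJ := by
    have : 0 < #BJ := by omega
    exact_mod_cast this
  have hτ0 : 0 < τ := by rw [hτ]; positivity
  have hτ8 : 8 * τ ≤ θ := by
    rw [hτ, ← mul_div_assoc, div_le_iff₀ (by positivity)]
    exact_mod_cast hτN
  have hk8r : 8 * (k:ℝ) ≤ θ := by exact_mod_cast hk8
  have hterm : ∀ y ∈ Q, (rr O BJ y : ℝ) / (k + τ) ≤ (rr O BJ y : ℝ) / (rr O BJ y + τ) := by
    intro y _
    have h0 : (0:ℝ) ≤ rr O BJ y := Nat.cast_nonneg _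
    have hle : (rr O BJ y : ℝ) ≤ k := by exact_mod_cast rr_le_left O BJ y
    apply div_le_div_of_nonneg_left h0 (by linarith) (by linarith)
  have h2 := (sum_le_sum hterm).trans h
  rw [← sum_div, div_le_iff₀ (by linarith)] at h2
  have hsumr : (k:ℝ) * θ ≤ 2 * ∑ y ∈ Q, (rr O BJ y : ℝ) := by exact_mod_cast hsum
  set N := #((O' + B') ∩ Q) with hN
  by_contra! hlt
  have hltr : (N:ℝ) < 2 * k := by exact_mod_cast hlt
  have q1 : (N:ℝ) * (k + τ) < 2 * k * (k + τ) := mul_lt_mul_of_pos_right hltr (by linarith)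
  have q2 : 2 * (k:ℝ) * (k + τ) ≤ 2 * k * (θ / 4) := mul_le_mul_of_nonneg_left (by linarith) (by linarith)
  linarith
theorem arcs_core {A B A0 B0 Ar Br : Finset (ZMod p)} {n c₁ c₂ len len' θ e z : ℕ} {s s' : ZMod p}
    (hAn : #A ≤ n) (hBn : #B ≤ n) (hθ : θ ≤ len') (hp : len + len' + θ ≤ p)
    (hA0 : A0 ⊆ A ∩ arc 1 (s - (θ : ZMod p)) (len + 2 * θ)) (hB0 : B0 ⊆ B ∩ arc 1 (s' - (θ : ZMod p)) (len' + 2 * θ))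
    (hA0c : 3 * #A0 ≤ c₁) (hB0c : 3 * #B0 ≤ c₂)
    (h0 : #(A ∩ arc 1 (s - (θ : ZMod p)) (len + 2 * θ)) + #(B ∩ arc 1 (s' - (θ : ZMod p)) (len' + 2 * θ)) ≤ #(A0 + B0) + 1)
    (hAr : Ar ⊆ A ∩ arc 1 s len) (hBr : Br ⊆ B ∩ arc 1 s' len') (hArc : 3 * #Ar ≤ c₁) (hBrc : 3 * #Br ≤ c₂)
    (hr : #A + #B ≤ #(Ar + Br) + z)
    (hkk : #(B \ arc 1 (s' - (θ : ZMod p)) (len' + 2 * θ)) ≤ #(A \ arc 1 (s - (θ : ZMod p)) (len + 2 * θ)))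
    (he : len' ≤ #(B ∩ arc 1 s' len') + e) (hez : 2 * (e + z) ≤ θ)
    (h3 : 3 ≤ c₁) (h4 : 3 ≤ c₂) (hcB : c₂ ≤ 3 * #(B ∩ arc 1 s' len'))
    (hk8 : 8 * #(A \ arc 1 (s - (θ : ZMod p)) (len + 2 * θ)) ≤ θ)
    (hb : 48 * n ≤ θ * c₂) (hcc : 288 * (n * n) ≤ θ * (c₁ * c₂)) :
    ∃ A' ⊆ A, ∃ B' ⊆ B, #A' ≤ c₁ ∧ #B' ≤ c₂ ∧ #A + #B ≤ #(A' + B') + 1 := by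
  set Ip := arc 1 (s - (θ : ZMod p)) (len + 2 * θ) with hIp
  set Jp := arc 1 (s' - (θ : ZMod p)) (len' + 2 * θ) with hJp
  have eA : #(A \ Ip) + #(A ∩ Ip) = #A := card_sdiff_add_card_inter A Ip
  have eB : #(B \ Jp) + #(B ∩ Jp) = #B := card_sdiff_add_card_inter B Jp
  by_cases hk : #(A \ Ip) = 0
  · exact ⟨A0, hA0.trans inter_subset_left, B0, hB0.trans inter_subset_left, by omega, by omega, by omega⟩
  set S := arc 1 (s + s') (len + len') with hS
  have hTr : Ar + Br ⊆ S := by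
    intro y hy
    obtain ⟨a, ha, b, hb, rfl⟩ := mem_add.mp hy
    obtain ⟨i, hi, rfl⟩ := mem_arc.mp (mem_inter.mp (hAr ha)).2
    obtain ⟨j, hj, rfl⟩ := mem_arc.mp (mem_inter.mp (hBr hb)).2
    exact mem_arc.mpr ⟨i + j, by omega, by push_cast; ring⟩
  by_cases hT : z ≤ #((A0 + B0) \ S)
  · refine ⟨A0 ∪ Ar, union_subset (hA0.trans inter_subset_left) (hAr.trans inter_subset_left),
      B0 ∪ Br, union_subset (hB0.trans inter_subset_left) (hBr.trans inter_subset_left), ?_, ?_, ?_⟩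
    · have := card_union_le A0 Ar; omega
    · have := card_union_le B0 Br; omega
    · have hsub : (Ar + Br) ∪ ((A0 + B0) \ S) ⊆ (A0 ∪ Ar) + (B0 ∪ Br) :=
        union_subset (add_subset_add subset_union_right subset_union_right)
          (sdiff_subset.trans (add_subset_add subset_union_left subset_union_left))
      have hd : Disjoint (Ar + Br) ((A0 + B0) \ S) := disjoint_of_subset_left hTr disjoint_sdiff
      have c1 := card_le_card hsub
      rw [card_union_of_disjoint hd] at c1
      omega
  · push Not at hT
    obtain ⟨O', hO', B1, hB1, q1, q2, q3⟩ := outlier_new (O := A \ Ip) (BJ := B ∩ arc 1 s' len') (Q := univ \ (S ∪ (A0 + B0))) (n := n) (θ := θ)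
      (by omega) (by omega) ((card_le_card inter_subset_left).trans hBn) h3 h4 hcB hk8 hb hcc (by
        intro x hx
        have := outlier2 (s := s) (s' := s') (T := A0 + B0) rfl (mem_sdiff.mp hx).2 hθ hp he hT.le
        have h2 : 2 * (e + z) ≤ θ := hez
        have h3 := (Nat.mul_le_mul_left 2 this)
        linarith)
    refine ⟨A0 ∪ O', union_subset (hA0.trans inter_subset_left) (hO'.trans sdiff_subset),
      B0 ∪ B1, union_subset (hB0.trans inter_subset_left) (hB1.trans inter_subset_left), ?_, ?_, ?_⟩
    · have := card_union_le A0 O'; omega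
    · have := card_union_le B0 B1; omega
    · have hsub : (A0 + B0) ∪ ((O' + B1) ∩ (univ \ (S ∪ (A0 + B0)))) ⊆ (A0 ∪ O') + (B0 ∪ B1) :=
        union_subset (add_subset_add subset_union_left subset_union_left)
          (inter_subset_left.trans (add_subset_add subset_union_right subset_union_right))
      have hd : Disjoint (A0 + B0) ((O' + B1) ∩ (univ \ (S ∪ (A0 + B0)))) := by
        rw [disjoint_left]
        intro y hy hy2
        exact (mem_sdiff.mp (mem_inter.mp hy2).2).2 (mem_union_right _ hy)
      have c1 := card_le_card hsub
      rw [card_union_of_disjoint hd] at c1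
      omega
end D
end CD
namespace CD
section D
variable {p : ℕ} [Fact p.Prime]
theorem half_floor {x : ℝ} (h : 2 ≤ x) : x / 2 ≤ (⌊x⌋₊ : ℝ) := by
  have := Nat.lt_floor_add_one x
  linarith
theorem rand_part {A1 B1 : Finset (ZMod p)} {n c₁ c₂ a b : ℕ} {ζ c : ℝ} (hζ : 0 < ζ) (hζ1 : ζ ≤ 1) (hn : 1 ≤ n)
    (ha1 : #A1 ≤ n) (hb1 : #B1 ≤ n) (han : a ≤ n) (hbn : b ≤ n) (hc : 2000 ≤ c * ζ ^ 2) (hcc : c * n ≤ c₁ * c₂)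
    (hζa : ζ * n ≤ #A1) (hζb : ζ * n ≤ #B1) (hp : #A1 + #B1 ≤ p)
    (h1 : (a:ℝ) + b ≤ #A1 + #B1 + ζ * n / 4) (h3 : 3 ≤ c₁) (h4 : 3 ≤ c₂) (hcA : c₁ ≤ 3 * #A1) (hcB : c₂ ≤ 3 * #B1) (hζn : 16 ≤ ζ * n) :
    ∃ A' ⊆ A1, ∃ B' ⊆ B1, 3 * #A' ≤ c₁ ∧ 3 * #B' ≤ c₂ ∧ (a:ℝ) + b ≤ #(A' + B') + ζ * n := by
  set t := ⌊ζ * n / 8⌋₊ with ht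
  have hnr : (0:ℝ) < n := by exact_mod_cast hn
  have ht1 : ζ * n / 16 ≤ t := by
    have := half_floor (x := ζ * n / 8) (by linarith)
    rw [← ht] at this; linarith
  have ht2 : (t:ℝ) ≤ ζ * n / 8 := Nat.floor_le (by linarith)
  have ht0 : 1 ≤ t := by
    have : (1:ℝ) ≤ t := by linarith
    exact_mod_cast this
  have htA : t ≤ #A1 := by
    have : (t:ℝ) ≤ #A1 := by linarith
    exact_mod_cast this
  have htB : t ≤ #B1 := by
    have : (t:ℝ) ≤ #B1 := by linarith
    exact_mod_cast this
  have hpol := pollard htA htB (by omega)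
  obtain ⟨A', hA', B', hB', e1, e2, h⟩ := random_ff (A := A1) (B := B1) (t := t) (c₁ := c₁ / 3) (c₂ := c₂ / 3) (by omega) (by omega) (by omega) (by omega) ht0
  refine ⟨A', hA', B', hB', by omega, by omega, ?_⟩
  set m₁ := c₁ / 3 with hm₁
  set m₂ := c₂ / 3 with hm₂
  set N := #(A' + B') with hN
  set a1 := #A1
  set b1 := #B1
  have hpolr : (t:ℝ) * (a1 + b1) ≤ ff t A1 B1 + t * t := by exact_mod_cast hpol
  have hm1r : (1:ℝ) ≤ m₁ := by
    have : 1 ≤ m₁ := by omega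
    exact_mod_cast this
  have hm2r : (1:ℝ) ≤ m₂ := by
    have : 1 ≤ m₂ := by omega
    exact_mod_cast this
  have hg : (c₁ * c₂ : ℝ) ≤ 36 * (m₁ * m₂) := by
    have g1 : c₁ ≤ 6 * m₁ := by omega
    have g2 : c₂ ≤ 6 * m₂ := by omega
    have := Nat.mul_le_mul g1 g2
    have e : 6 * m₁ * (6 * m₂) = 36 * (m₁ * m₂) := by ring
    rw [e] at this
    exact_mod_cast this
  set τ : ℝ := (a1 * b1 : ℝ) / (m₁ * m₂) with hτ
  have hτ0 : 0 ≤ τ := by rw [hτ]; positivity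
  have hc0 : 0 < c := by
    by_contra! hneg
    have : c * ζ ^ 2 ≤ 0 := mul_nonpos_of_nonpos_of_nonneg hneg (by positivity)
    linarith
  have hmm : (0:ℝ) < m₁ * m₂ := mul_pos (by linarith) (by linarith)
  have hτc : c * τ ≤ 36 * n := by
    rw [hτ, ← mul_div_assoc, div_le_iff₀ hmm]
    have g1 : (a1 * b1 : ℝ) ≤ n * n := by
      have := Nat.mul_le_mul ha1 hb1
      exact_mod_cast this
    have g2 : c * (a1 * b1 : ℝ) ≤ c * (n * n) := mul_le_mul_of_nonneg_left g1 hc0.le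
    have g3 : (c * n) * n ≤ (36 * (m₁ * m₂)) * (n:ℝ) := mul_le_mul_of_nonneg_right (hcc.trans hg) hnr.le
    linarith
  have hτζ : 2000 * τ ≤ 36 * n * ζ ^ 2 := by
    have g1 : 2000 * τ ≤ c * ζ ^ 2 * τ := mul_le_mul_of_nonneg_right hc hτ0
    have g2 : c * τ * ζ ^ 2 ≤ 36 * n * ζ ^ 2 := mul_le_mul_of_nonneg_right hτc (by positivity)
    linarith
  by_contra! hlt
  have hanr : (a:ℝ) ≤ n := by exact_mod_cast han
  have hbnr : (b:ℝ) ≤ n := by exact_mod_cast hbn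
  have htr : (1:ℝ) ≤ t := by exact_mod_cast ht0
  have hζn0 : 0 < ζ * n := by positivity
  have f1 : (N:ℝ) * t ≤ (a + b - ζ * n) * t := mul_le_mul_of_nonneg_right (by linarith) (by linarith)
  have f2 : (N:ℝ) * τ ≤ (2 * n) * τ := mul_le_mul_of_nonneg_right (by linarith) hτ0
  have f3 : (t:ℝ) * (a + b - ζ * n / 4 - ζ * n / 8) ≤ t * (a1 + b1 - t) := mul_le_mul_of_nonneg_left (by linarith) (by linarith)
  have f4 : (ζ * n / 16) * (ζ * n * 5 / 8) ≤ t * (ζ * n * 5 / 8) := mul_le_mul_of_nonneg_right ht1 (by linarith)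
  have f5 : n * (2000 * τ) ≤ n * (36 * n * ζ ^ 2) := mul_le_mul_of_nonneg_left hτζ hnr.le
  have f6 : 0 < ζ ^ 2 * (n * n) := by positivity
  linarith
theorem inner_facts {A : Finset (ZMod p)} {s : ZMod p} {len θ : ℕ} {κ : ℝ} (h1 : (#(A \ arc 1 s len) : ℝ) ≤ κ * #A) :
    (1 - κ) * #A ≤ #(A ∩ arc 1 s len) ∧ #(A ∩ arc 1 s len) ≤ #(A ∩ arc 1 (s - (θ : ZMod p)) (len + 2 * θ)) ∧
    (#(A \ arc 1 (s - (θ : ZMod p)) (len + 2 * θ)) : ℝ) ≤ κ * #A ∧ #(A ∩ arc 1 s len) ≤ len := by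
  have hsub : arc 1 s len ⊆ arc 1 (s - (θ : ZMod p)) (len + 2 * θ) := by
    intro x hx
    obtain ⟨j, hj, rfl⟩ := mem_arc.mp hx
    exact mem_arc.mpr ⟨j + θ, by omega, by push_cast; ring⟩
  refine ⟨?_, card_le_card (inter_subset_inter_left hsub), ?_, ?_⟩
  · have : #(A \ arc 1 s len) + #(A ∩ arc 1 s len) = #A := card_sdiff_add_card_inter _ _
    have hr : (#(A \ arc 1 s len) : ℝ) + #(A ∩ arc 1 s len) = #A := by exact_mod_cast this
    linarith
  · have : #(A \ arc 1 (s - (θ : ZMod p)) (len + 2 * θ)) ≤ #(A \ arc 1 s len) := card_le_card (sdiff_subset_sdiff le_rfl hsub)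
    have hr : (#(A \ arc 1 (s - (θ : ZMod p)) (len + 2 * θ)) : ℝ) ≤ #(A \ arc 1 s len) := by exact_mod_cast this
    linarith
  · exact (card_le_card inter_subset_right).trans (card_arc_le _ _ _)
end D
end CD
namespace CD
section D
variable {p : ℕ} [Fact p.Prime]
theorem side {A : Finset (ZMod p)} {s : ZMod p} {len θ n c₁ K : ℕ} {α Θ κ₁ : ℝ} (hα : 0 < α) (hα1 : α ≤ 1) (hΘ0 : 0 < Θ) (hΘα : Θ ≤ α / 8) (hΘκ : Θ ≤ κ₁ / 8)
    (hAn : #A ≤ n) (hA : α * n ≤ #A) (hlen : (len:ℝ) ≤ (1 + Θ / 64) * #A) (hout : (#(A \ arc 1 s len) : ℝ) ≤ Θ / 64 * #A)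
    (hθ1 : Θ * n / 2 ≤ θ) (hθ2 : (θ:ℝ) ≤ Θ * n) (hc : c₁ ≤ #A) (hK : 8 ≤ K * α) (hKn : K ≤ n) :
    n + K ≤ K * #(A ∩ arc 1 (s - (θ : ZMod p)) (len + 2 * θ)) ∧
    len + 2 * θ ≤ 2 * n ∧
    ((len + 2 * θ : ℕ) : ℝ) ≤ #(A ∩ arc 1 (s - (θ : ZMod p)) (len + 2 * θ)) + κ₁ * n ∧
    c₁ ≤ 2 * #(A ∩ arc 1 (s - (θ : ZMod p)) (len + 2 * θ)) ∧
    #(A ∩ arc 1 s len) ≤ n ∧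
    Θ / 8 * n ≤ #(A ∩ arc 1 s len) ∧
    c₁ ≤ 3 * #(A ∩ arc 1 s len) ∧
    θ ≤ len ∧
    len ≤ #(A ∩ arc 1 s len) + ⌊Θ / 32 * n⌋₊ ∧
    8 * #(A \ arc 1 (s - (θ : ZMod p)) (len + 2 * θ)) ≤ θ ∧
    (#A : ℝ) ≤ #(A ∩ arc 1 s len) + Θ / 64 * n ∧
    (len : ℝ) ≤ #A + Θ / 64 * n := by
  obtain ⟨i1, i2, i3, i4⟩ := inner_facts (θ := θ) hout
  have hin : #(A ∩ arc 1 s len) ≤ #A := card_le_card inter_subset_left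
  set xI := #(A ∩ arc 1 s len) with hxI
  set xP := #(A ∩ arc 1 (s - (θ : ZMod p)) (len + 2 * θ)) with hxP
  set xO := #(A \ arc 1 (s - (θ : ZMod p)) (len + 2 * θ)) with hxO
  set x := #A with hx
  have hxn : (x:ℝ) ≤ n := by exact_mod_cast hAn
  have hx0 : (0:ℝ) ≤ x := Nat.cast_nonneg _
  have hn0 : (0:ℝ) ≤ n := Nat.cast_nonneg _
  have i2r : (xI:ℝ) ≤ xP := by exact_mod_cast i2
  have i4r : (xI:ℝ) ≤ len := by exact_mod_cast i4
  have hcr : (c₁:ℝ) ≤ x := by exact_mod_cast hc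
  have hΘ8 : Θ ≤ 1 / 8 := by linarith
  have m1 : Θ / 64 * x ≤ Θ / 64 * n := mul_le_mul_of_nonneg_left hxn (by linarith)
  have m2 : Θ / 64 * x ≤ 1 / 512 * x := mul_le_mul_of_nonneg_right (by linarith) hx0
  have m3 : Θ * n ≤ α / 8 * n := mul_le_mul_of_nonneg_right hΘα hn0
  have m4 : Θ * n ≤ κ₁ / 8 * n := mul_le_mul_of_nonneg_right hΘκ hn0
  have m5 : Θ * n ≤ 1 / 8 * n := mul_le_mul_of_nonneg_right hΘ8 hn0
  have m6 : 0 ≤ Θ * n := mul_nonneg hΘ0.le hn0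
  refine ⟨?_, ?_, ?_, ?_, hin.trans hAn, by linarith, ?_, ?_, ?_, ?_, by linarith, by linarith⟩
  · have k1 : 8 * (n:ℝ) ≤ K * α * n := mul_le_mul_of_nonneg_right hK hn0
    have k2 : (K:ℝ) * (α * n / 2) ≤ K * xP := mul_le_mul_of_nonneg_left (by linarith) (Nat.cast_nonneg _)
    have k3 : (K:ℝ) ≤ n := by exact_mod_cast hKn
    have : (n:ℝ) + K ≤ K * xP := by linarith
    exact_mod_cast this
  · have : (len:ℝ) + 2 * θ ≤ 2 * n := by linarith
    exact_mod_cast this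
  · push_cast; linarith
  · have : (c₁:ℝ) ≤ 2 * xP := by linarith
    exact_mod_cast this
  · have : (c₁:ℝ) ≤ 3 * xI := by linarith
    exact_mod_cast this
  · have : (θ:ℝ) ≤ len := by linarith
    exact_mod_cast this
  · have : len - xI ≤ ⌊Θ / 32 * n⌋₊ := by
      apply Nat.le_floor
      rw [Nat.cast_sub i4]
      linarith
    omega
  · have : 8 * (xO:ℝ) ≤ θ := by linarith
    exact_mod_cast this
theorem arcs_case (α β : ℝ) (hα : 0 < α) (hα1 : α ≤ 1) (hβ : 0 < β) (hβ1 : β ≤ 1) :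
    ∃ κ : ℝ, 0 < κ ∧ κ ≤ 1 ∧ ∃ c : ℝ, 0 < c ∧ ∀ (p : ℕ) [Fact p.Prime] (A B : Finset (ZMod p)) (n c₁ c₂ : ℕ) (s s' : ZMod p) (len len' : ℕ),
      1 ≤ n → n ≤ p → #A ≤ n → #B ≤ n → α * n ≤ #A → α * n ≤ #B → (#A + #B : ℝ) ≤ (1 - β) * p →
      (len : ℝ) ≤ (1 + κ) * #A → (#(A \ arc 1 s len) : ℝ) ≤ κ * #A → (len' : ℝ) ≤ (1 + κ) * #B → (#(B \ arc 1 s' len') : ℝ) ≤ κ * #B →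
      c₁ ≤ #A → c₂ ≤ #B → c * n ≤ c₁ * c₂ →
      ∃ A' ⊆ A, ∃ B' ⊆ B, #A' ≤ c₁ ∧ #B' ≤ c₂ ∧ #A + #B ≤ #(A' + B') + 1 := by
  set K := ⌈8 / α⌉₊ with hKdef
  have hKα : 8 ≤ K * α := by
    have := Nat.le_ceil (8 / α)
    rw [div_le_iff₀ hα] at this
    exact this
  have hK1 : 1 ≤ K := by
    rw [hKdef]; exact Nat.one_le_ceil_iff.mpr (by positivity)
  obtain ⟨κ₁, hκ₁, C, hC, HP⟩ := arcP K hK1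
  set Θ := min (min (κ₁ / 8) (β / 16)) (α / 8) with hΘdef
  have hΘ0 : 0 < Θ := by rw [hΘdef]; apply lt_min (lt_min (by linarith) (by linarith)) (by linarith)
  have hΘκ : Θ ≤ κ₁ / 8 := (min_le_left _ _).trans (min_le_left _ _)
  have hΘβ : Θ ≤ β / 16 := (min_le_left _ _).trans (min_le_right _ _)
  have hΘα : Θ ≤ α / 8 := min_le_right _ _
  clear_value Θ
  have hΘ8 : Θ ≤ 1 / 8 := by linarith
  refine ⟨Θ / 64, by linarith, by linarith, C + K + 2000 / (Θ / 8) ^ 2, by positivity, ?_⟩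
  intro p _ A B n c₁ c₂ s s' len len' hn hnp hAn hBn hA hB hAB hlen hout hlen' hout' hc1 hc2 hcc
  set c : ℝ := C + K + 2000 / (Θ / 8) ^ 2 with hcdef
  have hn0 : (0:ℝ) < n := by exact_mod_cast hn
  have hcζ : 2000 ≤ c * (Θ / 8) ^ 2 := by
    have h1 : 2000 / (Θ / 8) ^ 2 ≤ c := by
      rw [hcdef]
      have : (0:ℝ) ≤ C := Nat.cast_nonneg _
      have : (0:ℝ) ≤ K := Nat.cast_nonneg _
      linarith
    rwa [div_le_iff₀ (by positivity)] at h1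
  have hcC : (C:ℝ) ≤ c := by
    have : (0:ℝ) < 2000 / (Θ / 8) ^ 2 := by positivity
    have : (0:ℝ) ≤ K := Nat.cast_nonneg _
    rw [hcdef]; linarith
  have hcK : (K:ℝ) ≤ c := by
    have : (0:ℝ) < 2000 / (Θ / 8) ^ 2 := by positivity
    have : (0:ℝ) ≤ C := Nat.cast_nonneg _
    rw [hcdef]; linarith
  clear_value c
  have hc0 : 0 < c := lt_of_lt_of_le (by exact_mod_cast hC) hcC
  have hcΘ : 128000 ≤ c * Θ := by
    have : c * (Θ / 8) ^ 2 = c * Θ * (Θ / 64) := by ring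
    have h2 : c * Θ * (Θ / 64) ≤ c * Θ * (1 / 512) := mul_le_mul_of_nonneg_left (by linarith) (by positivity)
    linarith
  have hc1n : (c₁:ℝ) ≤ n := by exact_mod_cast hc1.trans hAn
  have hc2n : (c₂:ℝ) ≤ n := by exact_mod_cast hc2.trans hBn
  have hcc1 : c ≤ c₁ := by
    have : (c₁:ℝ) * c₂ ≤ c₁ * n := mul_le_mul_of_nonneg_left hc2n (Nat.cast_nonneg _)
    exact le_of_mul_le_mul_right (hcc.trans this) hn0
  have hcc2 : c ≤ c₂ := by
    have : (c₁:ℝ) * c₂ ≤ n * c₂ := mul_le_mul_of_nonneg_right hc1n (Nat.cast_nonneg _)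
    have h2 : c * n ≤ c₂ * n := by linarith
    exact le_of_mul_le_mul_right h2 hn0
  have hcn : c ≤ n := hcc1.trans hc1n
  have hΘn : 128000 ≤ Θ * n := by
    have : c * Θ ≤ n * Θ := mul_le_mul_of_nonneg_right hcn hΘ0.le
    linarith
  have hc3 : 3 ≤ c := by
    have : c * Θ ≤ c * 1 := mul_le_mul_of_nonneg_left (by linarith) hc0.le
    linarith
  have h3 : 3 ≤ c₁ := by
    have : (3:ℝ) ≤ c₁ := by linarith
    exact_mod_cast this
  have h4 : 3 ≤ c₂ := by
    have : (3:ℝ) ≤ c₂ := by linarith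
    exact_mod_cast this
  have hKn : K ≤ n := by
    have : (K:ℝ) ≤ n := by linarith
    exact_mod_cast this
  have hCn : C * n ≤ c₁ * c₂ := by
    have : (C:ℝ) * n ≤ c * n := mul_le_mul_of_nonneg_right hcC hn0.le
    have h2 : (C:ℝ) * n ≤ c₁ * c₂ := this.trans hcc
    exact_mod_cast h2
  set θ := ⌊Θ * n⌋₊ with hθ
  have hθ1 : Θ * n / 2 ≤ θ := half_floor (by linarith)
  have hθ2 : (θ:ℝ) ≤ Θ * n := Nat.floor_le (by linarith)
  have hbθ : ∀ m : ℕ, c ≤ m → 48 * n ≤ θ * m := by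
    intro m hm
    have g1 : (Θ * n / 2) * c ≤ θ * m := mul_le_mul hθ1 hm hc0.le (Nat.cast_nonneg _)
    have g2 : 128000 * (n:ℝ) ≤ c * Θ * n := mul_le_mul_of_nonneg_right hcΘ hn0.le
    have : 48 * (n:ℝ) ≤ θ * m := by linarith
    exact_mod_cast this
  have hcθ : 288 * (n * n) ≤ θ * (c₁ * c₂) := by
    have g1 : (Θ * n / 2) * (c * n) ≤ θ * (c₁ * c₂) := mul_le_mul hθ1 hcc (by positivity) (Nat.cast_nonneg _)
    have g2 : 128000 * ((n:ℝ) * n) ≤ c * Θ * (n * n) := mul_le_mul_of_nonneg_right hcΘ (by positivity)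
    have g3 : 0 ≤ (n:ℝ) * n := by positivity
    have : 288 * ((n:ℝ) * n) ≤ θ * (c₁ * c₂) := by linarith
    exact_mod_cast this
  clear_value θ
  obtain ⟨a1, a2, a3, a4, a5, a6, a7, a8, a9, a10, a11, a12⟩ := side (s := s) (len := len) hα hα1 hΘ0 hΘα hΘκ hAn hA hlen hout hθ1 hθ2 hc1 hKα hKn
  obtain ⟨b1, b2, b3, b4, b5, b6, b7, b8, b9, b10, b11, b12⟩ := side (s := s') (len := len') hα hα1 hΘ0 hΘα hΘκ hBn hB hlen' hout' hθ1 hθ2 hc2 hKα hKn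
  have hpn : (n:ℝ) ≤ p := by exact_mod_cast hnp
  have hΘp : Θ * n ≤ β / 16 * p := by
    apply mul_le_mul hΘβ hpn hn0.le (by linarith)
  have hβp : 0 ≤ β * p := by positivity
  have hp4 : (len + 2 * θ) + (len' + 2 * θ) ≤ p := by
    have : ((len:ℝ) + 2 * θ) + (len' + 2 * θ) ≤ p := by linarith
    exact_mod_cast this
  have hABp : #(A ∩ arc 1 s len) + #(B ∩ arc 1 s' len') ≤ p := by
    have k1 : #(A ∩ arc 1 s len) ≤ len := (card_le_card inter_subset_right).trans (card_arc_le _ _ _)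
    have k2 : #(B ∩ arc 1 s' len') ≤ len' := (card_le_card inter_subset_right).trans (card_arc_le _ _ _)
    omega
  obtain ⟨A0, hA0, B0, hB0, q1, q2, q3⟩ := HP p n c₁ c₂ _ _ (s - (θ : ZMod p)) (s' - (θ : ZMod p)) (len + 2 * θ) (len' + 2 * θ)
    (inter_subset_right (s₁ := A)) (inter_subset_right (s₁ := B)) a1 b1 a2 b2 a3 b3 hp4 hCn a4 b4
  obtain ⟨Ar, hAr, Br, hBr, r1, r2, r3⟩ := rand_part (a := #A) (b := #B) (ζ := Θ / 8) (by linarith) (by linarith) hn a5 b5 hAn hBn hcζ hcc a6 b6 hABp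
    (by linarith) h3 h4 a7 b7 (by linarith)
  have hz : #A + #B ≤ #(Ar + Br) + ⌊Θ / 8 * n⌋₊ := by
    have : #A + #B - #(Ar + Br) ≤ ⌊Θ / 8 * n⌋₊ := by
      rcases Nat.le_total (#A + #B) (#(Ar + Br)) with h | h
      · rw [Nat.sub_eq_zero_of_le h]; exact Nat.zero_le _
      · apply Nat.le_floor
        rw [Nat.cast_sub h]; push_cast; linarith
    omega
  have hez : 2 * (⌊Θ / 32 * n⌋₊ + ⌊Θ / 8 * n⌋₊) ≤ θ := by
    have k1 : (⌊Θ / 32 * n⌋₊ : ℝ) ≤ Θ / 32 * n := Nat.floor_le (by positivity)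
    have k2 : (⌊Θ / 8 * n⌋₊ : ℝ) ≤ Θ / 8 * n := Nat.floor_le (by positivity)
    have : 2 * ((⌊Θ / 32 * n⌋₊ : ℝ) + ⌊Θ / 8 * n⌋₊) ≤ θ := by linarith
    exact_mod_cast this
  rcases Nat.le_total (#(B \ arc 1 (s' - (θ : ZMod p)) (len' + 2 * θ))) (#(A \ arc 1 (s - (θ : ZMod p)) (len + 2 * θ))) with hkk | hkk
  · exact arcs_core hAn hBn b8 (by omega) hA0 hB0 q1 q2 q3 hAr hBr r1 r2 hz hkk b9 hez h3 h4 b7 a10 (hbθ c₂ hcc2) hcθ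
  · obtain ⟨B', hB', A', hA', w1, w2, w3⟩ := arcs_core hBn hAn a8 (by omega) hB0 hA0 q2 q1 (by rw [add_comm B0 A0]; omega) hBr hAr r2 r1
      (z := ⌊Θ / 8 * n⌋₊) (by rw [add_comm Br Ar]; omega) hkk a9 hez h4 h3 a7 b10 (hbθ c₁ hcc1) (by rw [mul_comm c₂]; exact hcθ)
    exact ⟨A', hA', B', hB', w2, w1, by rw [add_comm A' B']; omega⟩
end D
end CD
namespace CD
theorem dl_add {p : ℕ} [Fact p.Prime] {d : ZMod p} (hd : d ≠ 0) (A B : Finset (ZMod p)) : dl d (A + B) = dl d A + dl d B := by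
  ext y
  rw [mem_dl hd, mem_add, mem_add]
  constructor
  · rintro ⟨a, ha, b, hb, e⟩
    refine ⟨d * a, ?_, d * b, ?_, ?_⟩
    · rw [mem_dl hd, inv_mul_cancel_left₀ hd]; exact ha
    · rw [mem_dl hd, inv_mul_cancel_left₀ hd]; exact hb
    · rw [← mul_add, e, mul_inv_cancel_left₀ hd]
  · rintro ⟨a, ha, b, hb, e⟩
    rw [mem_dl hd] at ha hb
    exact ⟨_, ha, _, hb, by rw [← mul_add, e]⟩
theorem arcs_case_d {p : ℕ} [Fact p.Prime] {A B : Finset (ZMod p)} {d s s' : ZMod p} {len len' c₁ c₂ : ℕ} (hd : d ≠ 0)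
    (H : ∃ A' ⊆ dl d⁻¹ A, ∃ B' ⊆ dl d⁻¹ B, #A' ≤ c₁ ∧ #B' ≤ c₂ ∧ #A + #B ≤ #(A' + B') + 1) :
    ∃ A' ⊆ A, ∃ B' ⊆ B, #A' ≤ c₁ ∧ #B' ≤ c₂ ∧ #A + #B ≤ #(A' + B') + 1 := by
  obtain ⟨A', hA', B', hB', h1, h2, h3⟩ := H
  have key : ∀ X Y : Finset (ZMod p), Y ⊆ dl d⁻¹ X → dl d Y ⊆ X := by
    intro X Y h y hy
    rw [mem_dl hd] at hy
    have := h hy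
    rw [mem_dl (inv_ne_zero hd), inv_inv, mul_inv_cancel_left₀ hd] at this
    exact this
  refine ⟨dl d A', key _ _ hA', dl d B', key _ _ hB', by rw [card_dl hd]; exact h1, by rw [card_dl hd]; exact h2, ?_⟩
  rw [← dl_add hd, card_dl hd]; exact h3
theorem main_le (α β : ℝ) (hα : 0 < α) (hα1 : α ≤ 1) (hβ : 0 < β) (hβ1 : β ≤ 1) :
    ∃ c : ℝ, 0 < c ∧ ∀ (p : ℕ) [Fact p.Prime] (A B : Finset (ZMod p)) (n c₁ c₂ : ℕ), n = max (#A) (#B) → 1 ≤ n →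
      α * #B ≤ #A → α * #A ≤ #B → (#A + #B : ℝ) ≤ (1 - β) * p → 1 ≤ c₁ → c₁ ≤ #A → 1 ≤ c₂ → c₂ ≤ #B → c * n ≤ c₁ * c₂ →
      ∃ A' ⊆ A, ∃ B' ⊆ B, #A' ≤ c₁ ∧ #B' ≤ c₂ ∧ #A + #B ≤ #(A' + B') + 1 := by
  obtain ⟨κ, hκ, hκ1, c₀, hc₀, HA⟩ := arcs_case α β hα hα1 hβ hβ1
  obtain ⟨η₀, hη₀, HS⟩ := struct α β κ hα hα1 hβ hβ1 hκ hκ1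
  set η := min η₀ 1 with hη
  have hη0 : 0 < η := lt_min hη₀ one_pos
  have hη1 : η ≤ 1 := min_le_right _ _
  have hηη : η ≤ η₀ := min_le_left _ _
  clear_value η
  refine ⟨c₀ + 8 / (η * α) ^ 2, by positivity, ?_⟩
  intro p _ A B n c₁ c₂ hnmax hn hBA hAB hp h1 h1A h2 h2B hcc
  set c := c₀ + 8 / (η * α) ^ 2 with hc
  have hn0 : (0:ℝ) < n := by exact_mod_cast hn
  have hδ0 : 0 < η * α := by positivity
  have hδ1 : η * α ≤ 1 := by
    have := mul_le_mul hη1 hα1 hα.le (by norm_num)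
    linarith
  have hc8 : 8 ≤ c * (η * α) ^ 2 := by
    have h1 : 8 / (η * α) ^ 2 ≤ c := by rw [hc]; linarith
    rwa [div_le_iff₀ (by positivity)] at h1
  have hcc₀ : c₀ ≤ c := by
    have : 0 < 8 / (η * α) ^ 2 := by positivity
    rw [hc]; linarith
  clear_value c
  have hAn : #A ≤ n := by rw [hnmax]; exact le_max_left _ _
  have hBn : #B ≤ n := by rw [hnmax]; exact le_max_right _ _
  have hnA : α * n ≤ #A := by
    rcases le_total (#A) (#B) with h | h
    · rw [hnmax, max_eq_right h]; exact hBA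
    · rw [hnmax, max_eq_left h]
      have : α * (#A : ℝ) ≤ 1 * #A := mul_le_mul_of_nonneg_right hα1 (Nat.cast_nonneg _)
      linarith
  have hnB : α * n ≤ #B := by
    rcases le_total (#A) (#B) with h | h
    · rw [hnmax, max_eq_right h]
      have : α * (#B : ℝ) ≤ 1 * #B := mul_le_mul_of_nonneg_right hα1 (Nat.cast_nonneg _)
      linarith
    · rw [hnmax, max_eq_left h]; exact hAB
  have hnp : n ≤ p := by
    have k : ∀ X : Finset (ZMod p), #X ≤ p := fun X => by
      have := Finset.card_le_univ X; rwa [ZMod.card] at this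
    rw [hnmax]; exact max_le (k A) (k B)
  have hAnr : (#A:ℝ) ≤ n := by exact_mod_cast hAn
  have hBnr : (#B:ℝ) ≤ n := by exact_mod_cast hBn
  have hc0 : 0 < c := by linarith
  have hcn : c ≤ n := by
    have g1 : (c₁:ℝ) * c₂ ≤ n * n := by exact_mod_cast Nat.mul_le_mul (h1A.trans hAn) (h2B.trans hBn)
    exact le_of_mul_le_mul_right (hcc.trans g1) hn0
  have hδn : 8 ≤ η * α * n := by
    have g1 : c * (η * α) ^ 2 = c * (η * α) * (η * α) := by ring
    have g2 : c * (η * α) * (η * α) ≤ c * (η * α) * 1 := mul_le_mul_of_nonneg_left hδ1 (by positivity)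
    have g3 : c * (η * α) ≤ n * (η * α) := mul_le_mul_of_nonneg_right hcn hδ0.le
    linarith
  set t := ⌊η * α * n⌋₊ with ht
  have ht1 : η * α * n / 2 ≤ t := half_floor (by linarith)
  have ht2 : (t:ℝ) ≤ η * α * n := Nat.floor_le (by linarith)
  have ht0 : 1 ≤ t := by
    have : (1:ℝ) ≤ t := by linarith
    exact_mod_cast this
  clear_value t
  have htX : ∀ X : Finset (ZMod p), α * n ≤ #X → (t:ℝ) ≤ η₀ * #X := by
    intro X hX
    have g1 : η * (α * n) ≤ η₀ * #X := mul_le_mul hηη hX (by positivity) hη₀.le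
    linarith
  by_cases hff : (ff t A B : ℝ) ≤ t * (#A + #B + t)
  · obtain ⟨d, hd, s, s', len, len', l1, l2, l3, l4⟩ := HS p t A B ht0 (htX A hnA) (htX B hnB) hBA hAB hp hff
    have hdi := inv_ne_zero hd
    have earc : ∀ (s : ZMod p) len, dl d⁻¹ (arc d s len) = arc 1 (d⁻¹ * s) len := by
      intro s len
      rw [dl_arc hdi, inv_mul_cancel₀ hd]
    have esd : ∀ (X : Finset (ZMod p)) (s : ZMod p) len, #(dl d⁻¹ X \ arc 1 (d⁻¹ * s) len) = #(X \ arc d s len) := by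
      intro X s len
      rw [← earc, ← dl_sdiff hdi, card_dl hdi]
    apply arcs_case_d (s := s) (s' := s') (len := len) (len' := len') hd
    have eA : #(dl d⁻¹ A) = #A := card_dl hdi A
    have eB : #(dl d⁻¹ B) = #B := card_dl hdi B
    have := HA p (dl d⁻¹ A) (dl d⁻¹ B) n c₁ c₂ (d⁻¹ * s) (d⁻¹ * s') len len' hn hnp
    rw [eA, eB, esd, esd] at this
    exact this hAn hBn hnA hnB hp l1 l2 l3 l4 h1A h2B ((mul_le_mul_of_nonneg_right hcc₀ hn0.le).trans hcc)
  · push Not at hff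
    obtain ⟨A', hA', B', hB', e1, e2, h⟩ := random_ff (A := A) (B := B) (t := t) h1 h1A h2 h2B ht0
    refine ⟨A', hA', B', hB', by omega, by omega, ?_⟩
    set N := #(A' + B') with hN
    set a := #A
    set b := #B
    have hm1r : (1:ℝ) ≤ c₁ := by exact_mod_cast h1
    have hm2r : (1:ℝ) ≤ c₂ := by exact_mod_cast h2
    have hmm : (0:ℝ) < c₁ * c₂ := mul_pos (by linarith) (by linarith)
    set τ : ℝ := (a * b : ℝ) / (c₁ * c₂) with hτ
    have hτ0 : 0 ≤ τ := by rw [hτ]; positivity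
    have hτc : c * τ ≤ n := by
      rw [hτ, ← mul_div_assoc, div_le_iff₀ hmm]
      have g1 : (a * b : ℝ) ≤ n * n := by
        have := Nat.mul_le_mul hAn hBn
        exact_mod_cast this
      have g2 : c * (a * b : ℝ) ≤ c * (n * n) := mul_le_mul_of_nonneg_left g1 hc0.le
      have g3 : (c * n) * n ≤ (c₁ * c₂) * (n:ℝ) := mul_le_mul_of_nonneg_right hcc hn0.le
      linarith
    have hτζ : 8 * τ ≤ n * (η * α) ^ 2 := by
      have g1 : 8 * τ ≤ c * (η * α) ^ 2 * τ := mul_le_mul_of_nonneg_right hc8 hτ0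
      have g2 : c * τ * (η * α) ^ 2 ≤ n * (η * α) ^ 2 := mul_le_mul_of_nonneg_right hτc (by positivity)
      linarith
    by_contra! hlt
    have hltr : (N:ℝ) ≤ a + b := by
      have : N ≤ a + b := by omega
      exact_mod_cast this
    have f1 : (N:ℝ) * t ≤ (a + b) * t := mul_le_mul_of_nonneg_right hltr (by positivity)
    have f2 : (N:ℝ) * τ ≤ (2 * n) * τ := mul_le_mul_of_nonneg_right (by linarith) hτ0
    have f4 : (η * α * n / 2) * (η * α * n / 2) ≤ t * t := mul_le_mul ht1 ht1 (by positivity) (Nat.cast_nonneg _)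
    have f5 : n * (8 * τ) ≤ n * (n * (η * α) ^ 2) := mul_le_mul_of_nonneg_left hτζ hn0.le
    linarith
end CD
theorem stmt1 (α β : ℝ) (hα : 0 < α) (hβ : 0 < β) :
    ∃ c : ℝ, 0 < c ∧
      ∀ (p : ℕ), p.Prime →
        ∀ A B : Finset (ZMod p), A.Nonempty → B.Nonempty →
          α * B.card ≤ (A.card : ℝ) → (A.card : ℝ) ≤ α⁻¹ * B.card →
          (A.card : ℝ) + B.card ≤ (1 - β) * p →
          ∀ c₁ c₂ : ℕ, 1 ≤ c₁ → c₁ ≤ A.card → 1 ≤ c₂ → c₂ ≤ B.card →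
            c * (max A.card B.card : ℕ) ≤ (c₁ * c₂ : ℝ) →
            ∃ A' ⊆ A, ∃ B' ⊆ B, A'.card = c₁ ∧ B'.card = c₂ ∧
              (A.card : ℤ) + B.card - 1 ≤ ((A' + B').card : ℤ) := by
  obtain ⟨c, hc, H⟩ := CD.main_le (min α 1) (min β 1) (lt_min hα one_pos) (min_le_right _ _) (lt_min hβ one_pos) (min_le_right _ _)
  refine ⟨c, hc, ?_⟩
  intro p hp A B hA hB h1 h2 h3 c₁ c₂ k1 k2 k3 k4 hcc
  have : Fact p.Prime := ⟨hp⟩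
  have hm : min α 1 ≤ α := min_le_left _ _
  have hmb : min β 1 ≤ β := min_le_left _ _
  have g2 : α * A.card ≤ (B.card : ℝ) := by
    have := mul_le_mul_of_nonneg_left h2 hα.le
    rwa [mul_inv_cancel_left₀ hα.ne'] at this
  have hmax : 1 ≤ max A.card B.card := le_max_of_le_left (card_pos.mpr hA)
  obtain ⟨A', hA', B', hB', q1, q2, q3⟩ := H p A B (max A.card B.card) c₁ c₂ rfl hmax
    ((mul_le_mul_of_nonneg_right hm (Nat.cast_nonneg _)).trans h1)
    ((mul_le_mul_of_nonneg_right hm (Nat.cast_nonneg _)).trans g2)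
    (h3.trans (mul_le_mul_of_nonneg_right (by linarith) (Nat.cast_nonneg _))) k1 k2 k3 k4 hcc
  obtain ⟨A'', x1, x2, x3⟩ := Finset.exists_subsuperset_card_eq hA' q1 k2
  obtain ⟨B'', y1, y2, y3⟩ := Finset.exists_subsuperset_card_eq hB' q2 k4
  refine ⟨A'', x2, B'', y2, x3, y3, ?_⟩
  have := Finset.card_le_card (Finset.add_subset_add x1 y1)
  omega
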